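/- Let h be a weak solution of the gravity water-wave problem that is 2π-periodic in the variable q. Then for every m ∈ ℕ the iterated partial derivative ∂_q^m h exists on Ω̄ and belongs to C^{1+α}(Ω̄); moreover there exists a constant L > 1 such that ‖∂_q^m h‖_{1+α} ≤ L^{m−2}·(m−3)! for every integer m ≥ 3. -/

import Mathlib

open MeasureTheory Set Real Filter

noncomputable section

/-- The closed strip `Ω̄ = ℝ × [p₀, 0]`. -/
def Obar (p₀ : ℝ) : Set (ℝ × ℝ) := Set.univ ×ˢ Set.Icc p₀ 0

/-- The open strip `Ω = ℝ × (p₀, 0)`. -/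
def Oset (p₀ : ℝ) : Set (ℝ × ℝ) := Set.univ ×ˢ Set.Ioo p₀ 0

/-- Partial derivative in the horizontal variable `q`. -/
def pd_q (f : ℝ × ℝ → ℝ) : ℝ × ℝ → ℝ := fun x => deriv (fun q => f (q, x.2)) x.1

/-- Partial derivative in the vertical variable `p` (within `[p₀, 0]`). -/
def pd_p (p₀ : ℝ) (f : ℝ × ℝ → ℝ) : ℝ × ℝ → ℝ :=
  fun x => derivWithin (fun p => f (x.1, p)) (Set.Icc p₀ 0) x.2

/-- Iterated partial derivative `∂_q^m`. -/
def pd_q_iter (m : ℕ) (f : ℝ × ℝ → ℝ) : ℝ × ℝ → ℝ := pd_q^[m] f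

/-- Bounded and uniformly `α`-Hölder continuous on `s`: membership in `C^α(s)`. -/
def MemCα (α : ℝ) (s : Set (ℝ × ℝ)) (f : ℝ × ℝ → ℝ) : Prop :=
  (∃ M : ℝ, ∀ x ∈ s, |f x| ≤ M) ∧
  (∃ C : ℝ, ∀ x ∈ s, ∀ y ∈ s, |f x - f y| ≤ C * dist x y ^ α)

/-- Membership in `C^{1+α}(Ω̄)`: continuously differentiable on `Ω̄` with `f`, `∂_q f`, `∂_p f`
bounded and uniformly `α`-Hölder continuous on `Ω̄`. -/
def MemC1α (p₀ α : ℝ) (f : ℝ × ℝ → ℝ) : Prop :=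
  ContDiffOn ℝ 1 f (Obar p₀) ∧ MemCα α (Obar p₀) f ∧
    MemCα α (Obar p₀) (pd_q f) ∧ MemCα α (Obar p₀) (pd_p p₀ f)

/-- Supremum norm on `s`. -/
def supNorm (s : Set (ℝ × ℝ)) (f : ℝ × ℝ → ℝ) : ℝ :=
  sSup {c | ∃ x ∈ s, c = |f x|}

/-- `α`-Hölder seminorm on `s`. -/
def holderSemi (α : ℝ) (s : Set (ℝ × ℝ)) (f : ℝ × ℝ → ℝ) : ℝ :=
  sSup {c | ∃ x ∈ s, ∃ y ∈ s, x ≠ y ∧ c = |f x - f y| / dist x y ^ α}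

/-- The `C^{1+α}(Ω̄)` norm: sup norms and `α`-Hölder seminorms of the function
and of its first-order partial derivatives. -/
def norm1α (p₀ α : ℝ) (f : ℝ × ℝ → ℝ) : ℝ :=
  supNorm (Obar p₀) f + supNorm (Obar p₀) (pd_q f) + supNorm (Obar p₀) (pd_p p₀ f) +
  holderSemi α (Obar p₀) f + holderSemi α (Obar p₀) (pd_q f) +
  holderSemi α (Obar p₀) (pd_p p₀ f)

/-- Test functions: `C¹` with compact support contained in `ℝ × (p₀, 0)`. -/
def IsTest (p₀ : ℝ) (ψ : ℝ × ℝ → ℝ) : Prop :=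
  ContDiff ℝ 1 ψ ∧ HasCompactSupport ψ ∧ tsupport ψ ⊆ Oset p₀

/-- `h` is a weak solution of the gravity water-wave problem \eqref{H}-\eqref{CH}. -/
structure IsWeakSolution (p₀ g Q α : ℝ) (γ : ℝ → ℝ) (h : ℝ × ℝ → ℝ) : Prop where
  reg : MemC1α p₀ α h
  infpos : ∃ δ > 0, ∀ x ∈ Oset p₀, δ ≤ pd_p p₀ h x
  weak : ∀ ψ : ℝ × ℝ → ℝ, IsTest p₀ ψ →
    (∫ x in Oset p₀,
      ((pd_q h x / pd_p p₀ h x) * pd_q ψ x -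
        ((∫ s in (0:ℝ)..x.2, γ s) + (1 + (pd_q h x) ^ 2) / (2 * (pd_p p₀ h x) ^ 2)) *
          pd_p p₀ ψ x)) = 0
  top : ∀ q : ℝ, 1 + (pd_q h (q, 0)) ^ 2 + (2 * g * h (q, 0) - Q) * (pd_p p₀ h (q, 0)) ^ 2 = 0
  bottom : ∀ q : ℝ, h (q, p₀) = 0

end

/-- The real-linear embedding of the plane into `ℂ`. -/
def toC (x : ℝ × ℝ) : ℂ := (x.1 : ℂ) + Complex.I * (x.2 : ℂ)

theorem continuous_toC : Continuous toC := by unfold toC; fun_prop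

theorem norm_le_norm_toC (x : ℝ × ℝ) : ‖x‖ ≤ ‖toC x‖ := by
  have h1 : (toC x).re = x.1 := by simp [toC]
  have h2 : (toC x).im = x.2 := by simp [toC]
  refine max_le ?_ ?_
  · have := Complex.abs_re_le_norm (toC x); rwa [h1] at this
  · have := Complex.abs_im_le_norm (toC x); rwa [h2] at this

theorem norm_toC_le (x : ℝ × ℝ) : ‖toC x‖ ≤ 2 * ‖x‖ := by
  unfold toC
  have h1 : ‖x.1‖ ≤ ‖x‖ := norm_fst_le x
  have h2 : ‖x.2‖ ≤ ‖x‖ := norm_snd_le x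
  calc _ ≤ ‖(x.1 : ℂ)‖ + ‖Complex.I * (x.2 : ℂ)‖ := norm_add_le _ _
    _ ≤ _ := by simp at *; linarith

theorem toC_sub (x y : ℝ × ℝ) : toC (x - y) = toC x - toC y := by
  simp [toC]; ring

theorem ae_snd_ne (l : ℝ) : ∀ᵐ p : ℝ × ℝ, p.2 ≠ l := by
  have h : (volume : Measure (ℝ × ℝ)) (Set.univ ×ˢ {l}) = 0 := by
    rw [Measure.volume_eq_prod, Measure.prod_prod]; simp
  refine measure_mono_null (fun p hp => ?_) h
  simpa using hp

theorem integrable_of_bounded_off_line {G : ℝ × ℝ → ℂ} {D : ℝ × ℝ → ℂ} {l B : ℝ}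
    (hc : HasCompactSupport G) (hm : AEStronglyMeasurable D volume)
    (hB : ∀ p : ℝ × ℝ, p.2 ≠ l → p ∈ tsupport G → ‖D p‖ ≤ B)
    (h0 : ∀ p : ℝ × ℝ, p.2 ≠ l → p ∉ tsupport G → D p = 0) : Integrable D := by
  have hK : IsCompact (tsupport G) := hc
  have h1 : Integrable ((tsupport G).indicator (fun _ => B)) :=
    (integrable_indicator_iff hK.measurableSet).2 (by
      exact integrableOn_const hK.measure_lt_top.ne (C := B) (by simp))
  refine h1.mono' hm ?_
  filter_upwards [ae_snd_ne l] with p hp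
  by_cases hpG : p ∈ tsupport G
  · simpa [hpG] using hB p hp hpG
  · simp [hpG, h0 p hp hpG]

theorem integral_deriv_fst_eq_zero {G D : ℝ × ℝ → ℂ} {l B : ℝ} (hG : Continuous G)
    (hc : HasCompactSupport G)
    (hD : ∀ p : ℝ × ℝ, p.2 ≠ l → HasDerivAt (fun t : ℝ => G (t, p.2)) (D p) p.1)
    (hB : ∀ p : ℝ × ℝ, p.2 ≠ l → p ∈ tsupport G → ‖D p‖ ≤ B) :
    Integrable D ∧ ∫ p, D p = 0 := by
  have hm : AEStronglyMeasurable D volume := by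
    have h1 : Measurable fun p : ℝ × ℝ => deriv (fun t : ℝ => G (t, p.1)) p.2 := by
      refine measurable_deriv_with_param (f := fun y t => G (t, y)) ?_
      exact hG.comp (continuous_snd.prodMk continuous_fst)
    have h2 : Measurable fun p : ℝ × ℝ => deriv (fun t : ℝ => G (t, p.2)) p.1 :=
      h1.comp measurable_swap
    refine h2.aestronglyMeasurable.congr ?_
    filter_upwards [ae_snd_ne l] with p hp using (hD p hp).deriv
  have hi : Integrable D := by
    refine integrable_of_bounded_off_line hc hm hB fun p hp hpG => ?_
    have h1 : ∀ᶠ t : ℝ in nhds p.1, G (t, p.2) = 0 := by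
      have : ∀ᶠ q in nhds p, q ∉ tsupport G := (isClosed_tsupport G).isOpen_compl.mem_nhds hpG
      have hcont : Tendsto (fun t : ℝ => (t, p.2)) (nhds p.1) (nhds p) :=
        Continuous.tendsto' (by fun_prop) _ _ rfl
      filter_upwards [hcont.eventually this] with t ht using image_eq_zero_of_notMem_tsupport ht
    have h2 : HasDerivAt (fun t : ℝ => G (t, p.2)) 0 p.1 :=
      (hasDerivAt_const p.1 (0:ℂ)).congr_of_eventuallyEq h1
    exact (hD p hp).unique h2
  refine ⟨hi, ?_⟩
  rw [Measure.volume_eq_prod, integral_prod_symm _ (by rwa [← Measure.volume_eq_prod])]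
  have hi' := hi
  rw [Measure.volume_eq_prod] at hi'
  have h3 : ∀ᵐ y : ℝ, ∫ x : ℝ, D (x, y) = 0 := by
    have hne : ∀ᵐ y : ℝ, y ≠ l := by simp [ae_iff]
    filter_upwards [hi'.prod_left_ae, hne] with y hy hyl
    refine integral_eq_zero_of_hasDerivAt_of_integrable (f := fun t => G (t, y))
      (fun x => hD (x, y) hyl) hy ?_
    refine Continuous.integrable_of_hasCompactSupport (by fun_prop) ?_
    have hK : IsCompact (Prod.fst '' tsupport G) := hc.image continuous_fst
    refine HasCompactSupport.intro hK fun x hx => ?_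
    refine image_eq_zero_of_notMem_tsupport fun h => hx ⟨_, h, rfl⟩
  rw [integral_congr_ae h3]; simp

theorem integral_deriv_snd_eq_zero {G D : ℝ × ℝ → ℂ} {l B : ℝ} (hG : Continuous G)
    (hc : HasCompactSupport G)
    (hD : ∀ p : ℝ × ℝ, p.2 ≠ l → HasDerivAt (fun t : ℝ => G (p.1, t)) (D p) p.2)
    (hB : ∀ p : ℝ × ℝ, p.2 ≠ l → p ∈ tsupport G → ‖D p‖ ≤ B) :
    Integrable D ∧ ∫ p, D p = 0 := by
  have hm : AEStronglyMeasurable D volume := by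
    have h1 : Measurable fun p : ℝ × ℝ => deriv (fun t : ℝ => G (p.1, t)) p.2 :=
      measurable_deriv_with_param (f := fun y t => G (y, t)) hG
    refine h1.aestronglyMeasurable.congr ?_
    filter_upwards [ae_snd_ne l] with p hp using (hD p hp).deriv
  have hi : Integrable D := by
    refine integrable_of_bounded_off_line hc hm hB fun p hp hpG => ?_
    have h1 : ∀ᶠ t : ℝ in nhds p.2, G (p.1, t) = 0 := by
      have : ∀ᶠ q in nhds p, q ∉ tsupport G := (isClosed_tsupport G).isOpen_compl.mem_nhds hpG
      have hcont : Tendsto (fun t : ℝ => (p.1, t)) (nhds p.2) (nhds p) :=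
        Continuous.tendsto' (by fun_prop) _ _ rfl
      filter_upwards [hcont.eventually this] with t ht using image_eq_zero_of_notMem_tsupport ht
    have h2 : HasDerivAt (fun t : ℝ => G (p.1, t)) 0 p.2 :=
      (hasDerivAt_const p.2 (0:ℂ)).congr_of_eventuallyEq h1
    exact (hD p hp).unique h2
  refine ⟨hi, ?_⟩
  have hi' := hi
  rw [Measure.volume_eq_prod] at hi'
  rw [Measure.volume_eq_prod, integral_prod _ hi']
  obtain ⟨R, hR⟩ := hc.isBounded.subset_closedBall (0 : ℝ × ℝ)
  have hout : ∀ x t : ℝ, R < |t| → G (x, t) = 0 := by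
    intro x t ht
    refine image_eq_zero_of_notMem_tsupport fun h => ?_
    have h1 := hR h
    rw [mem_closedBall_zero_iff] at h1
    have h2 : ‖t‖ ≤ ‖(x, t)‖ := norm_snd_le (x, t)
    rw [Real.norm_eq_abs] at h2
    linarith
  have h3 : ∀ᵐ x : ℝ, ∫ y : ℝ, D (x, y) = 0 := by
    filter_upwards [hi'.prod_right_ae] with x hx
    have hlim : Tendsto (fun n : ℕ => ∫ y in (-(n:ℝ))..n, D (x, y)) atTop
        (nhds (∫ y : ℝ, D (x, y))) :=
      intervalIntegral_tendsto_integral hx (tendsto_neg_atTop_atBot.comp tendsto_natCast_atTop_atTop)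
        tendsto_natCast_atTop_atTop
    refine tendsto_nhds_unique hlim ?_
    refine tendsto_const_nhds.congr' ?_
    filter_upwards [(tendsto_natCast_atTop_atTop (R := ℝ)).eventually_gt_atTop R,
      (tendsto_natCast_atTop_atTop (R := ℝ)).eventually_gt_atTop 0] with n hn hn0
    rw [integral_eq_of_hasDerivAt_off_countable (fun t => G (x, t)) (fun t => D (x, t))
      (s := {l}) (by simp) (by fun_prop) (fun t ht => hD (x, t) (by simpa using ht.2))
      hx.intervalIntegrable]
    rw [hout x n (by rwa [abs_of_pos hn0]), hout x (-n) (by rwa [abs_neg, abs_of_pos hn0])]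
    simp
  rw [integral_congr_ae h3]; simp

/-- The regularized Cauchy kernel. -/
noncomputable def cauchyReg (δ : ℝ) (x : ℝ × ℝ) : ℂ :=
  ((x.1 : ℂ) - Complex.I * (x.2 : ℂ)) * (((x.1 ^ 2 + x.2 ^ 2 + δ ^ 2 : ℝ))⁻¹ : ℝ)

/-- The Poisson-type approximate identity `(∂₁ + i∂₂) cauchyReg`. -/
noncomputable def poissonReg (δ : ℝ) (x : ℝ × ℝ) : ℝ :=
  2 * δ ^ 2 * ((x.1 ^ 2 + x.2 ^ 2 + δ ^ 2) ^ 2)⁻¹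

theorem denom_pos {δ : ℝ} (hδ : 0 < δ) (x : ℝ × ℝ) : 0 < x.1 ^ 2 + x.2 ^ 2 + δ ^ 2 := by
  positivity

theorem continuous_cauchyReg {δ : ℝ} (hδ : 0 < δ) : Continuous (cauchyReg δ) := by
  unfold cauchyReg
  have : Continuous fun x : ℝ × ℝ => (x.1 ^ 2 + x.2 ^ 2 + δ ^ 2)⁻¹ :=
    Continuous.inv₀ (by fun_prop) fun x => (denom_pos hδ x).ne'
  fun_prop

theorem continuous_poissonReg {δ : ℝ} (hδ : 0 < δ) : Continuous (poissonReg δ) := by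
  unfold poissonReg
  have : Continuous fun x : ℝ × ℝ => ((x.1 ^ 2 + x.2 ^ 2 + δ ^ 2) ^ 2)⁻¹ :=
    Continuous.inv₀ (by fun_prop) fun x => (pow_pos (denom_pos hδ x) 2).ne'
  fun_prop

/-- `∂₁` of the regularized kernel. -/
noncomputable def cauchyRegX (δ : ℝ) (x : ℝ × ℝ) : ℂ :=
  (((x.1 ^ 2 + x.2 ^ 2 + δ ^ 2 : ℝ))⁻¹ : ℝ) -
    ((x.1 : ℂ) - Complex.I * (x.2 : ℂ)) *
      ((2 * x.1 * ((x.1 ^ 2 + x.2 ^ 2 + δ ^ 2) ^ 2)⁻¹ : ℝ) : ℂ)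

/-- `∂₂` of the regularized kernel. -/
noncomputable def cauchyRegY (δ : ℝ) (x : ℝ × ℝ) : ℂ :=
  -Complex.I * (((x.1 ^ 2 + x.2 ^ 2 + δ ^ 2 : ℝ))⁻¹ : ℝ) -
    ((x.1 : ℂ) - Complex.I * (x.2 : ℂ)) *
      ((2 * x.2 * ((x.1 ^ 2 + x.2 ^ 2 + δ ^ 2) ^ 2)⁻¹ : ℝ) : ℂ)

theorem continuous_cauchyRegX {δ : ℝ} (hδ : 0 < δ) : Continuous (cauchyRegX δ) := by
  unfold cauchyRegX
  have h1 : Continuous fun x : ℝ × ℝ => (x.1 ^ 2 + x.2 ^ 2 + δ ^ 2)⁻¹ :=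
    Continuous.inv₀ (by fun_prop) fun x => (denom_pos hδ x).ne'
  have : Continuous fun x : ℝ × ℝ => ((x.1 ^ 2 + x.2 ^ 2 + δ ^ 2) ^ 2)⁻¹ :=
    Continuous.inv₀ (by fun_prop) fun x => (pow_pos (denom_pos hδ x) 2).ne'
  fun_prop

theorem continuous_cauchyRegY {δ : ℝ} (hδ : 0 < δ) : Continuous (cauchyRegY δ) := by
  unfold cauchyRegY
  have h1 : Continuous fun x : ℝ × ℝ => (x.1 ^ 2 + x.2 ^ 2 + δ ^ 2)⁻¹ :=
    Continuous.inv₀ (by fun_prop) fun x => (denom_pos hδ x).ne'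
  have : Continuous fun x : ℝ × ℝ => ((x.1 ^ 2 + x.2 ^ 2 + δ ^ 2) ^ 2)⁻¹ :=
    Continuous.inv₀ (by fun_prop) fun x => (pow_pos (denom_pos hδ x) 2).ne'
  fun_prop

theorem hasDerivAt_cauchyReg_fst {δ : ℝ} (hδ : 0 < δ) (z p : ℝ × ℝ) :
    HasDerivAt (fun t : ℝ => cauchyReg δ ((t, p.2) - z)) (cauchyRegX δ (p - z)) p.1 := by
  have hpos := denom_pos hδ (p - z)
  simp only [Prod.fst_sub, Prod.snd_sub] at hpos
  have h1 : HasDerivAt (fun t : ℝ => (t - z.1) ^ 2 + (p.2 - z.2) ^ 2 + δ ^ 2)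
      (2 * (p.1 - z.1)) p.1 := by
    have := (((hasDerivAt_id p.1).sub_const z.1).pow 2).add_const ((p.2 - z.2) ^ 2)
    simpa using this.add_const (δ ^ 2)
  have h2 := (h1.fun_inv hpos.ne').ofReal_comp
  have h3 : HasDerivAt (fun t : ℝ => ((t - z.1 : ℝ) : ℂ) - Complex.I * ((p.2 - z.2 : ℝ) : ℂ))
      1 p.1 := by
    have := ((hasDerivAt_id p.1).sub_const z.1).ofReal_comp
    simpa using this.sub_const (Complex.I * ((p.2 - z.2 : ℝ) : ℂ))
  refine (h3.fun_mul h2).congr_deriv ?_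
  simp only [cauchyRegX, Prod.fst_sub, Prod.snd_sub]
  push_cast
  ring

theorem hasDerivAt_cauchyReg_snd {δ : ℝ} (hδ : 0 < δ) (z p : ℝ × ℝ) :
    HasDerivAt (fun t : ℝ => cauchyReg δ ((p.1, t) - z)) (cauchyRegY δ (p - z)) p.2 := by
  have hpos := denom_pos hδ (p - z)
  simp only [Prod.fst_sub, Prod.snd_sub] at hpos
  have h1 : HasDerivAt (fun t : ℝ => (p.1 - z.1) ^ 2 + (t - z.2) ^ 2 + δ ^ 2)
      (2 * (p.2 - z.2)) p.2 := by
    have := (((hasDerivAt_id p.2).sub_const z.2).pow 2).const_add ((p.1 - z.1) ^ 2)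
    simpa using this.add_const (δ ^ 2)
  have h2 := (h1.fun_inv hpos.ne').ofReal_comp
  have h3 : HasDerivAt (fun t : ℝ => ((p.1 - z.1 : ℝ) : ℂ) - Complex.I * ((t - z.2 : ℝ) : ℂ))
      (-Complex.I) p.2 := by
    have := ((hasDerivAt_id p.2).sub_const z.2).ofReal_comp
    simpa using (this.const_mul Complex.I).const_sub (((p.1 - z.1 : ℝ) : ℂ))
  refine (h3.fun_mul h2).congr_deriv ?_
  simp only [cauchyRegY, Prod.fst_sub, Prod.snd_sub]
  push_cast
  ring

theorem cauchyReg_dbar {δ : ℝ} (hδ : 0 < δ) (x : ℝ × ℝ) :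
    cauchyRegX δ x + Complex.I * cauchyRegY δ x = (poissonReg δ x : ℂ) := by
  have hpos := denom_pos hδ x
  have hne : ((x.1 : ℂ) ^ 2 + (x.2 : ℂ) ^ 2 + (δ : ℂ) ^ 2) ≠ 0 := by
    have := hpos.ne'; exact_mod_cast this
  simp only [cauchyRegX, cauchyRegY, poissonReg]
  push_cast
  field_simp
  ring_nf
  simp only [Complex.I_sq]
  ring

theorem integral_dbar_mul_cauchyReg {g gx gy : ℝ × ℝ → ℂ} {l B δ : ℝ} (hδ : 0 < δ)
    (hg : Continuous g) (hc : HasCompactSupport g)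
    (hx : ∀ p : ℝ × ℝ, p.2 ≠ l → HasDerivAt (fun t : ℝ => g (t, p.2)) (gx p) p.1)
    (hy : ∀ p : ℝ × ℝ, p.2 ≠ l → HasDerivAt (fun t : ℝ => g (p.1, t)) (gy p) p.2)
    (hBx : ∀ p : ℝ × ℝ, p.2 ≠ l → ‖gx p‖ ≤ B) (hBy : ∀ p : ℝ × ℝ, p.2 ≠ l → ‖gy p‖ ≤ B)
    (z : ℝ × ℝ) :
    ∫ p, (gx p + Complex.I * gy p) * cauchyReg δ (p - z) =
      -∫ p, g p * (poissonReg δ (p - z) : ℂ) := by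
  have hcG : HasCompactSupport fun p => g p * cauchyReg δ (p - z) := hc.mul_right
  have hKc : Continuous fun p : ℝ × ℝ => cauchyReg δ (p - z) :=
    (continuous_cauchyReg hδ).comp (by fun_prop)
  have hKx : Continuous fun p : ℝ × ℝ => cauchyRegX δ (p - z) :=
    (continuous_cauchyRegX hδ).comp (by fun_prop)
  have hKy : Continuous fun p : ℝ × ℝ => cauchyRegY δ (p - z) :=
    (continuous_cauchyRegY hδ).comp (by fun_prop)
  have hP : Continuous fun p : ℝ × ℝ => (poissonReg δ (p - z) : ℂ) :=
    Complex.continuous_ofReal.comp ((continuous_poissonReg hδ).comp (by fun_prop))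
  have hsub : tsupport (fun p => g p * cauchyReg δ (p - z)) ⊆ tsupport g :=
    closure_mono (Function.support_mul_subset_left _ _)
  obtain ⟨c0, h0⟩ := (show IsCompact (tsupport g) from hc).exists_bound_of_continuousOn
    hKc.continuousOn
  obtain ⟨c1, h1⟩ := (show IsCompact (tsupport g) from hc).exists_bound_of_continuousOn
    (hg.mul hKx).continuousOn
  obtain ⟨c2, h2⟩ := (show IsCompact (tsupport g) from hc).exists_bound_of_continuousOn
    (hg.mul hKy).continuousOn
  have hX := integral_deriv_fst_eq_zero (B := B * c0 + c1) (l := l)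
    (G := fun p => g p * cauchyReg δ (p - z))
    (D := fun p => gx p * cauchyReg δ (p - z) + g p * cauchyRegX δ (p - z))
    (hg.mul hKc) hcG
    (fun p hp => (hx p hp).fun_mul (hasDerivAt_cauchyReg_fst hδ z p))
    (fun p hp hps => by
      have hps' := hsub hps
      refine (norm_add_le _ _).trans (add_le_add ?_ (h1 p hps'))
      rw [norm_mul]
      exact mul_le_mul (hBx p hp) (h0 p hps') (norm_nonneg _)
        ((norm_nonneg _).trans (hBx p hp)))
  have hY := integral_deriv_snd_eq_zero (B := B * c0 + c2) (l := l)
    (G := fun p => g p * cauchyReg δ (p - z))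
    (D := fun p => gy p * cauchyReg δ (p - z) + g p * cauchyRegY δ (p - z))
    (hg.mul hKc) hcG
    (fun p hp => (hy p hp).fun_mul (hasDerivAt_cauchyReg_snd hδ z p))
    (fun p hp hps => by
      have hps' := hsub hps
      refine (norm_add_le _ _).trans (add_le_add ?_ (h2 p hps'))
      rw [norm_mul]
      exact mul_le_mul (hBy p hp) (h0 p hps') (norm_nonneg _)
        ((norm_nonneg _).trans (hBy p hp)))
  have hgP : Integrable fun p => g p * (poissonReg δ (p - z) : ℂ) :=
    (hg.mul hP).integrable_of_hasCompactSupport hc.mul_right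
  have hsum : (fun p => (gx p + Complex.I * gy p) * cauchyReg δ (p - z)) = fun p =>
      ((gx p * cauchyReg δ (p - z) + g p * cauchyRegX δ (p - z)) +
        Complex.I * (gy p * cauchyReg δ (p - z) + g p * cauchyRegY δ (p - z))) -
        g p * (poissonReg δ (p - z) : ℂ) := by
    funext p
    rw [← cauchyReg_dbar hδ (p - z)]
    ring
  rw [hsum, integral_sub _ hgP, integral_add hX.1 (hY.1.const_mul _), hX.2,
    integral_const_mul, hY.2]
  · simp
  · exact hX.1.add (hY.1.const_mul _)

theorem integrable_inv_norm_ball (r : ℝ) :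
    Integrable ((Metric.ball (0 : ℝ × ℝ) r).indicator fun x => ‖x‖⁻¹) := by
  have h := integrable_fun_norm_addHaar (volume : Measure (ℝ × ℝ))
    (f := (Set.Iio r).indicator fun y : ℝ => y⁻¹)
  have h2 : IntegrableOn (fun y : ℝ => y ^ (Module.finrank ℝ (ℝ × ℝ) - 1) •
      (Set.Iio r).indicator (fun y : ℝ => y⁻¹) y) (Ioi 0) := by
    have h3 : IntegrableOn ((Set.Iio r).indicator fun _ : ℝ => (1:ℝ)) (Ioi 0) := by
      rw [IntegrableOn, integrable_indicator_iff measurableSet_Iio, IntegrableOn,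
        Measure.restrict_restrict measurableSet_Iio]
      refine integrableOn_const (C := (1:ℝ)) ?_ (by simp)
      have : Iio r ∩ Ioi (0:ℝ) = Ioo 0 r := by ext; simp [and_comm]
      rw [this]; simp
    refine h3.congr_fun (fun y hy => ?_) measurableSet_Ioi
    have hy0 : y ≠ 0 := ne_of_gt hy
    simp only [Module.finrank_prod, Module.finrank_self, smul_eq_mul]
    by_cases hyr : y < r <;> simp [hyr, hy0]
  refine (h.2 h2).congr (Eventually.of_forall fun x => ?_)
  by_cases hx : ‖x‖ < r <;> simp [hx]

theorem integrable_poissonReg_one : Integrable (poissonReg 1) := by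
  have h := integrable_rpow_neg_one_add_norm_sq (E := ℝ × ℝ) (μ := volume) (r := 4)
    (by simp; norm_num)
  refine (h.const_mul 2).mono' (continuous_poissonReg one_pos).aestronglyMeasurable
    (Eventually.of_forall fun x => ?_)
  have h1 : (1 + ‖x‖ ^ 2) ^ (-(4:ℝ) / 2) = ((1 + ‖x‖ ^ 2) ^ 2)⁻¹ := by
    rw [show (-(4:ℝ) / 2) = -((2:ℕ):ℝ) by norm_num, Real.rpow_neg (by positivity),
      Real.rpow_natCast]
  rw [h1]
  have h2 : ‖x‖ ^ 2 ≤ x.1 ^ 2 + x.2 ^ 2 := by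
    rcases max_choice ‖x.1‖ ‖x.2‖ with h | h
    · rw [Prod.norm_def, h, Real.norm_eq_abs, sq_abs]; nlinarith [sq_nonneg x.2]
    · rw [Prod.norm_def, h, Real.norm_eq_abs, sq_abs]; nlinarith [sq_nonneg x.1]
  have h3 : 0 ≤ poissonReg 1 x := by unfold poissonReg; positivity
  rw [Real.norm_of_nonneg h3]
  unfold poissonReg
  have h4 : ((x.1 ^ 2 + x.2 ^ 2 + 1 ^ 2) ^ 2)⁻¹ ≤ ((1 + ‖x‖ ^ 2) ^ 2)⁻¹ := by
    apply inv_anti₀ (by positivity)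
    apply pow_le_pow_left₀ (by positivity)
    linarith
  nlinarith

theorem integral_poissonReg_one_pos : 0 < ∫ x, poissonReg 1 x := by
  have hnn : 0 ≤ poissonReg 1 := fun x => by simp only [Pi.zero_apply]; unfold poissonReg; positivity
  rw [integral_pos_iff_support_of_nonneg hnn integrable_poissonReg_one]
  have : Function.support (poissonReg 1) = Set.univ := by
    ext x; simp only [Function.mem_support, mem_univ, iff_true]
    unfold poissonReg
    have := denom_pos one_pos x
    positivity
  rw [this]
  exact isOpen_univ.measure_pos _ univ_nonempty

theorem integral_mul_poissonReg (g : ℝ × ℝ → ℂ) (z : ℝ × ℝ) {δ : ℝ} (hδ : 0 < δ) :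
    ∫ p, g p * (poissonReg δ (p - z) : ℂ) = ∫ p, g (z + δ • p) * (poissonReg 1 p : ℂ) := by
  have h1 : ∫ p, g p * (poissonReg δ (p - z) : ℂ) = ∫ p, g (z + p) * (poissonReg δ p : ℂ) := by
    rw [← integral_add_left_eq_self (fun p => g p * (poissonReg δ (p - z) : ℂ)) z]
    simp
  have h2 := Measure.integral_comp_smul (volume : Measure (ℝ × ℝ))
    (fun p => g (z + p) * (poissonReg δ p : ℂ)) δ
  rw [h1]
  have hd : Module.finrank ℝ (ℝ × ℝ) = 2 := by simp
  rw [hd, abs_of_pos (by positivity)] at h2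
  have h3 : ∫ p, g (z + p) * (poissonReg δ p : ℂ) =
      (δ ^ 2 : ℝ) • ∫ p : ℝ × ℝ, g (z + δ • p) * (poissonReg δ (δ • p) : ℂ) := by
    rw [h2, smul_smul, mul_inv_cancel₀ (by positivity), one_smul]
  rw [h3, ← integral_smul]
  congr 1
  funext p
  have hpos := denom_pos one_pos p
  have h4 : poissonReg 1 p = δ ^ 2 * poissonReg δ (δ • p) := by
    unfold poissonReg
    have h5 : (δ • p).1 ^ 2 + (δ • p).2 ^ 2 + δ ^ 2 = δ ^ 2 * (p.1 ^ 2 + p.2 ^ 2 + 1 ^ 2) := by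
      simp; ring
    rw [h5]
    field_simp
  rw [h4]
  simp [mul_left_comm]

theorem norm_cauchyReg_le (δ : ℝ) (x : ℝ × ℝ) : ‖cauchyReg δ x‖ ≤ ‖x‖⁻¹ := by
  by_cases hx : x = 0
  · simp [hx, cauchyReg]
  have hn : ‖((x.1 : ℂ) - Complex.I * (x.2 : ℂ))‖ = ‖toC x‖ := by
    have : ((x.1 : ℂ) - Complex.I * (x.2 : ℂ)) = (starRingEnd ℂ) (toC x) := by simp [toC]; ring
    rw [this, Complex.norm_conj]
  have hs : ‖toC x‖ ^ 2 = x.1 ^ 2 + x.2 ^ 2 := by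
    rw [Complex.sq_norm, Complex.normSq_apply]; simp [toC]; ring
  have h0 : 0 < ‖x‖ := norm_pos_iff.2 hx
  have h1 : 0 < ‖toC x‖ := h0.trans_le (norm_le_norm_toC x)
  unfold cauchyReg
  rw [norm_mul, hn, Complex.norm_real, ← hs, Real.norm_of_nonneg (by positivity)]
  calc ‖toC x‖ * (‖toC x‖ ^ 2 + δ ^ 2)⁻¹ ≤ ‖toC x‖ * (‖toC x‖ ^ 2)⁻¹ := by
        gcongr; nlinarith [sq_nonneg δ]
    _ = ‖toC x‖⁻¹ := by field_simp
    _ ≤ _ := inv_anti₀ h0 (norm_le_norm_toC x)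

theorem tendsto_cauchyReg (x : ℝ × ℝ) :
    Tendsto (fun n : ℕ => cauchyReg (1 / ((n:ℝ) + 1)) x) atTop (nhds (toC x)⁻¹) := by
  by_cases hx : x = 0
  · subst hx; simp [cauchyReg, toC]
  have h0 : 0 < ‖x‖ := norm_pos_iff.2 hx
  have h1 : 0 < ‖toC x‖ := h0.trans_le (norm_le_norm_toC x)
  have hs : x.1 ^ 2 + x.2 ^ 2 = ‖toC x‖ ^ 2 := by
    rw [Complex.sq_norm, Complex.normSq_apply]; simp [toC]; ring
  have hd : Tendsto (fun n : ℕ => (1 / ((n:ℝ) + 1))) atTop (nhds 0) :=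
    tendsto_one_div_add_atTop_nhds_zero_nat
  have h2 : Tendsto (fun n : ℕ => (x.1 ^ 2 + x.2 ^ 2 + (1 / ((n:ℝ) + 1)) ^ 2)⁻¹) atTop
      (nhds (x.1 ^ 2 + x.2 ^ 2 + 0 ^ 2)⁻¹) :=
    ((hd.pow 2).const_add _).inv₀ (by rw [hs]; positivity)
  have h3 := ((Complex.continuous_ofReal.tendsto _).comp h2).const_mul
    ((x.1 : ℂ) - Complex.I * (x.2 : ℂ))
  have h4 : ((x.1 : ℂ) - Complex.I * (x.2 : ℂ)) * (((x.1 ^ 2 + x.2 ^ 2 + 0 ^ 2)⁻¹ : ℝ) : ℂ)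
      = (toC x)⁻¹ := by
    rw [Complex.inv_def, Complex.normSq_apply]
    simp [toC]
    ring_nf
  rw [← h4]
  exact h3

theorem cauchy_pompeiu {g gx gy : ℝ × ℝ → ℂ} {l B : ℝ}
    (hg : Continuous g) (hc : HasCompactSupport g)
    (hx : ∀ p : ℝ × ℝ, p.2 ≠ l → HasDerivAt (fun t : ℝ => g (t, p.2)) (gx p) p.1)
    (hy : ∀ p : ℝ × ℝ, p.2 ≠ l → HasDerivAt (fun t : ℝ => g (p.1, t)) (gy p) p.2)
    (hBx : ∀ p : ℝ × ℝ, p.2 ≠ l → ‖gx p‖ ≤ B) (hBy : ∀ p : ℝ × ℝ, p.2 ≠ l → ‖gy p‖ ≤ B)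
    (h0x : ∀ p : ℝ × ℝ, p ∉ tsupport g → gx p = 0)
    (h0y : ∀ p : ℝ × ℝ, p ∉ tsupport g → gy p = 0)
    (z : ℝ × ℝ) :
    Integrable (fun p => (gx p + Complex.I * gy p) * (toC (p - z))⁻¹) ∧
    ((∫ x, poissonReg 1 x : ℝ) : ℂ) * g z =
      -∫ p, (gx p + Complex.I * gy p) * (toC (p - z))⁻¹ := by
  have hX := integral_deriv_fst_eq_zero hg hc hx (fun p hp _ => hBx p hp)
  have hY := integral_deriv_snd_eq_zero hg hc hy (fun p hp _ => hBy p hp)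
  have hint : Integrable fun p => gx p + Complex.I * gy p := hX.1.add (hY.1.const_mul _)
  obtain ⟨r, hr⟩ := hc.isBounded.subset_ball z
  have hdom : Integrable fun p : ℝ × ℝ =>
      (2 * B) * (Metric.ball (0 : ℝ × ℝ) r).indicator (fun x => ‖x‖⁻¹) (p - z) :=
    ((integrable_inv_norm_ball r).comp_sub_right z).const_mul _
  have hbd : ∀ (k : ℂ) (p : ℝ × ℝ), p.2 ≠ l → ‖k‖ ≤ ‖p - z‖⁻¹ →
      ‖(gx p + Complex.I * gy p) * k‖ ≤
      (2 * B) * (Metric.ball (0 : ℝ × ℝ) r).indicator (fun x => ‖x‖⁻¹) (p - z) := by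
    intro k p hp hk
    by_cases hps : p ∈ tsupport g
    · have h1 : p - z ∈ Metric.ball (0 : ℝ × ℝ) r := by
        have := hr hps
        rw [mem_ball_iff_norm] at this
        exact mem_ball_zero_iff.2 this
      rw [Set.indicator_of_mem h1, norm_mul]
      refine mul_le_mul ?_ hk (norm_nonneg _) ?_
      · refine (norm_add_le _ _).trans ?_
        rw [norm_mul, Complex.norm_I, one_mul]
        linarith [hBx p hp, hBy p hp]
      · linarith [(norm_nonneg _).trans (hBx p hp)]
    · rw [h0x p hps, h0y p hps]
      simp only [mul_zero, add_zero, zero_mul, norm_zero]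
      refine mul_nonneg (by linarith [(norm_nonneg _).trans (hBx p hp)]) ?_
      exact Set.indicator_nonneg (fun x _ => by positivity) _
  have hkm : Measurable fun p : ℝ × ℝ => (toC (p - z))⁻¹ :=
    (continuous_toC.comp (by fun_prop : Continuous fun p : ℝ × ℝ => p - z)).measurable.inv
  have hinvle : ∀ x : ℝ × ℝ, ‖(toC x)⁻¹‖ ≤ ‖x‖⁻¹ := by
    intro x
    by_cases hx : x = 0
    · simp [hx, toC]
    rw [norm_inv]
    exact inv_anti₀ (norm_pos_iff.2 hx) (norm_le_norm_toC x)
  have hI : Integrable (fun p => (gx p + Complex.I * gy p) * (toC (p - z))⁻¹) := by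
    refine hdom.mono' (hint.1.mul hkm.aestronglyMeasurable) ?_
    filter_upwards [ae_snd_ne l] with p hp using hbd _ p hp (hinvle _)
  refine ⟨hI, ?_⟩
  have hδ : ∀ n : ℕ, (0:ℝ) < 1 / ((n:ℝ) + 1) := fun n => by positivity
  have hL : Tendsto (fun n : ℕ => ∫ p, (gx p + Complex.I * gy p) *
      cauchyReg (1 / ((n:ℝ) + 1)) (p - z)) atTop
      (nhds (∫ p, (gx p + Complex.I * gy p) * (toC (p - z))⁻¹)) := by
    refine tendsto_integral_of_dominated_convergence _ (fun n => ?_) hdom (fun n => ?_) ?_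
    · refine hint.1.mul (Continuous.aestronglyMeasurable ?_)
      exact (continuous_cauchyReg (hδ n)).comp (by fun_prop)
    · filter_upwards [ae_snd_ne l] with p hp using hbd _ p hp (norm_cauchyReg_le _ _)
    · exact Eventually.of_forall fun p => (tendsto_cauchyReg (p - z)).const_mul _
  obtain ⟨c0, h0⟩ := hg.bounded_above_of_compact_support hc
  have hR : Tendsto (fun n : ℕ => ∫ p, g (z + (1 / ((n:ℝ) + 1)) • p) * (poissonReg 1 p : ℂ)) atTop
      (nhds (∫ p, g z * (poissonReg 1 p : ℂ))) := by
    refine tendsto_integral_of_dominated_convergence (fun p => c0 * poissonReg 1 p) (fun n => ?_)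
      (integrable_poissonReg_one.const_mul _) (fun n => ?_) ?_
    · refine Continuous.aestronglyMeasurable ?_
      exact (hg.comp (by fun_prop)).mul
        (Complex.continuous_ofReal.comp (continuous_poissonReg one_pos))
    · refine Eventually.of_forall fun p => ?_
      have hnn : 0 ≤ poissonReg 1 p := by unfold poissonReg; positivity
      rw [norm_mul, Complex.norm_real, Real.norm_of_nonneg hnn]
      exact mul_le_mul_of_nonneg_right (h0 _) hnn
    · refine Eventually.of_forall fun p => ?_
      refine Tendsto.mul_const _ ((hg.tendsto z).comp ?_)
      have hd : Tendsto (fun n : ℕ => (1 / ((n:ℝ) + 1))) atTop (nhds 0) :=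
        tendsto_one_div_add_atTop_nhds_zero_nat
      simpa using (hd.smul_const p).const_add z
  have heq : ∀ n : ℕ, ∫ p, (gx p + Complex.I * gy p) * cauchyReg (1 / ((n:ℝ) + 1)) (p - z) =
      -∫ p, g (z + (1 / ((n:ℝ) + 1)) • p) * (poissonReg 1 p : ℂ) := fun n => by
    rw [integral_dbar_mul_cauchyReg (hδ n) hg hc hx hy hBx hBy z,
      integral_mul_poissonReg g z (hδ n)]
  have hfin := tendsto_nhds_unique (hL.congr heq) hR.neg
  rw [hfin, neg_neg, integral_const_mul, integral_complex_ofReal, mul_comm]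

theorem norm_inv_toC_le {x : ℝ × ℝ} {r : ℝ} (hr : 0 < r) (h : r ≤ ‖x‖) : ‖(toC x)⁻¹‖ ≤ r⁻¹ := by
  rw [norm_inv]
  exact inv_anti₀ hr (h.trans (norm_le_norm_toC x))

theorem norm_cauchyKernel_remainder_le {p z : ℝ × ℝ} (hp : 1 / 2 ≤ ‖p‖) (hz : ‖z‖ ≤ 1 / 4) :
    ‖(toC (p - z))⁻¹ - (toC p)⁻¹ - toC z * ((toC p)⁻¹) ^ 2‖ ≤ 64 * ‖z‖ ^ 2 := by
  have h1 : 1 / 4 ≤ ‖p - z‖ := by have := norm_sub_norm_le p z; linarith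
  have e1 := norm_inv_toC_le (by norm_num) hp
  have e2 := norm_inv_toC_le (by norm_num) h1
  have n1 : toC p ≠ 0 := by
    intro h; have := norm_le_norm_toC p; rw [h, norm_zero] at this; linarith
  have n2 : toC p - toC z ≠ 0 := by
    rw [← toC_sub]
    intro h; have := norm_le_norm_toC (p - z); rw [h, norm_zero] at this; linarith
  have : (toC (p - z))⁻¹ - (toC p)⁻¹ - toC z * ((toC p)⁻¹) ^ 2 =
      toC z ^ 2 * ((toC p)⁻¹) ^ 2 * (toC (p - z))⁻¹ := by
    rw [toC_sub]; field_simp; ring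
  rw [this, norm_mul, norm_mul, norm_pow, norm_pow]
  have e3 := norm_toC_le z
  calc ‖toC z‖ ^ 2 * ‖(toC p)⁻¹‖ ^ 2 * ‖(toC (p - z))⁻¹‖
      ≤ (2 * ‖z‖) ^ 2 * ((1 / 2 : ℝ)⁻¹) ^ 2 * (1 / 4 : ℝ)⁻¹ := by gcongr
    _ = _ := by ring

theorem exists_affine_approx_unit : ∃ C > 0, ∀ (f fx fy : ℝ × ℝ → ℂ) (l S ε B : ℝ),
    ContinuousOn f (Metric.ball 0 1) →
    (∀ p ∈ Metric.ball (0 : ℝ × ℝ) 1, p.2 ≠ l →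
      HasDerivAt (fun t : ℝ => f (t, p.2)) (fx p) p.1) →
    (∀ p ∈ Metric.ball (0 : ℝ × ℝ) 1, p.2 ≠ l →
      HasDerivAt (fun t : ℝ => f (p.1, t)) (fy p) p.2) →
    (∀ p ∈ Metric.ball (0 : ℝ × ℝ) 1, p.2 ≠ l → ‖fx p‖ ≤ B ∧ ‖fy p‖ ≤ B) →
    (∀ p ∈ Metric.ball (0 : ℝ × ℝ) 1, p.2 ≠ l → ‖fx p + Complex.I * fy p‖ ≤ ε) →
    (∀ p ∈ Metric.ball (0 : ℝ × ℝ) 1, ‖f p‖ ≤ S) →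
    ∃ a b : ℂ, ∀ z : ℝ × ℝ, ‖z‖ ≤ 1 / 4 → ‖f z - a - b * toC z‖ ≤ C * (S * ‖z‖ ^ 2 + ε) := by
  classical
  let χ : ContDiffBump (0 : ℝ × ℝ) := ⟨1 / 2, 3 / 4, by norm_num, by norm_num⟩
  have hχs : ContDiff ℝ 1 (χ : ℝ × ℝ → ℝ) := χ.contDiff
  have hχd : Differentiable ℝ (χ : ℝ × ℝ → ℝ) := hχs.differentiable one_ne_zero
  have hdc : Continuous (fderiv ℝ (χ : ℝ × ℝ → ℝ)) := hχs.continuous_fderiv one_ne_zero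
  obtain ⟨M0, hM0⟩ := hdc.bounded_above_of_compact_support (χ.hasCompactSupport.fderiv ℝ)
  set M : ℝ := max M0 1 with hM
  have hMpos : 0 < M := lt_of_lt_of_le one_pos (le_max_right _ _)
  let χx : ℝ × ℝ → ℝ := fun p => fderiv ℝ χ p (1, 0)
  let χy : ℝ × ℝ → ℝ := fun p => fderiv ℝ χ p (0, 1)
  have hχx : ∀ p, |χx p| ≤ M := fun p => by
    have := (fderiv ℝ χ p).le_opNorm (1, 0)
    have h2 : ‖((1:ℝ), (0:ℝ))‖ = 1 := by simp [Prod.norm_def]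
    rw [h2, mul_one] at this
    exact this.trans ((hM0 p).trans (le_max_left _ _))
  have hχy : ∀ p, |χy p| ≤ M := fun p => by
    have := (fderiv ℝ χ p).le_opNorm (0, 1)
    have h2 : ‖((0:ℝ), (1:ℝ))‖ = 1 := by simp [Prod.norm_def]
    rw [h2, mul_one] at this
    exact this.trans ((hM0 p).trans (le_max_left _ _))
  have hχxd : ∀ p : ℝ × ℝ, HasDerivAt (fun t : ℝ => χ (t, p.2)) (χx p) p.1 := fun p => by
    have h1 : HasFDerivAt χ (fderiv ℝ χ p) (p.1, p.2) := (hχd p).hasFDerivAt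
    exact HasFDerivAt.comp_hasDerivAt (l := (χ : ℝ × ℝ → ℝ)) p.1 h1 ((hasDerivAt_id p.1).prodMk (hasDerivAt_const p.1 p.2))
  have hχyd : ∀ p : ℝ × ℝ, HasDerivAt (fun t : ℝ => χ (p.1, t)) (χy p) p.2 := fun p => by
    have h1 : HasFDerivAt χ (fderiv ℝ χ p) (p.1, p.2) := (hχd p).hasFDerivAt
    exact HasFDerivAt.comp_hasDerivAt (l := (χ : ℝ × ℝ → ℝ)) p.2 h1 ((hasDerivAt_const p.2 p.1).prodMk (hasDerivAt_id p.2))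
  have hθ0 : ∀ p : ℝ × ℝ, ‖p‖ < 1 / 2 → fderiv ℝ χ p = 0 := fun p hp => by
    have : (χ : ℝ × ℝ → ℝ) =ᶠ[nhds p] 1 := χ.eventuallyEq_one_of_mem_ball (by simpa [χ] using hp)
    rw [this.fderiv_eq]; simp
  set c : ℝ := ∫ x, poissonReg 1 x with hc
  have hcpos : 0 < c := integral_poissonReg_one_pos
  set K : Set (ℝ × ℝ) := Metric.closedBall 0 (3 / 4) with hK
  have hKc : IsCompact K := isCompact_closedBall _ _
  set vK : ℝ := (volume : Measure (ℝ × ℝ)).real K with hvK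
  set I0 : ℝ := ∫ x : ℝ × ℝ, (Metric.ball (0 : ℝ × ℝ) 2).indicator (fun x => ‖x‖⁻¹) x with hI0
  have hI0n : 0 ≤ I0 := integral_nonneg fun x => Set.indicator_nonneg (fun x _ => by positivity) _
  have hvKn : 0 ≤ vK := measureReal_nonneg
  refine ⟨c⁻¹ * (2 * M * 64 * vK + I0 + 1), by positivity, ?_⟩
  intro f fx fy l S ε B hf hfx hfy hB hε hS
  have hS0 : 0 ≤ S := (norm_nonneg _).trans (hS 0 (by simp))
  have hε0 : 0 ≤ ε := by
    obtain ⟨p, hp, hpl⟩ : ∃ p ∈ Metric.ball (0 : ℝ × ℝ) 1, p.2 ≠ l := by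
      by_cases hl : l = 0
      · exact ⟨(0, 1 / 2), by simp [Prod.norm_def]; norm_num, by simp [hl]⟩
      · exact ⟨0, by simp, by simpa using fun h => hl h.symm⟩
    exact (norm_nonneg _).trans (hε p hp hpl)
  have hB0 : 0 ≤ max B 0 := le_max_right _ _
  let g : ℝ × ℝ → ℂ := fun p => (χ p : ℂ) * f p
  set T := tsupport g with hT
  have hTK : T ⊆ K := by
    refine closure_minimal ?_ Metric.isClosed_closedBall
    intro p hp
    have h1 : χ p ≠ 0 := by
      intro h; exact hp (by simp [g, h])
    have := χ.support_eq
    have h2 : p ∈ Function.support χ := h1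
    rw [this] at h2
    exact Metric.ball_subset_closedBall h2
  have hKB : K ⊆ Metric.ball 0 1 := Metric.closedBall_subset_ball (by norm_num)
  have hgc : HasCompactSupport g := HasCompactSupport.of_support_subset_isCompact hKc
    ((subset_tsupport g).trans hTK)
  have hgcont : Continuous g := by
    rw [continuous_iff_continuousAt]
    intro p
    by_cases hp : p ∈ Metric.ball (0 : ℝ × ℝ) 1
    · have h1 := (hf p hp).continuousAt (Metric.isOpen_ball.mem_nhds hp)
      exact (Complex.continuous_ofReal.continuousAt.comp χ.continuous.continuousAt).mul h1
    · have h1 : p ∉ T := fun h => hp (hKB (hTK h))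
      have h2 : g =ᶠ[nhds p] 0 := notMem_tsupport_iff_eventuallyEq.1 h1
      exact (continuousAt_const (y := (0:ℂ))).congr h2.symm
  let gx : ℝ × ℝ → ℂ := T.indicator fun p => (χx p : ℂ) * f p + (χ p : ℂ) * fx p
  let gy : ℝ × ℝ → ℂ := T.indicator fun p => (χy p : ℂ) * f p + (χ p : ℂ) * fy p
  have hgx : ∀ p : ℝ × ℝ, p.2 ≠ l → HasDerivAt (fun t : ℝ => g (t, p.2)) (gx p) p.1 := by
    intro p hp
    by_cases hpT : p ∈ T
    · simp only [gx, Set.indicator_of_mem hpT]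
      exact (hχxd p).ofReal_comp.mul (hfx p (hKB (hTK hpT)) hp)
    · simp only [gx, Set.indicator_of_notMem hpT]
      have h2 : g =ᶠ[nhds (p.1, p.2)] 0 := notMem_tsupport_iff_eventuallyEq.1 hpT
      have h3 : (fun t : ℝ => g (t, p.2)) =ᶠ[nhds p.1] fun _ => 0 :=
        (Continuous.tendsto (by fun_prop : Continuous fun t : ℝ => (t, p.2)) p.1).eventually h2
      exact (hasDerivAt_const p.1 (0:ℂ)).congr_of_eventuallyEq h3
  have hgy : ∀ p : ℝ × ℝ, p.2 ≠ l → HasDerivAt (fun t : ℝ => g (p.1, t)) (gy p) p.2 := by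
    intro p hp
    by_cases hpT : p ∈ T
    · simp only [gy, Set.indicator_of_mem hpT]
      exact (hχyd p).ofReal_comp.mul (hfy p (hKB (hTK hpT)) hp)
    · simp only [gy, Set.indicator_of_notMem hpT]
      have h2 : g =ᶠ[nhds (p.1, p.2)] 0 := notMem_tsupport_iff_eventuallyEq.1 hpT
      have h3 : (fun t : ℝ => g (p.1, t)) =ᶠ[nhds p.2] fun _ => 0 :=
        (Continuous.tendsto (by fun_prop : Continuous fun t : ℝ => (p.1, t)) p.2).eventually h2
      exact (hasDerivAt_const p.2 (0:ℂ)).congr_of_eventuallyEq h3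
  have hχ1 : ∀ p, ‖(χ p : ℂ)‖ ≤ 1 := fun p => by
    rw [Complex.norm_real, Real.norm_of_nonneg χ.nonneg]; exact χ.le_one
  have hbd : ∀ (s : ℝ) (k : ℂ) p, p ∈ T → |s| ≤ M → ‖k‖ ≤ B →
      ‖(s : ℂ) * f p + (χ p : ℂ) * k‖ ≤ M * S + max B 0 := by
    intro s k p hp hs hk
    refine (norm_add_le _ _).trans ?_
    rw [norm_mul, norm_mul, Complex.norm_real, Real.norm_eq_abs]
    have := hS p (hKB (hTK hp))
    have := hχ1 p
    have h3 : ‖(χ p : ℂ)‖ * ‖k‖ ≤ 1 * max B 0 := by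
      gcongr; exact hk.trans (le_max_left _ _)
    have h4 : |s| * ‖f p‖ ≤ M * S := by gcongr
    linarith
  have hMS : 0 ≤ M * S + max B 0 := by positivity
  have hBx : ∀ p : ℝ × ℝ, p.2 ≠ l → ‖gx p‖ ≤ M * S + max B 0 := by
    intro p hp
    by_cases hpT : p ∈ T
    · simp only [gx, Set.indicator_of_mem hpT]
      exact hbd _ _ p hpT (hχx p) (hB p (hKB (hTK hpT)) hp).1
    · simpa only [gx, Set.indicator_of_notMem hpT, norm_zero] using hMS
  have hBy : ∀ p : ℝ × ℝ, p.2 ≠ l → ‖gy p‖ ≤ M * S + max B 0 := by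
    intro p hp
    by_cases hpT : p ∈ T
    · simp only [gy, Set.indicator_of_mem hpT]
      exact hbd _ _ p hpT (hχy p) (hB p (hKB (hTK hpT)) hp).2
    · simpa only [gy, Set.indicator_of_notMem hpT, norm_zero] using hMS
  have hCP := cauchy_pompeiu hgcont hgc hgx hgy hBx hBy
    (fun p hp => Set.indicator_of_notMem hp _) (fun p hp => Set.indicator_of_notMem hp _)
  let F : ℝ × ℝ → ℂ := T.indicator fun p => f p * ((χx p : ℂ) + Complex.I * (χy p : ℂ))
  have hFm : AEStronglyMeasurable F := by
    refine (aestronglyMeasurable_indicator_iff (isClosed_tsupport g).measurableSet).2 ?_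
    refine ContinuousOn.aestronglyMeasurable ?_ (isClosed_tsupport g).measurableSet
    refine (hf.mono (hTK.trans hKB)).mul (Continuous.continuousOn ?_)
    have h1 : Continuous χx := hdc.clm_apply continuous_const
    have h2 : Continuous χy := hdc.clm_apply continuous_const
    fun_prop
  have hFb : ∀ p, ‖F p‖ ≤ K.indicator (fun _ => 2 * M * S) p := by
    intro p
    by_cases hpT : p ∈ T
    · rw [Set.indicator_of_mem (hTK hpT)]
      simp only [F, Set.indicator_of_mem hpT, norm_mul]
      have h1 : ‖(χx p : ℂ) + Complex.I * (χy p : ℂ)‖ ≤ 2 * M := by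
        refine (norm_add_le _ _).trans ?_
        rw [norm_mul, Complex.norm_I, one_mul, Complex.norm_real, Complex.norm_real]
        have := hχx p; have := hχy p
        simp only [Real.norm_eq_abs]; linarith
      have := hS p (hKB (hTK hpT))
      calc ‖f p‖ * _ ≤ S * (2 * M) := by gcongr
        _ = _ := by ring
    · simp only [F, Set.indicator_of_notMem hpT, norm_zero]
      exact Set.indicator_nonneg (fun _ _ => by positivity) _
  have hF0 : ∀ p, ‖p‖ < 1 / 2 → F p = 0 := by
    intro p hp
    by_cases hpT : p ∈ T
    · simp only [F, Set.indicator_of_mem hpT, χx, χy, hθ0 p hp]; simp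
    · simp only [F, Set.indicator_of_notMem hpT]
  have hFk : ∀ (k : ℝ × ℝ → ℂ) (R : ℝ), 0 ≤ R → Measurable k → (∀ p, 1 / 2 ≤ ‖p‖ → ‖k p‖ ≤ R) →
      Integrable (fun p => F p * k p) ∧ ‖∫ p, F p * k p‖ ≤ 2 * M * S * R * vK := by
    intro k R hR hk hkR
    have hdom : Integrable (K.indicator fun _ : ℝ × ℝ => 2 * M * S * R) :=
      (integrable_indicator_iff hKc.measurableSet).2
        (integrableOn_const hKc.measure_lt_top.ne)
    have hle : ∀ p, ‖F p * k p‖ ≤ K.indicator (fun _ => 2 * M * S * R) p := by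
      intro p
      by_cases hp : ‖p‖ < 1 / 2
      · rw [hF0 p hp, zero_mul, norm_zero]
        exact Set.indicator_nonneg (fun _ _ => by positivity) _
      · rw [norm_mul]
        have h1 := hFb p
        have h2 := hkR p (not_lt.1 hp)
        by_cases hpK : p ∈ K
        · rw [Set.indicator_of_mem hpK] at h1 ⊢
          gcongr
        · rw [Set.indicator_of_notMem hpK] at h1 ⊢
          have : ‖F p‖ = 0 := le_antisymm h1 (norm_nonneg _)
          rw [this, zero_mul]
    refine ⟨hdom.mono' (hFm.mul hk.aestronglyMeasurable) (Eventually.of_forall hle), ?_⟩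
    refine (norm_integral_le_of_norm_le hdom (Eventually.of_forall hle)).trans (le_of_eq ?_)
    rw [integral_indicator hKc.measurableSet]
    simp [hvK, mul_comm]
  have hkm : ∀ z : ℝ × ℝ, Measurable fun p : ℝ × ℝ => (toC (p - z))⁻¹ := fun z =>
    (continuous_toC.comp (by fun_prop : Continuous fun p : ℝ × ℝ => p - z)).measurable.inv
  have hkm0 : Measurable fun p : ℝ × ℝ => (toC p)⁻¹ := continuous_toC.measurable.inv
  have i1 := (hFk (fun p => (toC p)⁻¹) 2 (by norm_num) hkm0
    (fun p hp => (norm_inv_toC_le (by norm_num) hp).trans (by norm_num))).1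
  have i2 := (hFk (fun p => ((toC p)⁻¹) ^ 2) 4 (by norm_num) (hkm0.pow_const 2) (fun p hp => by
    rw [norm_pow]
    calc ‖(toC p)⁻¹‖ ^ 2 ≤ ((1 / 2 : ℝ)⁻¹) ^ 2 := by
          gcongr; exact norm_inv_toC_le (by norm_num) hp
      _ = 4 := by norm_num)).1
  refine ⟨-(c⁻¹ : ℝ) * ∫ p, F p * (toC p)⁻¹, -(c⁻¹ : ℝ) * ∫ p, F p * ((toC p)⁻¹) ^ 2, ?_⟩
  intro z hz
  have i3 := (hFk (fun p => (toC (p - z))⁻¹) 4 (by norm_num) (hkm z) (fun p hp => by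
    have h1 : 1 / 4 ≤ ‖p - z‖ := by have := norm_sub_norm_le p z; linarith
    exact (norm_inv_toC_le (by norm_num) h1).trans (by norm_num))).1
  obtain ⟨i4, e4⟩ := hFk (fun p => (toC (p - z))⁻¹ - (toC p)⁻¹ - toC z * ((toC p)⁻¹) ^ 2)
    (64 * ‖z‖ ^ 2) (by positivity) (((hkm z).sub hkm0).sub ((hkm0.pow_const 2).const_mul _))
    (fun p hp => norm_cauchyKernel_remainder_le hp hz)
  obtain ⟨i5, e5⟩ := hCP z
  have hgz : g z = f z := by
    have : χ z = 1 := χ.one_of_mem_closedBall (by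
      simp only [mem_closedBall_zero_iff]; show ‖z‖ ≤ 1 / 2; linarith)
    simp [g, this]
  have hE : ‖∫ p, ((gx p + Complex.I * gy p) * (toC (p - z))⁻¹ - F p * (toC (p - z))⁻¹)‖
      ≤ ε * I0 := by
    have hdom : Integrable fun p : ℝ × ℝ =>
        ε * (Metric.ball (0 : ℝ × ℝ) 2).indicator (fun x => ‖x‖⁻¹) (p - z) :=
      ((integrable_inv_norm_ball 2).comp_sub_right z).const_mul _
    refine (norm_integral_le_of_norm_le hdom ?_).trans (le_of_eq ?_)
    · filter_upwards [ae_snd_ne l] with p hp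
      by_cases hpT : p ∈ T
      · have hpK : ‖p‖ ≤ 3 / 4 := mem_closedBall_zero_iff.1 (hTK hpT)
        have h1 : p - z ∈ Metric.ball (0 : ℝ × ℝ) 2 := by
          rw [mem_ball_zero_iff]; have := norm_sub_le p z; linarith
        rw [Set.indicator_of_mem h1]
        simp only [gx, gy, F, Set.indicator_of_mem hpT]
        have h2 : ((χx p : ℂ) * f p + (χ p : ℂ) * fx p +
            Complex.I * ((χy p : ℂ) * f p + (χ p : ℂ) * fy p)) * (toC (p - z))⁻¹ -
            f p * ((χx p : ℂ) + Complex.I * (χy p : ℂ)) * (toC (p - z))⁻¹ =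
            (χ p : ℂ) * (fx p + Complex.I * fy p) * (toC (p - z))⁻¹ := by ring
        rw [h2, norm_mul, norm_mul]
        have h3 : ‖(toC (p - z))⁻¹‖ ≤ ‖p - z‖⁻¹ := by
          by_cases h0 : p - z = 0
          · simp [h0, toC]
          · exact norm_inv_toC_le (norm_pos_iff.2 h0) le_rfl
        have h4 := hε p (hKB (hTK hpT)) hp
        have h5 := hχ1 p
        calc _ ≤ 1 * ε * ‖p - z‖⁻¹ := by gcongr
          _ = _ := by ring
      · simp only [gx, gy, F, Set.indicator_of_notMem hpT]
        simp only [mul_zero, add_zero, zero_mul, sub_zero, norm_zero]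
        exact mul_nonneg hε0 (Set.indicator_nonneg (fun x _ => by positivity) _)
    · rw [integral_const_mul, integral_sub_right_eq_self
        (fun x => (Metric.ball (0 : ℝ × ℝ) 2).indicator (fun x => ‖x‖⁻¹) x)]
  rw [integral_sub i5 i3] at hE
  have h4 : ∫ p, F p * ((toC (p - z))⁻¹ - (toC p)⁻¹ - toC z * ((toC p)⁻¹) ^ 2) =
      (∫ p, F p * (toC (p - z))⁻¹) - (∫ p, F p * (toC p)⁻¹) -
        toC z * ∫ p, F p * ((toC p)⁻¹) ^ 2 := by
    have i6 : Integrable fun p => F p * (toC (p - z))⁻¹ - F p * (toC p)⁻¹ := i3.sub i1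
    rw [← integral_const_mul, ← integral_sub i3 i1, ← integral_sub i6 (i2.const_mul _)]
    congr 1; funext p; ring
  rw [h4] at e4
  have hcc : (c : ℂ) ≠ 0 := by exact_mod_cast hcpos.ne'
  rw [hgz] at e5
  set A1 := ∫ p, (gx p + Complex.I * gy p) * (toC (p - z))⁻¹
  set A2 := ∫ p, F p * (toC (p - z))⁻¹
  set A3 := ∫ p, F p * (toC p)⁻¹
  set A4 := ∫ p, F p * ((toC p)⁻¹) ^ 2
  have hfz : f z = (c⁻¹ : ℝ) * (-A1) := by
    rw [← e5, ← hc]; push_cast; field_simp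
  have : f z - -((c⁻¹ : ℝ) : ℂ) * A3 - -((c⁻¹ : ℝ) : ℂ) * A4 * toC z =
      ((c⁻¹ : ℝ) : ℂ) * (-(A1 - A2) - (A2 - A3 - toC z * A4)) := by
    rw [hfz]; ring
  rw [this, norm_mul, Complex.norm_real, Real.norm_of_nonneg (by positivity), mul_assoc]
  gcongr
  refine (norm_sub_le _ _).trans ?_
  rw [norm_neg]
  have hz2 : 0 ≤ S * ‖z‖ ^ 2 := by positivity
  have hP : 0 ≤ 2 * M * 64 * vK := by positivity
  calc ‖A1 - A2‖ + ‖A2 - A3 - toC z * A4‖ ≤ ε * I0 + 2 * M * S * (64 * ‖z‖ ^ 2) * vK := add_le_add hE e4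
    _ = ε * I0 + (2 * M * 64 * vK) * (S * ‖z‖ ^ 2) := by ring
    _ ≤ (2 * M * 64 * vK + I0 + 1) * (S * ‖z‖ ^ 2 + ε) := by nlinarith [mul_nonneg hI0n hz2, mul_nonneg hP hε0]

theorem exists_affine_approx : ∃ C > 0, ∀ (z₀ : ℝ × ℝ) (R : ℝ) (f fx fy : ℝ × ℝ → ℂ)
    (l S ε B : ℝ), 0 < R →
    ContinuousOn f (Metric.ball z₀ R) →
    (∀ p ∈ Metric.ball z₀ R, p.2 ≠ l → HasDerivAt (fun t : ℝ => f (t, p.2)) (fx p) p.1) →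
    (∀ p ∈ Metric.ball z₀ R, p.2 ≠ l → HasDerivAt (fun t : ℝ => f (p.1, t)) (fy p) p.2) →
    (∀ p ∈ Metric.ball z₀ R, p.2 ≠ l → ‖fx p‖ ≤ B ∧ ‖fy p‖ ≤ B) →
    (∀ p ∈ Metric.ball z₀ R, p.2 ≠ l → ‖fx p + Complex.I * fy p‖ ≤ ε) →
    (∀ p ∈ Metric.ball z₀ R, ‖f p‖ ≤ S) →
    ∃ a b : ℂ, ∀ z : ℝ × ℝ, ‖z - z₀‖ ≤ R / 4 →
      ‖f z - a - b * toC (z - z₀)‖ ≤ C * (S * (‖z - z₀‖ / R) ^ 2 + ε * R) := by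
  obtain ⟨C, hC, H⟩ := exists_affine_approx_unit
  refine ⟨C, hC, ?_⟩
  intro z₀ R f fx fy l S ε B hR hf hfx hfy hB hε hS
  have hmem : ∀ p ∈ Metric.ball (0 : ℝ × ℝ) 1, z₀ + R • p ∈ Metric.ball z₀ R := by
    intro p hp
    rw [mem_ball_zero_iff] at hp
    rw [mem_ball_iff_norm, add_sub_cancel_left, norm_smul, Real.norm_of_nonneg hR.le]
    nlinarith
  have hl : ∀ p : ℝ × ℝ, p.2 ≠ (l - z₀.2) / R → (z₀ + R • p).2 ≠ l := by
    intro p hp h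
    apply hp
    rw [eq_div_iff hR.ne']
    simp at h; linarith
  obtain ⟨a, b, hab⟩ := H (fun p => f (z₀ + R • p)) (fun p => R * fx (z₀ + R • p))
    (fun p => R * fy (z₀ + R • p)) ((l - z₀.2) / R) S (ε * R) (R * B)
    (hf.comp (by fun_prop) hmem)
    (fun p hp hpl => by
      have h1 := hfx _ (hmem p hp) (hl p hpl)
      have h2 : HasDerivAt (fun t : ℝ => z₀.1 + R * t) R p.1 := by
        simpa using ((hasDerivAt_id p.1).const_mul R).const_add z₀.1
      have h3 := h1.scomp_of_eq p.1 h2 (by simp)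
      rw [← Complex.real_smul]
      exact h3)
    (fun p hp hpl => by
      have h1 := hfy _ (hmem p hp) (hl p hpl)
      have h2 : HasDerivAt (fun t : ℝ => z₀.2 + R * t) R p.2 := by
        simpa using ((hasDerivAt_id p.2).const_mul R).const_add z₀.2
      have h3 := h1.scomp_of_eq p.2 h2 (by simp)
      rw [← Complex.real_smul]
      exact h3)
    (fun p hp hpl => by
      have h1 := hB _ (hmem p hp) (hl p hpl)
      rw [norm_mul, norm_mul, Complex.norm_real, Real.norm_of_nonneg hR.le]
      exact ⟨by gcongr; exact h1.1, by gcongr; exact h1.2⟩)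
    (fun p hp hpl => by
      have h1 := hε _ (hmem p hp) (hl p hpl)
      rw [show (R : ℂ) * fx (z₀ + R • p) + Complex.I * (R * fy (z₀ + R • p)) =
        R * (fx (z₀ + R • p) + Complex.I * fy (z₀ + R • p)) by ring, norm_mul,
        Complex.norm_real, Real.norm_of_nonneg hR.le, mul_comm]
      gcongr)
    (fun p hp => hS _ (hmem p hp))
  refine ⟨a, (R⁻¹ : ℝ) * b, ?_⟩
  intro z hz
  have hn : ‖R⁻¹ • (z - z₀)‖ = ‖z - z₀‖ / R := by
    rw [norm_smul, Real.norm_of_nonneg (by positivity), inv_mul_eq_div]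
  have h1 := hab (R⁻¹ • (z - z₀)) (by
    rw [hn, div_le_iff₀ hR]; linarith)
  rw [hn] at h1
  have h2 : z₀ + R • R⁻¹ • (z - z₀) = z := by
    rw [smul_smul, mul_inv_cancel₀ hR.ne', one_smul, add_sub_cancel]
  have h3 : toC (R⁻¹ • (z - z₀)) = (R⁻¹ : ℝ) * toC (z - z₀) := by
    simp [toC]; ring
  simp only [h2, h3] at h1
  convert h1 using 3
  ring

theorem exists_affine_approx_half : ∃ C > 0, ∀ (σ u : ℝ) (z₀ : ℝ × ℝ) (R : ℝ)
    (f fx fy : ℝ × ℝ → ℂ) (S ε B : ℝ), |σ| = 1 → |u| = 1 → 0 < R → σ * z₀.2 ≤ 0 →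
    ContinuousOn f (Metric.ball z₀ R ∩ {p | σ * p.2 ≤ 0}) →
    (∀ p ∈ Metric.ball z₀ R, σ * p.2 < 0 → HasDerivAt (fun t : ℝ => f (t, p.2)) (fx p) p.1) →
    (∀ p ∈ Metric.ball z₀ R, σ * p.2 < 0 → HasDerivAt (fun t : ℝ => f (p.1, t)) (fy p) p.2) →
    (∀ p ∈ Metric.ball z₀ R, σ * p.2 < 0 → ‖fx p‖ ≤ B ∧ ‖fy p‖ ≤ B) →
    (∀ p ∈ Metric.ball z₀ R, σ * p.2 < 0 → ‖fx p + Complex.I * fy p‖ ≤ ε) →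
    (∀ p ∈ Metric.ball z₀ R, σ * p.2 ≤ 0 → ‖f p‖ ≤ S) →
    (∀ p ∈ Metric.ball z₀ R, p.2 = 0 → f p = u * (starRingEnd ℂ) (f p)) →
    ∃ a b : ℂ, ∀ z : ℝ × ℝ, ‖z - z₀‖ ≤ R / 4 → σ * z.2 ≤ 0 →
      ‖f z - a - b * toC (z - z₀)‖ ≤ C * (S * (‖z - z₀‖ / R) ^ 2 + ε * R) := by
  classical
  obtain ⟨C, hC, H⟩ := exists_affine_approx
  refine ⟨C, hC, ?_⟩
  intro σ u z₀ R f fx fy S ε B hσ hu hR hz₀ hf hfx hfy hB hε hS hsym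
  have hσ0 : σ ≠ 0 := by rintro rfl; simp at hσ
  let r : ℝ × ℝ → ℝ × ℝ := fun p => (p.1, -p.2)
  have hrc : Continuous r := by fun_prop
  have hrm : ∀ p ∈ Metric.ball z₀ R, 0 ≤ σ * p.2 → r p ∈ Metric.ball z₀ R := by
    intro p hp h
    rw [Metric.mem_ball, Prod.dist_eq, max_lt_iff, Real.dist_eq, Real.dist_eq] at hp ⊢
    refine ⟨hp.1, lt_of_le_of_lt ?_ hp.2⟩
    simp only [r]
    rcases (abs_eq (by norm_num : (0:ℝ) ≤ 1)).1 hσ with h1 | h1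
    · subst h1
      rw [abs_le]; constructor <;> rcases abs_cases (p.2 - z₀.2) with h3 | h3 <;> linarith
    · subst h1
      rw [abs_le]; constructor <;> rcases abs_cases (p.2 - z₀.2) with h3 | h3 <;> linarith
  let F : ℝ × ℝ → ℂ := fun p => if σ * p.2 ≤ 0 then f p else u * (starRingEnd ℂ) (f (r p))
  let Fx : ℝ × ℝ → ℂ := fun p => if σ * p.2 ≤ 0 then fx p else u * (starRingEnd ℂ) (fx (r p))
  let Fy : ℝ × ℝ → ℂ := fun p => if σ * p.2 ≤ 0 then fy p else -(u * (starRingEnd ℂ) (fy (r p)))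
  have hun : ‖(u : ℂ)‖ = 1 := by rw [Complex.norm_real]; exact hu
  have hside : ∀ p : ℝ × ℝ, p.2 ≠ 0 → σ * p.2 < 0 ∨ 0 < σ * p.2 := fun p hp =>
    lt_or_gt_of_ne (mul_ne_zero hσ0 hp)
  have hrs : ∀ p : ℝ × ℝ, σ * (r p).2 = -(σ * p.2) := fun p => by simp [r]
  have hFc : ContinuousOn F (Metric.ball z₀ R) := by
    have hc1 : IsClosed {p : ℝ × ℝ | σ * p.2 ≤ 0} := isClosed_le (by fun_prop) continuous_const
    have hc2 : IsClosed {p : ℝ × ℝ | 0 ≤ σ * p.2} := isClosed_le continuous_const (by fun_prop)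
    have hcov : Metric.ball z₀ R = (Metric.ball z₀ R ∩ {p | σ * p.2 ≤ 0}) ∪
        (Metric.ball z₀ R ∩ {p | 0 ≤ σ * p.2}) := by
      rw [← Set.inter_union_distrib_left]
      ext p; simp [le_total]
    have h1 : ContinuousOn F (Metric.ball z₀ R ∩ {p | σ * p.2 ≤ 0}) :=
      hf.congr fun p hp => if_pos hp.2
    have h2 : ContinuousOn F (Metric.ball z₀ R ∩ {p | 0 ≤ σ * p.2}) := by
      have h3 : ContinuousOn (fun p => (u : ℂ) * (starRingEnd ℂ) (f (r p)))
          (Metric.ball z₀ R ∩ {p | 0 ≤ σ * p.2}) := by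
        refine ContinuousOn.mul continuousOn_const ?_
        refine Complex.continuous_conj.comp_continuousOn ?_
        refine hf.comp hrc.continuousOn fun p hp => ⟨hrm p hp.1 hp.2, ?_⟩
        have := hp.2
        simp only [mem_ofPred_eq] at this ⊢
        rw [hrs]; linarith
      refine h3.congr fun p hp => ?_
      by_cases h : σ * p.2 ≤ 0
      · have h0 : σ * p.2 = 0 := le_antisymm h hp.2
        have h00 : p.2 = 0 := (mul_eq_zero.1 h0).resolve_left hσ0
        have hrp : r p = p := Prod.ext rfl (by simp [r, h00])
        simp only [F, if_pos h, hrp]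
        exact hsym p hp.1 h00
      · simp only [F, if_neg h]
    intro p hp
    have e1 : ContinuousWithinAt F (Metric.ball z₀ R ∩ {p | σ * p.2 ≤ 0}) p := by
      by_cases h : σ * p.2 ≤ 0
      · exact h1 p ⟨hp, h⟩
      · refine continuousWithinAt_of_notMem_closure fun h' => h ?_
        exact hc1.closure_subset_iff.2 Set.inter_subset_right h'
    have e2 : ContinuousWithinAt F (Metric.ball z₀ R ∩ {p | 0 ≤ σ * p.2}) p := by
      by_cases h : 0 ≤ σ * p.2
      · exact h2 p ⟨hp, h⟩
      · refine continuousWithinAt_of_notMem_closure fun h' => h ?_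
        exact hc2.closure_subset_iff.2 Set.inter_subset_right h'
    rw [hcov]
    exact e1.union e2
  refine (H z₀ R F Fx Fy 0 S ε B hR hFc ?_ ?_ ?_ ?_ ?_).imp fun a => Exists.imp fun b hab z hz hzσ =>
    by simpa only [F, if_pos hzσ] using hab z hz
  · intro p hp hp0
    rcases hside p hp0 with h | h
    · simp only [F, Fx, if_pos h.le]
      exact hfx p hp h
    · simp only [F, Fx, if_neg (not_le.2 h)]
      have h1 := hfx (r p) (hrm p hp h.le) (by rw [hrs]; linarith)
      exact (h1.star).const_mul (u : ℂ)
  · intro p hp hp0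
    rcases hside p hp0 with h | h
    · have h2 : (fun t : ℝ => F (p.1, t)) =ᶠ[nhds p.2] fun t => f (p.1, t) := by
        filter_upwards [(Continuous.tendsto (by fun_prop : Continuous fun t : ℝ => σ * t)
          p.2).eventually_lt_const h] with t ht
        simp only [F, if_pos ht.le]
      simp only [Fy, if_pos h.le]
      exact (hfy p hp h).congr_of_eventuallyEq h2
    · have h2 : (fun t : ℝ => F (p.1, t)) =ᶠ[nhds p.2]
          fun t => u * (starRingEnd ℂ) (f (p.1, -t)) := by
        filter_upwards [(Continuous.tendsto (by fun_prop : Continuous fun t : ℝ => σ * t)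
          p.2).eventually_const_lt h] with t ht
        simp only [F, if_neg (not_le.2 ht), r]
      simp only [Fy, if_neg (not_le.2 h)]
      refine HasDerivAt.congr_of_eventuallyEq ?_ h2
      have h1 := hfy (r p) (hrm p hp h.le) (by rw [hrs]; linarith)
      have h3 := HasDerivAt.scomp (h := fun t : ℝ => -t) (h' := -1) p.2
        (by exact h1) (hasDerivAt_neg p.2)
      have h4 := (h3.star).const_mul (u : ℂ)
      refine h4.congr_deriv ?_
      simp [r]
  · intro p hp hp0
    rcases hside p hp0 with h | h
    · simpa only [Fx, Fy, if_pos h.le] using hB p hp h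
    · simp only [Fx, Fy, if_neg (not_le.2 h), norm_neg, norm_mul, hun, one_mul, Complex.norm_conj]
      exact hB (r p) (hrm p hp h.le) (by rw [hrs]; linarith)
  · intro p hp hp0
    rcases hside p hp0 with h | h
    · simpa only [Fx, Fy, if_pos h.le] using hε p hp h
    · simp only [Fx, Fy, if_neg (not_le.2 h)]
      have h1 := hε (r p) (hrm p hp h.le) (by rw [hrs]; linarith)
      have h2 : (u : ℂ) * (starRingEnd ℂ) (fx (r p)) +
          Complex.I * -(u * (starRingEnd ℂ) (fy (r p))) =
          u * (starRingEnd ℂ) (fx (r p) + Complex.I * fy (r p)) := by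
        simp; ring
      rwa [h2, norm_mul, hun, one_mul, Complex.norm_conj]
  · intro p hp
    by_cases h : σ * p.2 ≤ 0
    · simp only [F, if_pos h]; exact hS p hp h
    · simp only [F, if_neg h, norm_mul, hun, one_mul, Complex.norm_conj]
      exact hS (r p) (hrm p hp (not_le.1 h).le) (by rw [hrs]; linarith)

/-- The linear form `(s, t) ↦ a s + b t` on the plane. -/
noncomputable def lin (a b : ℝ) : ℝ × ℝ →L[ℝ] ℝ :=
  a • ContinuousLinearMap.fst ℝ ℝ ℝ + b • ContinuousLinearMap.snd ℝ ℝ ℝ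

@[simp] theorem lin_apply (a b : ℝ) (x : ℝ × ℝ) : lin a b x = a * x.1 + b * x.2 := by
  simp [lin]

theorem abs_lin_le (a b : ℝ) (x : ℝ × ℝ) : |lin a b x| ≤ (|a| + |b|) * ‖x‖ := by
  rw [lin_apply]
  have h1 : |x.1| ≤ ‖x‖ := norm_fst_le x
  have h2 : |x.2| ≤ ‖x‖ := norm_snd_le x
  calc |a * x.1 + b * x.2| ≤ |a| * |x.1| + |b| * |x.2| := by
        rw [← abs_mul, ← abs_mul]; exact abs_add_le _ _
    _ ≤ |a| * ‖x‖ + |b| * ‖x‖ := by gcongr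
    _ = _ := by ring

set_option maxHeartbeats 1000000 in
theorem exists_affine_approx_frozen {lam Lam : ℝ} (hlam : 0 < lam) (hLam : 0 < Lam) :
    ∃ C > 0, ∃ c > 0, ∀ (a b d σ pb : ℝ) (x₀ : ℝ × ℝ) (ρ S ε B : ℝ)
    (w wq wp V Vq Vp : ℝ × ℝ → ℝ),
    |a| ≤ Lam → |b| ≤ Lam → d ≤ Lam → lam ≤ d → lam ≤ a * d - b ^ 2 → |σ| = 1 → 0 < ρ → 0 ≤ ε →
    σ * (x₀.2 - pb) ≤ 0 →
    ContinuousOn w (Metric.ball x₀ ρ ∩ {p | σ * (p.2 - pb) ≤ 0}) →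
    ContinuousOn V (Metric.ball x₀ ρ ∩ {p | σ * (p.2 - pb) ≤ 0}) →
    (∀ p ∈ Metric.ball x₀ ρ, σ * (p.2 - pb) < 0 → HasFDerivAt w (lin (wq p) (wp p)) p) →
    (∀ p ∈ Metric.ball x₀ ρ, σ * (p.2 - pb) < 0 → HasFDerivAt V (lin (Vq p) (Vp p)) p) →
    (∀ p ∈ Metric.ball x₀ ρ, σ * (p.2 - pb) < 0 →
      |wq p| ≤ B ∧ |wp p| ≤ B ∧ |Vq p| ≤ B ∧ |Vp p| ≤ B) →
    (∀ p ∈ Metric.ball x₀ ρ, σ * (p.2 - pb) < 0 →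
      |Vp p - (a * wq p + b * wp p)| ≤ ε ∧ |Vq p + (b * wq p + d * wp p)| ≤ ε) →
    (∀ p ∈ Metric.ball x₀ ρ, σ * (p.2 - pb) ≤ 0 → |w p| ≤ S ∧ |V p| ≤ S) →
    ((∀ p ∈ Metric.ball x₀ ρ, p.2 = pb → w p = 0) ∨
      (∀ p ∈ Metric.ball x₀ ρ, p.2 = pb → V p = 0)) →
    ∃ m₀ m₁ m₂ : ℝ, ∀ x : ℝ × ℝ, ‖x - x₀‖ ≤ c * ρ → σ * (x.2 - pb) ≤ 0 →
      |w x - m₀ - lin m₁ m₂ (x - x₀)| ≤ C * (S * (‖x - x₀‖ / ρ) ^ 2 + ε * ρ) := by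
  obtain ⟨C₁, hC₁, H⟩ := exists_affine_approx_half
  set K : ℝ := 1 + 2 * Lam / √lam with hK
  set K' : ℝ := 1 + Lam / lam with hK'
  have hsl : 0 < √lam := Real.sqrt_pos.2 hlam
  have hK1 : 1 ≤ K := by rw [hK]; have : 0 < 2 * Lam / √lam := by positivity
                         linarith
  have hK'1 : 1 ≤ K' := by rw [hK']; have : 0 < Lam / lam := by positivity
                           linarith
  have hKp : 0 < K := by linarith
  have hK'p : 0 < K' := by linarith
  refine ⟨C₁ * ((Lam + 1) * (K' * K) ^ 2 + K) / √lam, by positivity, 1 / (4 * K * K'),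
    by positivity, ?_⟩
  intro a b d σ pb x₀ ρ S ε B w wq wp V Vq Vp ha hb hd hld hdet hσ hρ hε0 hx₀ hwc hVc hw hV hB hε hS hbd
  have hdp : 0 < d := by linarith
  set κ : ℝ := √(a * d - b ^ 2) with hκ
  have hκ2 : κ ^ 2 = a * d - b ^ 2 := Real.sq_sqrt (by linarith)
  have hκl : √lam ≤ κ := Real.sqrt_le_sqrt hdet
  have hκp : 0 < κ := by linarith
  have hκL : κ ≤ Lam := by
    rw [hκ]; apply Real.sqrt_le_iff.2 ⟨hLam.le, ?_⟩
    have : a * d ≤ Lam * Lam := by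
      have := (abs_le.1 ha).2
      calc a * d ≤ Lam * d := by gcongr
        _ ≤ _ := by gcongr
    nlinarith [sq_nonneg b]
  have hS0 : 0 ≤ S := (abs_nonneg _).trans (hS x₀ (Metric.mem_ball_self hρ) hx₀).1
  have hdiv : ∀ t, |t| ≤ Lam → |t / κ| ≤ Lam / √lam := fun t ht => by
    rw [abs_div, abs_of_pos hκp]; gcongr
  have hbκ := hdiv b hb
  have hdκ := hdiv d (by rw [abs_of_pos hdp]; exact hd)
  let z₀ : ℝ × ℝ := (x₀.1 - b / d * (x₀.2 - pb), κ / d * (x₀.2 - pb))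
  let T : ℝ × ℝ → ℝ × ℝ := fun z => (z.1 + b / κ * z.2, pb + d / κ * z.2)
  let A : ℝ × ℝ →L[ℝ] ℝ × ℝ := (lin 1 (b / κ)).prod (lin 0 (d / κ))
  have hTz₀ : T z₀ = x₀ := by
    ext
    · simp only [T, z₀]; field_simp; ring
    · simp only [T, z₀]; field_simp; ring
  have hTsub : ∀ z, T z - x₀ = A (z - z₀) := by
    intro z; rw [← hTz₀]
    ext <;> simp [T, A] <;> ring
  have hAle : ∀ z, ‖A z‖ ≤ K * ‖z‖ := by
    intro z
    rw [Prod.norm_def]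
    have hz := norm_nonneg z
    refine max_le ?_ ?_
    · refine (abs_lin_le 1 (b / κ) z).trans ?_
      gcongr
      rw [abs_one, hK, mul_div_assoc]
      have : 0 < Lam / √lam := by positivity
      linarith
    · refine (abs_lin_le 0 (d / κ) z).trans ?_
      gcongr
      rw [abs_zero, hK, mul_div_assoc]
      have : 0 < Lam / √lam := by positivity
      linarith
  have hTside : ∀ z, σ * ((T z).2 - pb) = d / κ * (σ * z.2) := by
    intro z; simp only [T]; ring
  have hdk : 0 < d / κ := by positivity
  have hlt : ∀ z : ℝ × ℝ, σ * z.2 < 0 → σ * ((T z).2 - pb) < 0 := fun z hz => by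
    rw [hTside]; exact mul_neg_of_pos_of_neg hdk hz
  have hle : ∀ z : ℝ × ℝ, σ * z.2 ≤ 0 → σ * ((T z).2 - pb) ≤ 0 := fun z hz => by
    rw [hTside]; exact mul_nonpos_of_nonneg_of_nonpos hdk.le hz
  have hRp : 0 < ρ / K := by positivity
  have hball : ∀ z ∈ Metric.ball z₀ (ρ / K), T z ∈ Metric.ball x₀ ρ := by
    intro z hz
    rw [mem_ball_iff_norm] at hz ⊢
    rw [hTsub]
    calc _ ≤ K * ‖z - z₀‖ := hAle _
      _ < K * (ρ / K) := by gcongr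
      _ = ρ := by field_simp
  have hTc : Continuous T := by fun_prop
  let f : ℝ × ℝ → ℂ := fun z => (κ * w (T z) : ℝ) + Complex.I * (V (T z) : ℝ)
  let fx : ℝ × ℝ → ℂ := fun z => (κ * wq (T z) : ℝ) + Complex.I * (Vq (T z) : ℝ)
  let fy : ℝ × ℝ → ℂ := fun z => (κ * lin (wq (T z)) (wp (T z)) (b / κ, d / κ) : ℝ) +
    Complex.I * (lin (Vq (T z)) (Vp (T z)) (b / κ, d / κ) : ℝ)
  have hu : ∃ u : ℝ, |u| = 1 ∧ ∀ p ∈ Metric.ball z₀ (ρ / K), p.2 = 0 →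
      f p = u * (starRingEnd ℂ) (f p) := by
    have hT0 : ∀ p : ℝ × ℝ, p.2 = 0 → (T p).2 = pb := fun p hp => by simp [T, hp]
    rcases hbd with h | h
    · refine ⟨-1, by simp, fun p hp hp0 => ?_⟩
      have := h _ (hball p hp) (hT0 p hp0)
      simp [f, this]
    · refine ⟨1, by simp, fun p hp hp0 => ?_⟩
      have := h _ (hball p hp) (hT0 p hp0)
      simp [f, this]
  obtain ⟨u, hu1, husym⟩ := hu
  have hz₀s : σ * z₀.2 ≤ 0 := by
    have : σ * z₀.2 = κ / d * (σ * (x₀.2 - pb)) := by simp only [z₀]; ring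
    rw [this]
    exact mul_nonpos_of_nonneg_of_nonpos (by positivity) hx₀
  have hnorm : ∀ s t : ℝ, ‖(s : ℂ) + Complex.I * (t : ℂ)‖ ≤ |s| + |t| := fun s t => by
    refine (norm_add_le _ _).trans ?_
    rw [norm_mul, Complex.norm_I, one_mul, Complex.norm_real, Complex.norm_real]; rfl
  have hmaps : MapsTo T (Metric.ball z₀ (ρ / K) ∩ {p | σ * p.2 ≤ 0})
      (Metric.ball x₀ ρ ∩ {p | σ * (p.2 - pb) ≤ 0}) := fun z hz => ⟨hball z hz.1, hle z hz.2⟩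
  have hB0 : ∀ z ∈ Metric.ball z₀ (ρ / K), σ * z.2 < 0 → 0 ≤ B := fun z hz hzs =>
    (abs_nonneg _).trans (hB _ (hball z hz) (hlt z hzs)).1
  obtain ⟨α, β, hab⟩ := H σ u z₀ (ρ / K) f fx fy ((Lam + 1) * S) (ε * K)
    ((Lam + 1) * (B * (2 * (Lam / √lam)) + B)) hσ hu1 hRp hz₀s
    (by
      have h1 := hwc.comp hTc.continuousOn hmaps
      have h2 := hVc.comp hTc.continuousOn hmaps
      exact (Complex.continuous_ofReal.comp_continuousOn (continuousOn_const.mul h1)).add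
        (continuousOn_const.mul (Complex.continuous_ofReal.comp_continuousOn h2)))
    (fun z hz hzs => by
      have h1 := hw _ (hball z hz) (hlt z hzs)
      have h2 := hV _ (hball z hz) (hlt z hzs)
      have h3 : HasDerivAt (fun t : ℝ => T (t, z.2)) (1, 0) z.1 := by
        have e1 : HasDerivAt (fun t : ℝ => t + b / κ * z.2) 1 z.1 := by
          simpa using (hasDerivAt_id z.1).add_const (b / κ * z.2)
        have e2 : HasDerivAt (fun _ : ℝ => pb + d / κ * z.2) 0 z.1 := hasDerivAt_const _ _
        exact e1.prodMk e2
      have h4 := HasFDerivAt.comp_hasDerivAt (f := fun t : ℝ => T (t, z.2)) z.1 h1 h3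
      have h5 := HasFDerivAt.comp_hasDerivAt (f := fun t : ℝ => T (t, z.2)) z.1 h2 h3
      rw [lin_apply] at h4 h5
      simp only [mul_one, mul_zero, add_zero] at h4 h5
      exact ((h4.const_mul κ).ofReal_comp).add (h5.ofReal_comp.const_mul Complex.I))
    (fun z hz hzs => by
      have h1 := hw _ (hball z hz) (hlt z hzs)
      have h2 := hV _ (hball z hz) (hlt z hzs)
      have h3 : HasDerivAt (fun t : ℝ => T (z.1, t)) (b / κ, d / κ) z.2 := by
        have e1 : HasDerivAt (fun t : ℝ => z.1 + b / κ * t) (b / κ) z.2 := by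
          simpa using ((hasDerivAt_id z.2).const_mul (b / κ)).const_add z.1
        have e2 : HasDerivAt (fun t : ℝ => pb + d / κ * t) (d / κ) z.2 := by
          simpa using ((hasDerivAt_id z.2).const_mul (d / κ)).const_add pb
        exact e1.prodMk e2
      have h4 := HasFDerivAt.comp_hasDerivAt (f := fun t : ℝ => T (z.1, t)) z.2 h1 h3
      have h5 := HasFDerivAt.comp_hasDerivAt (f := fun t : ℝ => T (z.1, t)) z.2 h2 h3
      exact ((h4.const_mul κ).ofReal_comp).add (h5.ofReal_comp.const_mul Complex.I))
    (fun z hz hzs => by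
      obtain ⟨b1, b2, b3, b4⟩ := hB _ (hball z hz) (hlt z hzs)
      have hB0' := hB0 z hz hzs
      have hq : 0 < Lam / √lam := by positivity
      have hl : ∀ s t : ℝ, |s| ≤ B → |t| ≤ B →
          |lin s t (b / κ, d / κ)| ≤ B * (2 * (Lam / √lam)) := by
        intro s t hs ht
        rw [lin_apply]
        refine (abs_add_le _ _).trans ?_
        rw [abs_mul, abs_mul]
        calc _ ≤ B * (Lam / √lam) + B * (Lam / √lam) := by gcongr
          _ = _ := by ring
      have hgen : ∀ s t : ℝ, |s| ≤ B * (2 * (Lam / √lam)) + B → |t| ≤ B * (2 * (Lam / √lam)) + B →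
          ‖((κ * s : ℝ) : ℂ) + Complex.I * (t : ℂ)‖ ≤
            (Lam + 1) * (B * (2 * (Lam / √lam)) + B) := by
        intro s t hs ht
        refine (hnorm _ _).trans ?_
        rw [abs_mul, abs_of_pos hκp, add_mul, one_mul]
        gcongr
      have hX : 0 ≤ B * (2 * (Lam / √lam)) := by positivity
      exact ⟨hgen _ _ (by linarith) (by linarith),
        hgen _ _ (by linarith [hl _ _ b1 b2]) (by linarith [hl _ _ b3 b4])⟩)
    (fun z hz hzs => by
      obtain ⟨e1, e2⟩ := hε _ (hball z hz) (hlt z hzs)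
      set E1 := Vp (T z) - (a * wq (T z) + b * wp (T z)) with hE1
      set E2 := Vq (T z) + (b * wq (T z) + d * wp (T z)) with hE2
      have hVp : Vp (T z) = E1 + (a * wq (T z) + b * wp (T z)) := by rw [hE1]; ring
      have hVq : Vq (T z) = E2 - (b * wq (T z) + d * wp (T z)) := by rw [hE2]; ring
      have h1 : κ * wq (T z) - lin (Vq (T z)) (Vp (T z)) (b / κ, d / κ) =
          -(b / κ * E2 + d / κ * E1) := by
        rw [lin_apply, hVp, hVq]
        field_simp
        linear_combination (wq (T z)) * hκ2
      have h2 : Vq (T z) + κ * lin (wq (T z)) (wp (T z)) (b / κ, d / κ) = E2 := by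
        rw [lin_apply, hVq]; field_simp; ring
      have h3 : fx z + Complex.I * fy z =
          ((κ * wq (T z) - lin (Vq (T z)) (Vp (T z)) (b / κ, d / κ) : ℝ) : ℂ) +
          Complex.I * ((Vq (T z) + κ * lin (wq (T z)) (wp (T z)) (b / κ, d / κ) : ℝ) : ℂ) := by
        simp only [fx, fy]
        push_cast
        linear_combination ((lin (Vq (T z)) (Vp (T z)) (b / κ, d / κ) : ℝ) : ℂ) * Complex.I_sq
      rw [h3, h1, h2]
      refine (hnorm _ _).trans ?_
      rw [abs_neg]
      have h4 : |b / κ * E2 + d / κ * E1| ≤ Lam / √lam * ε + Lam / √lam * ε := by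
        refine (abs_add_le _ _).trans ?_
        rw [abs_mul, abs_mul]
        gcongr
      rw [hK, mul_div_assoc]
      linarith)
    (fun z hz hzs => by
      obtain ⟨s1, s2⟩ := hS _ (hball z hz) (hle z hzs)
      refine (hnorm _ _).trans ?_
      rw [abs_mul, abs_of_pos hκp, add_mul, one_mul]
      gcongr)
    husym
  refine ⟨α.re / κ, β.re / κ, (-(β.re * (b / d)) - β.im * (κ / d)) / κ, ?_⟩
  intro x hx hxs
  let z : ℝ × ℝ := (x.1 - b / d * (x.2 - pb), κ / d * (x.2 - pb))
  have hTz : T z = x := by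
    ext
    · simp only [T, z]; field_simp; ring
    · simp only [T, z]; field_simp; ring
  have hzz : z - z₀ = (lin 1 (-(b / d)) (x - x₀), lin 0 (κ / d) (x - x₀)) := by
    ext <;> simp [z, z₀] <;> ring
  have hzn : ‖z - z₀‖ ≤ K' * ‖x - x₀‖ := by
    rw [hzz, Prod.norm_def]
    have h1 : |b / d| ≤ Lam / lam := by rw [abs_div, abs_of_pos hdp]; gcongr
    have h2 : |κ / d| ≤ Lam / lam := by rw [abs_div, abs_of_pos hdp, abs_of_pos hκp]; gcongr
    refine max_le ?_ ?_
    · refine (abs_lin_le _ _ _).trans ?_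
      gcongr
      rw [abs_one, abs_neg, hK']; linarith
    · refine (abs_lin_le _ _ _).trans ?_
      gcongr
      rw [abs_zero, hK']; linarith
  have hzs : σ * z.2 ≤ 0 := by
    have : σ * z.2 = κ / d * (σ * (x.2 - pb)) := by simp only [z]; ring
    rw [this]
    exact mul_nonpos_of_nonneg_of_nonpos (by positivity) hxs
  have h1 := hab z (by
    calc ‖z - z₀‖ ≤ K' * ‖x - x₀‖ := hzn
      _ ≤ K' * (1 / (4 * K * K') * ρ) := by gcongr
      _ = ρ / K / 4 := by field_simp) hzs
  have h2 : (f z - α - β * toC (z - z₀)).re =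
      κ * (w x - α.re / κ - lin (β.re / κ) ((-(β.re * (b / d)) - β.im * (κ / d)) / κ) (x - x₀)) := by
    simp only [f, hTz, hzz, toC, lin_apply]
    simp
    field_simp
    ring
  have h3 := (Complex.abs_re_le_norm _).trans h1
  rw [h2, abs_mul, abs_of_pos hκp] at h3
  have h4 : √lam * |w x - α.re / κ -
      lin (β.re / κ) ((-(β.re * (b / d)) - β.im * (κ / d)) / κ) (x - x₀)| ≤
      C₁ * ((Lam + 1) * S * (K' * ‖x - x₀‖ / (ρ / K)) ^ 2 + ε * ρ) := by
    refine (mul_le_mul_of_nonneg_right hκl (abs_nonneg _)).trans (h3.trans ?_)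
    have : ε * K * (ρ / K) = ε * ρ := by field_simp
    rw [this]
    gcongr
  have h5 : (K' * ‖x - x₀‖ / (ρ / K)) ^ 2 = (K' * K) ^ 2 * (‖x - x₀‖ / ρ) ^ 2 := by
    field_simp
  rw [h5] at h4
  set X := (‖x - x₀‖ / ρ) ^ 2
  have hX : 0 ≤ X := by positivity
  rw [div_mul_eq_mul_div, le_div_iff₀ hsl, mul_comm, mul_assoc]
  refine h4.trans ?_
  gcongr
  have p1 : 0 ≤ S * X := by positivity
  have p2 : 0 ≤ ε * ρ := by positivity
  have p3 : 0 ≤ (Lam + 1) * (K' * K) ^ 2 := by positivity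
  nlinarith [mul_nonneg p3 p2, mul_nonneg hKp.le p1, mul_nonneg (sub_nonneg.2 hK1) p2]

theorem le_of_contraction {ι : Type*} {X Y : ι → ℝ} {N₀ θ B : ℝ} (hN₀ : 0 ≤ N₀) (hθ : 0 ≤ θ)
    (hθ1 : θ < 1) (hB : 0 ≤ B) (h0 : ∀ i, X i ≤ N₀ * Y i)
    (hstep : ∀ N, 0 ≤ N → (∀ i, X i ≤ N * Y i) → ∀ i, X i ≤ (θ * N + B) * Y i) (i : ι) :
    X i ≤ B / (1 - θ) * Y i := by
  have h1 : 0 < 1 - θ := by linarith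
  have hseq : ∀ k : ℕ, 0 ≤ θ ^ k * N₀ + (1 - θ ^ k) * (B / (1 - θ)) ∧
      ∀ i, X i ≤ (θ ^ k * N₀ + (1 - θ ^ k) * (B / (1 - θ))) * Y i := by
    intro k
    induction k with
    | zero => simpa using ⟨hN₀, h0⟩
    | succ k ih =>
      have e : θ * (θ ^ k * N₀ + (1 - θ ^ k) * (B / (1 - θ))) + B =
          θ ^ (k + 1) * N₀ + (1 - θ ^ (k + 1)) * (B / (1 - θ)) := by
        field_simp; ring
      rw [← e]
      exact ⟨add_nonneg (mul_nonneg hθ ih.1) hB, hstep _ ih.1 ih.2⟩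
  have hlim : Tendsto (fun k : ℕ => (θ ^ k * N₀ + (1 - θ ^ k) * (B / (1 - θ))) * Y i) atTop
      (nhds ((0 * N₀ + (1 - 0) * (B / (1 - θ))) * Y i)) := by
    have := tendsto_pow_atTop_nhds_zero_of_lt_one hθ hθ1
    exact ((this.mul_const _).add ((this.const_sub 1).mul_const _)).mul_const _
  have := ge_of_tendsto' hlim fun k => (hseq k).2 i
  simpa using this

/-- `wq` and `wp` are the partial derivatives of `w` on the closed strip. -/
structure HasPartials (p₀ : ℝ) (w wq wp : ℝ × ℝ → ℝ) : Prop where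
  fst : ∀ x ∈ Obar p₀, HasDerivAt (fun t => w (t, x.2)) (wq x) x.1
  snd : ∀ x ∈ Obar p₀, HasDerivWithinAt (fun t => w (x.1, t)) (wp x) (Icc p₀ 0) x.2

/-- `N` is a Hölder constant of `f` on the closed strip. -/
def HolderC (p₀ α : ℝ) (f : ℝ × ℝ → ℝ) (N : ℝ) : Prop :=
  ∀ x ∈ Obar p₀, ∀ y ∈ Obar p₀, |f x - f y| ≤ N * ‖x - y‖ ^ α

theorem mem_Obar {p₀ : ℝ} {x : ℝ × ℝ} : x ∈ Obar p₀ ↔ p₀ ≤ x.2 ∧ x.2 ≤ 0 := by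
  simp [Obar, Set.mem_prod]

theorem HolderC.continuousOn {p₀ α : ℝ} {f : ℝ × ℝ → ℝ} {N : ℝ} (hα : 0 < α)
    (h : HolderC p₀ α f N) : ContinuousOn f (Obar p₀) := by
  intro y hy
  have h0 : Tendsto (fun x : ℝ × ℝ => N * ‖x - y‖ ^ α) (nhdsWithin y (Obar p₀)) (nhds 0) := by
    have : Continuous fun x : ℝ × ℝ => N * ‖x - y‖ ^ α :=
      continuous_const.mul ((by fun_prop : Continuous fun x : ℝ × ℝ => ‖x - y‖).rpow_const
        fun _ => Or.inr hα.le)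
    have h2 := (this.tendsto y).mono_left (nhdsWithin_le_nhds (s := Obar p₀))
    simpa [hα.ne'] using h2
  rw [ContinuousWithinAt, tendsto_iff_norm_sub_tendsto_zero]
  refine squeeze_zero_norm' ?_ h0
  filter_upwards [self_mem_nhdsWithin] with x hx
  rw [norm_norm]
  exact h x hx y hy

theorem abs_sub_sub_mul_le_of_deriv {f f' : ℝ → ℝ} {s : Set ℝ} (hs : Convex ℝ s) {m K : ℝ}
    {u v : ℝ} (hu : u ∈ s) (hv : v ∈ s)
    (hf : ∀ t ∈ s, HasDerivWithinAt f (f' t) s t) (hK : ∀ t ∈ uIcc u v, |f' t - m| ≤ K) :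
    |f v - f u - m * (v - u)| ≤ K * |v - u| := by
  have hsub : uIcc u v ⊆ s := by
    rw [← segment_eq_uIcc]; exact hs.segment_subset hu hv
  have h := (convex_uIcc u v).norm_image_sub_le_of_norm_hasDerivWithin_le
    (f := fun t => f t - m * t) (f' := fun t => f' t - m) (C := K)
    (fun t ht => ((hf t (hsub ht)).mono hsub).sub
      (by simpa using ((hasDerivWithinAt_id t (uIcc u v)).const_mul m)))
    hK left_mem_uIcc right_mem_uIcc
  rw [Real.norm_eq_abs, Real.norm_eq_abs] at h
  convert h using 2
  ring

theorem HasPartials.taylor {p₀ α : ℝ} {w wq wp : ℝ × ℝ → ℝ} {N : ℝ} (hα : 0 ≤ α) (hN : 0 ≤ N)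
    (hw : HasPartials p₀ w wq wp) (hq : HolderC p₀ α wq N) (hp : HolderC p₀ α wp N)
    {x y : ℝ × ℝ} (hx : x ∈ Obar p₀) (hy : y ∈ Obar p₀) :
    |w x - w y - lin (wq y) (wp y) (x - y)| ≤ 2 * N * (‖x - y‖ * ‖x - y‖ ^ α) := by
  have n1 : |x.1 - y.1| ≤ ‖x - y‖ := norm_fst_le (x - y)
  have n2 : |x.2 - y.2| ≤ ‖x - y‖ := norm_snd_le (x - y)
  rw [mem_Obar] at hx hy
  have h1 : |w (x.1, y.2) - w (y.1, y.2) - wq y * (x.1 - y.1)| ≤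
      N * ‖x - y‖ ^ α * |x.1 - y.1| := by
    refine abs_sub_sub_mul_le_of_deriv (f := fun t => w (t, y.2)) (f' := fun t => wq (t, y.2))
      convex_univ (mem_univ _) (mem_univ _)
      (fun t _ => (hw.fst (t, y.2) (mem_Obar.2 hy)).hasDerivWithinAt) ?_
    intro t ht
    refine (hq (t, y.2) (mem_Obar.2 hy) y (mem_Obar.2 hy)).trans ?_
    gcongr
    rw [Prod.norm_def]
    simp only [Prod.fst_sub, Prod.snd_sub, sub_self, norm_zero]
    refine max_le ?_ (norm_nonneg _)
    exact (abs_sub_left_of_mem_uIcc ht).trans n1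
  have h2 : |w (x.1, x.2) - w (x.1, y.2) - wp y * (x.2 - y.2)| ≤
      N * ‖x - y‖ ^ α * |x.2 - y.2| := by
    refine abs_sub_sub_mul_le_of_deriv (f := fun t => w (x.1, t)) (f' := fun t => wp (x.1, t))
      (convex_Icc p₀ 0) (Set.mem_Icc.2 hy) (Set.mem_Icc.2 hx)
      (fun t ht => hw.snd (x.1, t) (mem_Obar.2 ht)) ?_
    intro t ht
    have htm : t ∈ Icc p₀ 0 := (ordConnected_Icc.uIcc_subset (Set.mem_Icc.2 hy) (Set.mem_Icc.2 hx)) ht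
    refine (hp (x.1, t) (mem_Obar.2 htm) y (mem_Obar.2 hy)).trans ?_
    gcongr
    rw [Prod.norm_def]
    simp only [Prod.fst_sub, Prod.snd_sub]
    exact max_le n1 ((abs_sub_left_of_mem_uIcc ht).trans n2)
  have e : w x - w y - lin (wq y) (wp y) (x - y) =
      (w (x.1, y.2) - w (y.1, y.2) - wq y * (x.1 - y.1)) +
      (w (x.1, x.2) - w (x.1, y.2) - wp y * (x.2 - y.2)) := by
    rw [lin_apply]; simp; ring
  rw [e]
  have hr : 0 ≤ N * ‖x - y‖ ^ α := by positivity
  calc _ ≤ N * ‖x - y‖ ^ α * |x.1 - y.1| + N * ‖x - y‖ ^ α * |x.2 - y.2| :=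
        (abs_add_le _ _).trans (add_le_add h1 h2)
    _ ≤ N * ‖x - y‖ ^ α * ‖x - y‖ + N * ‖x - y‖ ^ α * ‖x - y‖ := by gcongr
    _ = _ := by ring

theorem hasFDerivWithinAt_of_taylor {α N : ℝ} (hα : 0 < α) {s : Set (ℝ × ℝ)}
    {w : ℝ × ℝ → ℝ} {L : ℝ × ℝ →L[ℝ] ℝ} {y : ℝ × ℝ}
    (h : ∀ x ∈ s, |w x - w y - L (x - y)| ≤ N * (‖x - y‖ * ‖x - y‖ ^ α)) :
    HasFDerivWithinAt w L s y := by
  rw [hasFDerivWithinAt_iff_tendsto]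
  have h0 : Tendsto (fun x : ℝ × ℝ => N * ‖x - y‖ ^ α) (nhdsWithin y s) (nhds 0) := by
    have : Continuous fun x : ℝ × ℝ => N * ‖x - y‖ ^ α :=
      continuous_const.mul ((by fun_prop : Continuous fun x : ℝ × ℝ => ‖x - y‖).rpow_const
        fun _ => Or.inr hα.le)
    have h2 := (this.tendsto y).mono_left (nhdsWithin_le_nhds (s := s))
    simpa [hα.ne'] using h2
  refine squeeze_zero_norm' ?_ h0
  filter_upwards [self_mem_nhdsWithin] with x hx
  rw [norm_mul, norm_inv, norm_norm, norm_norm]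
  by_cases hxy : ‖x - y‖ = 0
  · rw [hxy, inv_zero, zero_mul, Real.zero_rpow hα.ne', mul_zero]
  · have hpos : 0 < ‖x - y‖ := lt_of_le_of_ne (norm_nonneg _) (Ne.symm hxy)
    rw [inv_mul_le_iff₀ hpos]
    calc _ ≤ _ := h x hx
      _ = _ := by ring

theorem HasPartials.hasFDerivWithinAt {p₀ α : ℝ} {w wq wp : ℝ × ℝ → ℝ} {N : ℝ} (hα : 0 < α)
    (hN : 0 ≤ N)
    (hw : HasPartials p₀ w wq wp) (hq : HolderC p₀ α wq N) (hp : HolderC p₀ α wp N)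
    {y : ℝ × ℝ} (hy : y ∈ Obar p₀) :
    HasFDerivWithinAt w (lin (wq y) (wp y)) (Obar p₀) y :=
  hasFDerivWithinAt_of_taylor hα fun _ hx => hw.taylor hα.le hN hq hp hx hy

theorem HasPartials.hasFDerivAt {p₀ α : ℝ} {w wq wp : ℝ × ℝ → ℝ} {N : ℝ} (hα : 0 < α)
    (hN : 0 ≤ N)
    (hw : HasPartials p₀ w wq wp) (hq : HolderC p₀ α wq N) (hp : HolderC p₀ α wp N)
    {y : ℝ × ℝ} (hy : p₀ < y.2) (hy' : y.2 < 0) :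
    HasFDerivAt w (lin (wq y) (wp y)) y := by
  refine (hw.hasFDerivWithinAt hα hN hq hp (mem_Obar.2 ⟨hy.le, hy'.le⟩)).hasFDerivAt ?_
  have : Obar p₀ ∈ nhds y := by
    refine mem_of_superset (IsOpen.mem_nhds (s := {x : ℝ × ℝ | p₀ < x.2} ∩ {x | x.2 < 0}) ?_
      ⟨hy, hy'⟩) fun x hx => mem_Obar.2 ⟨hx.1.le, hx.2.le⟩
    exact (isOpen_lt continuous_const continuous_snd).inter
      (isOpen_lt continuous_snd continuous_const)
  exact this

theorem abs_slope_le {p₀ A m₁ m₂ s K : ℝ} {x : ℝ × ℝ} (hx : x ∈ Obar p₀)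
    (hs : 0 < s) (hs' : s ≤ -p₀ / 2)
    (h : ∀ y ∈ Obar p₀, ‖y - x‖ ≤ s → |A + lin m₁ m₂ (y - x)| ≤ K) :
    |m₁| ≤ 2 * K / s ∧ |m₂| ≤ 2 * K / s := by
  have h0 := h x hx (by simpa using hs.le)
  rw [sub_self, map_zero, add_zero] at h0
  rw [mem_Obar] at hx
  have key : ∀ m t : ℝ, |t| = s → |A + m * t| ≤ K → |m| ≤ 2 * K / s := by
    intro m t ht hm
    rw [le_div_iff₀ hs, ← ht, ← abs_mul]
    calc |m * t| = |(A + m * t) - A| := by congr 1; ring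
      _ ≤ |A + m * t| + |A| := abs_sub _ _
      _ ≤ 2 * K := by linarith
  refine ⟨key m₁ s (abs_of_pos hs) ?_, ?_⟩
  · have := h (x.1 + s, x.2) (mem_Obar.2 hx) (by
      simp [Prod.norm_def, abs_of_pos hs, hs.le])
    simpa using this
  · rcases le_or_gt (p₀ / 2) x.2 with hh | hh
    · have := h (x.1, x.2 + -s) (mem_Obar.2 ⟨by linarith, by simp only; linarith⟩) (by
        simp [Prod.norm_def, abs_of_pos hs, hs.le])
      exact key m₂ (-s) (by rw [abs_neg, abs_of_pos hs]) (by simpa using this)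
    · have := h (x.1, x.2 + s) (mem_Obar.2 ⟨by simp only; linarith, by simp only; linarith⟩) (by
        simp [Prod.norm_def, abs_of_pos hs, hs.le])
      exact key m₂ s (abs_of_pos hs) (by simpa using this)

theorem abs_slope_sub_le {p₀ m₀ m₁ m₂ n₀ n₁ n₂ s K L : ℝ} {w : ℝ × ℝ → ℝ} {x z : ℝ × ℝ}
    (hx : x ∈ Obar p₀) (hs : 0 < s) (hs' : s ≤ -p₀ / 2)
    (hm : ∀ y ∈ Obar p₀, ‖y - x‖ ≤ s → |w y - m₀ - lin m₁ m₂ (y - x)| ≤ K)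
    (hn : ∀ y ∈ Obar p₀, ‖y - x‖ ≤ s → |w y - n₀ - lin n₁ n₂ (y - z)| ≤ L) :
    |m₁ - n₁| ≤ 2 * (K + L) / s ∧ |m₂ - n₂| ≤ 2 * (K + L) / s := by
  refine abs_slope_le (A := m₀ - n₀ + lin n₁ n₂ (z - x)) hx hs hs' fun y hy hys => ?_
  have e : m₀ - n₀ + lin n₁ n₂ (z - x) + lin (m₁ - n₁) (m₂ - n₂) (y - x) =
      (w y - n₀ - lin n₁ n₂ (y - z)) - (w y - m₀ - lin m₁ m₂ (y - x)) := by
    simp only [lin_apply, Prod.fst_sub, Prod.snd_sub]; ring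
  rw [e]
  refine (abs_sub _ _).trans ?_
  linarith [hm y hy hys, hn y hy hys]

theorem holder_of_affine_approx {α : ℝ} (hα : 0 < α) : ∃ C > 0, ∀ (p₀ : ℝ)
    (w wq wp : ℝ × ℝ → ℝ) (N₀ E r₀ : ℝ), 0 ≤ N₀ → 0 ≤ E → 0 < r₀ → r₀ ≤ -p₀ / 2 →
    HasPartials p₀ w wq wp → HolderC p₀ α wq N₀ → HolderC p₀ α wp N₀ →
    (∀ x ∈ Obar p₀, ∀ r, 0 < r → r ≤ r₀ → ∃ m₀ m₁ m₂ : ℝ, ∀ y ∈ Obar p₀, ‖y - x‖ ≤ r →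
      |w y - m₀ - lin m₁ m₂ (y - x)| ≤ E * (r * r ^ α)) →
    ∀ x ∈ Obar p₀, ∀ y ∈ Obar p₀, ‖x - y‖ ≤ r₀ / 2 →
      |wq x - wq y| ≤ C * E * ‖x - y‖ ^ α ∧ |wp x - wp y| ≤ C * E * ‖x - y‖ ^ α := by
  set θ : ℝ := (1 / 2 : ℝ) ^ α with hθ
  have hθ0 : 0 < θ := by positivity
  have hθ1 : θ < 1 := Real.rpow_lt_one (by norm_num) (by norm_num) hα
  have h1θ : 0 < 1 - θ := by linarith
  have h2α : (2:ℝ) ^ α * θ = 1 := by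
    rw [hθ, ← Real.mul_rpow (by norm_num) (by norm_num)]; norm_num
  refine ⟨(2:ℝ) ^ α * (2 * (8 / (1 - θ)) + 8), by positivity, ?_⟩
  intro p₀ w wq wp N₀ E r₀ hN₀ hE hr₀ hr₀' hw hq hp H
  choose! m₀ m₁ m₂ hm using H
  have hcmp : ∀ x ∈ Obar p₀, ∀ y ∈ Obar p₀, ∀ r r', 0 < r → r ≤ r₀ → 0 < r' → r' ≤ r →
      ‖x - y‖ ≤ r / 2 → r / 2 ≤ r' → (r' = r ∨ x = y) →
      |m₁ x r - m₁ y r'| ≤ 8 * E * r ^ α ∧ |m₂ x r - m₂ y r'| ≤ 8 * E * r ^ α := by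
    intro x hx y hy r r' hr hrr hr' hrr' hxy h2 hor
    have := abs_slope_sub_le (s := r / 2) (K := E * (r * r ^ α)) (L := E * (r * r ^ α))
      (m₀ := m₀ x r) (m₁ := m₁ x r) (m₂ := m₂ x r) (n₀ := m₀ y r') (n₁ := m₁ y r')
      (n₂ := m₂ y r') (w := w) (z := y) hx (by linarith) (by linarith)
      (fun z hz hzx => hm x hx r hr hrr z hz (by linarith))
      (fun z hz hzx => (hm y hy r' hr' (by linarith) z hz (by
        rcases hor with h | h
        · have : ‖z - y‖ ≤ ‖z - x‖ + ‖x - y‖ := norm_sub_le_norm_sub_add_norm_sub _ _ _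
          linarith
        · rw [← h]; linarith)).trans (by gcongr))
    have e : 2 * (E * (r * r ^ α) + E * (r * r ^ α)) / (r / 2) = 8 * E * r ^ α := by
      field_simp; ring
    rwa [e] at this
  have hlim : ∀ x ∈ Obar p₀, ∀ r, 0 < r → r ≤ r₀ →
      max |wq x - m₁ x r| |wp x - m₂ x r| ≤ 8 * E / (1 - θ) * r ^ α := by
    intro x hx r hr hrr
    refine le_of_contraction (ι := {i : (ℝ × ℝ) × ℝ // i.1 ∈ Obar p₀ ∧ 0 < i.2 ∧ i.2 ≤ r₀})
      (X := fun i => max |wq i.1.1 - m₁ i.1.1 i.1.2| |wp i.1.1 - m₂ i.1.1 i.1.2|)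
      (Y := fun i => i.1.2 ^ α) (N₀ := 2 * (2 * N₀ + E)) (θ := θ) (B := 8 * E)
      (by positivity) hθ0.le hθ1 (by positivity) ?_ ?_ ⟨(x, r), hx, hr, hrr⟩
    · rintro ⟨⟨x, r⟩, hx, hr, hrr⟩
      simp only at hx hr hrr ⊢
      have := abs_slope_sub_le (s := r) (K := 2 * N₀ * (r * r ^ α)) (L := E * (r * r ^ α))
        (m₀ := w x) (m₁ := wq x) (m₂ := wp x) (w := w) hx hr (by linarith)
        (fun z hz hzx => (hw.taylor hα.le hN₀ hq hp hz hx).trans (by gcongr))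
        (fun z hz hzx => hm x hx r hr hrr z hz hzx)
      have e : 2 * (2 * N₀ * (r * r ^ α) + E * (r * r ^ α)) / r = 2 * (2 * N₀ + E) * r ^ α := by
        field_simp
      rw [e] at this
      exact max_le this.1 this.2
    · rintro N hN hX ⟨⟨x, r⟩, hx, hr, hrr⟩
      simp only at hx hr hrr ⊢
      have h1 := hX ⟨(x, r / 2), hx, by simp only; linarith, by simp only; linarith⟩
      simp only at h1
      have h2 := hcmp x hx x hx r (r / 2) hr hrr (by linarith) (by linarith)
        (by simp; linarith) le_rfl (Or.inr rfl)
      have e : (r / 2) ^ α = θ * r ^ α := by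
        rw [hθ, ← Real.mul_rpow (by norm_num) hr.le]; congr 1; ring
      rw [e] at h1
      rw [add_mul]
      have e2 : θ * N * r ^ α = N * (θ * r ^ α) := by ring
      rw [e2]
      refine max_le ?_ ?_
      · calc |wq x - m₁ x r| = |(wq x - m₁ x (r / 2)) - (m₁ x r - m₁ x (r / 2))| := by congr 1; ring
          _ ≤ |wq x - m₁ x (r / 2)| + |m₁ x r - m₁ x (r / 2)| := abs_sub _ _
          _ ≤ _ := add_le_add ((le_max_left _ _).trans h1) h2.1
      · calc |wp x - m₂ x r| = |(wp x - m₂ x (r / 2)) - (m₂ x r - m₂ x (r / 2))| := by congr 1; ring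
          _ ≤ |wp x - m₂ x (r / 2)| + |m₂ x r - m₂ x (r / 2)| := abs_sub _ _
          _ ≤ _ := add_le_add ((le_max_right _ _).trans h1) h2.2
  intro x hx y hy hxy
  rcases eq_or_ne x y with rfl | hne
  · simp [hα.ne']
  have hpos : 0 < ‖x - y‖ := norm_pos_iff.2 (sub_ne_zero.2 hne)
  set t := ‖x - y‖
  have h1 := hlim x hx (2 * t) (by linarith) (by linarith)
  have h2 := hlim y hy (2 * t) (by linarith) (by linarith)
  have h3 := hcmp x hx y hy (2 * t) (2 * t) (by linarith) (by linarith) (by linarith) le_rfl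
    (by linarith) (by linarith) (Or.inl rfl)
  have e : 2 ^ α * (2 * (8 / (1 - θ)) + 8) * E * t ^ α =
      8 * E / (1 - θ) * (2 * t) ^ α + 8 * E * (2 * t) ^ α + 8 * E / (1 - θ) * (2 * t) ^ α := by
    rw [Real.mul_rpow (by norm_num) hpos.le]; ring
  rw [e]
  constructor
  · calc |wq x - wq y| = |(wq x - m₁ x (2 * t)) + (m₁ x (2 * t) - m₁ y (2 * t)) -
          (wq y - m₁ y (2 * t))| := by congr 1; ring
      _ ≤ |(wq x - m₁ x (2 * t)) + (m₁ x (2 * t) - m₁ y (2 * t))| + |wq y - m₁ y (2 * t)| :=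
        abs_sub _ _
      _ ≤ |wq x - m₁ x (2 * t)| + |m₁ x (2 * t) - m₁ y (2 * t)| + |wq y - m₁ y (2 * t)| := by
        gcongr; exact abs_add_le _ _
      _ ≤ _ := add_le_add (add_le_add ((le_max_left _ _).trans h1) h3.1)
        ((le_max_left _ _).trans h2)
  · calc |wp x - wp y| = |(wp x - m₂ x (2 * t)) + (m₂ x (2 * t) - m₂ y (2 * t)) -
          (wp y - m₂ y (2 * t))| := by congr 1; ring
      _ ≤ |(wp x - m₂ x (2 * t)) + (m₂ x (2 * t) - m₂ y (2 * t))| + |wp y - m₂ y (2 * t)| :=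
        abs_sub _ _
      _ ≤ |wp x - m₂ x (2 * t)| + |m₂ x (2 * t) - m₂ y (2 * t)| + |wp y - m₂ y (2 * t)| := by
        gcongr; exact abs_add_le _ _
      _ ≤ _ := add_le_add (add_le_add ((le_max_right _ _).trans h1) h3.2)
        ((le_max_right _ _).trans h2)

/-- A first-order elliptic system `V_p = a w_q + b w_p + f₁`, `V_q = -(b w_q + d w_p + f₂)` on the
closed strip, with `V = 0` on the top and `w = 0` on the bottom. -/
structure EllipticSystem (p₀ α lam Lam F : ℝ) (a b d f₁ f₂ w wq wp V Vq Vp : ℝ × ℝ → ℝ) :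
    Prop where
  w_partials : HasPartials p₀ w wq wp
  V_partials : HasPartials p₀ V Vq Vp
  a_le : ∀ x ∈ Obar p₀, |a x| ≤ Lam
  b_le : ∀ x ∈ Obar p₀, |b x| ≤ Lam
  d_le : ∀ x ∈ Obar p₀, |d x| ≤ Lam
  a_holder : HolderC p₀ α a Lam
  b_holder : HolderC p₀ α b Lam
  d_holder : HolderC p₀ α d Lam
  le_d : ∀ x ∈ Obar p₀, lam ≤ d x
  le_det : ∀ x ∈ Obar p₀, lam ≤ a x * d x - b x ^ 2
  f₁_holder : HolderC p₀ α f₁ F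
  f₂_holder : HolderC p₀ α f₂ F
  Vp_eq : ∀ x ∈ Obar p₀, Vp x = a x * wq x + b x * wp x + f₁ x
  Vq_eq : ∀ x ∈ Obar p₀, Vq x = -(b x * wq x + d x * wp x + f₂ x)
  top : ∀ q, V (q, 0) = 0
  bottom : ∀ q, w (q, p₀) = 0

theorem HolderC.mul {p₀ α A N M G : ℝ} {f k : ℝ × ℝ → ℝ}
    (hA : 0 ≤ A) (hM : 0 ≤ M) (hf : ∀ x ∈ Obar p₀, |f x| ≤ A) (hf' : HolderC p₀ α f M)
    (hk : ∀ x ∈ Obar p₀, |k x| ≤ G) (hk' : HolderC p₀ α k N) :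
    HolderC p₀ α (fun x => f x * k x) (A * N + M * G) := by
  intro x hx y hy
  have e : f x * k x - f y * k y = f x * (k x - k y) + (f x - f y) * k y := by ring
  rw [e, add_mul]
  refine (abs_add_le _ _).trans (add_le_add ?_ ?_)
  · rw [abs_mul, mul_assoc]
    exact mul_le_mul (hf x hx) (hk' x hx y hy) (abs_nonneg _) hA
  · rw [abs_mul, mul_right_comm]
    exact mul_le_mul (hf' x hx y hy) (hk y hy) (abs_nonneg _) (by positivity)

theorem HolderC.add {p₀ α N M : ℝ} {f k : ℝ × ℝ → ℝ}
    (hf : HolderC p₀ α f M) (hk : HolderC p₀ α k N) :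
    HolderC p₀ α (fun x => f x + k x) (M + N) := by
  intro x hx y hy
  have e : f x + k x - (f y + k y) = (f x - f y) + (k x - k y) := by ring
  rw [e, add_mul]
  exact (abs_add_le _ _).trans (add_le_add (hf x hx y hy) (hk x hx y hy))

theorem HolderC.neg {p₀ α M : ℝ} {f : ℝ × ℝ → ℝ} (hf : HolderC p₀ α f M) :
    HolderC p₀ α (fun x => -f x) M := by
  intro x hx y hy
  rw [neg_sub_neg, abs_sub_comm]
  exact hf x hx y hy

theorem HolderC.mono {p₀ α M N : ℝ} {f : ℝ × ℝ → ℝ} (hf : HolderC p₀ α f M) (h : M ≤ N) :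
    HolderC p₀ α f N := fun x hx y hy => (hf x hx y hy).trans (by gcongr)

theorem HolderC.congr {p₀ α M : ℝ} {f k : ℝ × ℝ → ℝ} (hf : HolderC p₀ α f M)
    (h : ∀ x ∈ Obar p₀, k x = f x) : HolderC p₀ α k M := fun x hx y hy => by
  rw [h x hx, h y hy]; exact hf x hx y hy

theorem exists_boundary_point {p₀ ρ : ℝ} {x₀ : ℝ × ℝ} (hx₀ : x₀ ∈ Obar p₀) (hρ : 0 < ρ)
    (hρ' : ρ ≤ -p₀ / 2) : ∃ σ pb : ℝ, ∃ y₀ ∈ Obar p₀, |σ| = 1 ∧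
      ((σ = 1 ∧ pb = 0) ∨ (σ = -1 ∧ pb = p₀)) ∧
      (∀ x ∈ Metric.ball x₀ ρ, σ * (x.2 - pb) ≤ 0 ↔ x ∈ Obar p₀) ∧
      (∀ x ∈ Metric.ball x₀ ρ, σ * (x.2 - pb) < 0 → p₀ < x.2 ∧ x.2 < 0) ∧
      (∀ x ∈ Metric.ball x₀ ρ, x.2 = pb → y₀.2 = pb) ∧
      (∀ x ∈ Metric.ball x₀ ρ, ‖x - y₀‖ ≤ 2 * ρ) := by
  classical
  have hball : ∀ x ∈ Metric.ball x₀ ρ, |x.2 - x₀.2| < ρ := fun x hx => by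
    rw [mem_ball_iff_norm] at hx
    exact (norm_snd_le (x - x₀)).trans_lt hx
  have hpt : ∀ pb : ℝ, p₀ ≤ pb → pb ≤ 0 → ∃ y₀ ∈ Obar p₀,
      (∀ x ∈ Metric.ball x₀ ρ, x.2 = pb → y₀.2 = pb) ∧
      (∀ x ∈ Metric.ball x₀ ρ, ‖x - y₀‖ ≤ 2 * ρ) := by
    intro pb h1 h2
    by_cases h : |x₀.2 - pb| < ρ
    · refine ⟨(x₀.1, pb), mem_Obar.2 ⟨h1, h2⟩, fun _ _ _ => rfl, fun x hx => ?_⟩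
      rw [mem_ball_iff_norm] at hx
      have h3 : ‖x₀ - (x₀.1, pb)‖ ≤ ρ := by
        rw [Prod.norm_def]
        simp only [Prod.fst_sub, Prod.snd_sub, sub_self, norm_zero]
        exact max_le hρ.le h.le
      linarith [norm_sub_le_norm_sub_add_norm_sub x x₀ (x₀.1, pb)]
    · refine ⟨x₀, hx₀, fun x hx hxp => absurd ?_ h, fun x hx => ?_⟩
      · rw [← hxp, abs_sub_comm]; exact hball x hx
      · rw [mem_ball_iff_norm] at hx; linarith
  rw [mem_Obar] at hx₀
  rcases le_or_gt (p₀ / 2) x₀.2 with h | h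
  · obtain ⟨y₀, hy₀, h1, h2⟩ := hpt 0 (by linarith) le_rfl
    refine ⟨1, 0, y₀, hy₀, by simp, Or.inl ⟨rfl, rfl⟩, ?_, ?_, h1, h2⟩
    · intro x hx
      have := abs_lt.1 (hball x hx)
      rw [mem_Obar]
      constructor
      · intro h; constructor <;> linarith
      · intro h; linarith [h.2]
    · intro x hx hs
      have := abs_lt.1 (hball x hx)
      constructor <;> linarith
  · obtain ⟨y₀, hy₀, h1, h2⟩ := hpt p₀ le_rfl (by linarith)
    refine ⟨-1, p₀, y₀, hy₀, by simp, Or.inr ⟨rfl, rfl⟩, ?_, ?_, h1, h2⟩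
    · intro x hx
      have := abs_lt.1 (hball x hx)
      rw [mem_Obar]
      constructor
      · intro h; constructor <;> linarith
      · intro h; linarith [h.1]
    · intro x hx hs
      have := abs_lt.1 (hball x hx)
      constructor <;> linarith

theorem HasPartials.fst_eq_zero {p₀ pb : ℝ} {w wq wp : ℝ × ℝ → ℝ} (h : HasPartials p₀ w wq wp)
    (h0 : ∀ q, w (q, pb) = 0) (h1 : p₀ ≤ pb) (h2 : pb ≤ 0) (q : ℝ) : wq (q, pb) = 0 := by
  have := h.fst (q, pb) (mem_Obar.2 ⟨h1, h2⟩)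
  simp only [h0] at this
  exact this.unique (hasDerivAt_const q 0)

set_option maxHeartbeats 1000000 in
theorem EllipticSystem.exists_affine_approx {α lam Lam : ℝ} (hα : 0 < α) (hα1 : α < 1)
    (hlam : 0 < lam) (hLam : 0 < Lam) :
    ∃ C > 0, ∃ c > 0, ∀ (p₀ F N G : ℝ) (a b d f₁ f₂ w wq wp V Vq Vp : ℝ × ℝ → ℝ),
      EllipticSystem p₀ α lam Lam F a b d f₁ f₂ w wq wp V Vq Vp → 0 ≤ N → 0 ≤ G → 0 ≤ F →
      p₀ < 0 →
      HolderC p₀ α wq N → HolderC p₀ α wp N →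
      (∀ x ∈ Obar p₀, |wq x| ≤ G) → (∀ x ∈ Obar p₀, |wp x| ≤ G) →
      ∀ x₀ ∈ Obar p₀, ∀ ρ, 0 < ρ → ρ ≤ -p₀ / 2 → ∃ m₀ m₁ m₂ : ℝ, ∀ x ∈ Obar p₀,
        ‖x - x₀‖ ≤ c * ρ →
        |w x - m₀ - lin m₁ m₂ (x - x₀)| ≤
          C * (N * (‖x - x₀‖ / ρ) ^ 2 + (G + F)) * (ρ * ρ ^ α) := by
  obtain ⟨C₀, hC₀, c₀, hc₀, H⟩ := exists_affine_approx_frozen hlam hLam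
  refine ⟨C₀ * (10 * (2 * Lam + 1)), by positivity, min c₀ (1 / 2), by positivity, ?_⟩
  intro p₀ F N G a b d f₁ f₂ w wq wp V Vq Vp hE hN hG hF hp₀ hq hp hqG hpG x₀ hx₀ ρ hρ hρ'
  obtain ⟨σ, pb, y₀, hy₀, hσ, hcase, hiff, hint, hy₀b, hy₀d⟩ := exists_boundary_point hx₀ hρ hρ'
  set M : ℝ := 2 * Lam * G + F with hM
  have hM0 : 0 ≤ M := by positivity
  set N' : ℝ := (2 * Lam + 1) * N + M with hN'
  have hN'0 : 0 ≤ N' := by positivity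
  have hNN' : N ≤ N' := by rw [hN']; nlinarith
  have hVp : HolderC p₀ α Vp N' :=
    ((((HolderC.mul hLam.le hLam.le hE.a_le hE.a_holder hqG hq).add
      (HolderC.mul hLam.le hLam.le hE.b_le hE.b_holder hpG hp)).add hE.f₁_holder).congr
      hE.Vp_eq).mono (by rw [hN', hM]; linarith)
  have hVq : HolderC p₀ α Vq N' :=
    ((((HolderC.mul hLam.le hLam.le hE.b_le hE.b_holder hqG hq).add
      (HolderC.mul hLam.le hLam.le hE.d_le hE.d_holder hpG hp)).add hE.f₂_holder).neg.congr
      hE.Vq_eq).mono (by rw [hN', hM]; linarith)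
  have h2α : (2:ℝ) ^ α ≤ 2 := by
    calc (2:ℝ) ^ α ≤ 2 ^ (1:ℝ) := Real.rpow_le_rpow_of_exponent_le (by norm_num) hα1.le
      _ = 2 := Real.rpow_one 2
  have hdα : ∀ x ∈ Metric.ball x₀ ρ, ‖x - y₀‖ ^ α ≤ 2 * ρ ^ α := fun x hx => by
    calc ‖x - y₀‖ ^ α ≤ (2 * ρ) ^ α := by gcongr; exact hy₀d x hx
      _ = 2 ^ α * ρ ^ α := Real.mul_rpow (by norm_num) hρ.le
      _ ≤ _ := by gcongr
  have hT : ∀ x ∈ Metric.ball x₀ ρ, 2 * N' * (‖x - y₀‖ * ‖x - y₀‖ ^ α) ≤ 8 * N' * (ρ * ρ ^ α) :=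
    fun x hx => by
      calc 2 * N' * (‖x - y₀‖ * ‖x - y₀‖ ^ α) ≤ 2 * N' * ((2 * ρ) * (2 * ρ ^ α)) := by
            gcongr
            · exact hy₀d x hx
            · exact hdα x hx
        _ = _ := by ring
  have hwN : HolderC p₀ α wq N' := hq.mono hNN'
  have hpN : HolderC p₀ α wp N' := hp.mono hNN'
  have hWc : ∀ (u : ℝ × ℝ → ℝ) (k : ℝ) (L : ℝ × ℝ →L[ℝ] ℝ), ContinuousOn u (Obar p₀) →
      ContinuousOn (fun x => u x - k - L (x - y₀)) (Metric.ball x₀ ρ ∩ {p | σ * (p.2 - pb) ≤ 0}) :=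
    fun u k L hu => by
      have h1 : ContinuousOn u (Metric.ball x₀ ρ ∩ {p | σ * (p.2 - pb) ≤ 0}) :=
        hu.mono fun x hx => (hiff x hx.1).1 hx.2
      exact (h1.sub continuousOn_const).sub (Continuous.continuousOn (by fun_prop))
  have hWd : ∀ (u uq up : ℝ × ℝ → ℝ), HasPartials p₀ u uq up → HolderC p₀ α uq N' →
      HolderC p₀ α up N' → ∀ p ∈ Metric.ball x₀ ρ, σ * (p.2 - pb) < 0 →
      HasFDerivAt (fun x => u x - u y₀ - lin (uq y₀) (up y₀) (x - y₀))
        (lin (uq p - uq y₀) (up p - up y₀)) p := by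
    intro u uq up hu h1 h2 p hpb hps
    obtain ⟨i1, i2⟩ := hint p hpb hps
    have h3 := hu.hasFDerivAt hα hN'0 h1 h2 i1 i2
    have h4 : HasFDerivAt (fun x => lin (uq y₀) (up y₀) (x - y₀)) (lin (uq y₀) (up y₀)) p := by
      have h := (lin (uq y₀) (up y₀)).hasFDerivAt.comp p ((hasFDerivAt_id p).sub_const y₀)
      exact h
    refine ((h3.sub_const (u y₀)).sub h4).congr_fderiv ?_
    ext <;> simp
  have hcont : ∀ (u uq up : ℝ × ℝ → ℝ), HasPartials p₀ u uq up → HolderC p₀ α uq N' →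
      HolderC p₀ α up N' → ContinuousOn u (Obar p₀) := fun u uq up hu h1 h2 y hy =>
    (hu.hasFDerivWithinAt hα hN'0 h1 h2 hy).continuousWithinAt
  have hx₀' : σ * (x₀.2 - pb) ≤ 0 := (hiff x₀ (Metric.mem_ball_self hρ)).2 hx₀
  have hbdd : ∀ (u : ℝ × ℝ → ℝ), HolderC p₀ α u N' → ∀ p ∈ Metric.ball x₀ ρ,
      σ * (p.2 - pb) < 0 → |u p - u y₀| ≤ N' * (2 * ρ ^ α) := fun u hu p hpb hps => by
    refine (hu p ((hiff p hpb).1 hps.le) y₀ hy₀).trans ?_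
    gcongr
    exact hdα p hpb
  have herr : ∀ (k₁ k₂ f : ℝ × ℝ → ℝ), HolderC p₀ α k₁ Lam → HolderC p₀ α k₂ Lam →
      HolderC p₀ α f F → ∀ p ∈ Metric.ball x₀ ρ, σ * (p.2 - pb) < 0 →
      |(k₁ p - k₁ y₀) * wq p + (k₂ p - k₂ y₀) * wp p + (f p - f y₀)| ≤ 2 * M * ρ ^ α := by
    intro k₁ k₂ f h1 h2 h3 p hpb hps
    have hpO := (hiff p hpb).1 hps.le
    have hd := hdα p hpb
    calc _ ≤ |k₁ p - k₁ y₀| * |wq p| + |k₂ p - k₂ y₀| * |wp p| + |f p - f y₀| := by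
          rw [← abs_mul, ← abs_mul]
          exact (abs_add_le _ _).trans (by gcongr; exact abs_add_le _ _)
      _ ≤ (Lam * (2 * ρ ^ α)) * G + (Lam * (2 * ρ ^ α)) * G + F * (2 * ρ ^ α) := by
          gcongr
          · exact (h1 p hpO y₀ hy₀).trans (by gcongr)
          · exact hqG p hpO
          · exact (h2 p hpO y₀ hy₀).trans (by gcongr)
          · exact hpG p hpO
          · exact (h3 p hpO y₀ hy₀).trans (by gcongr)
      _ = _ := by rw [hM]; ring
  obtain ⟨m₀, m₁, m₂, hm⟩ := H (a y₀) (b y₀) (d y₀) σ pb x₀ ρ (8 * N' * (ρ * ρ ^ α))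
    (2 * M * ρ ^ α) (N' * (2 * ρ ^ α))
    (fun x => w x - w y₀ - lin (wq y₀) (wp y₀) (x - y₀)) (fun x => wq x - wq y₀)
    (fun x => wp x - wp y₀) (fun x => V x - V y₀ - lin (Vq y₀) (Vp y₀) (x - y₀))
    (fun x => Vq x - Vq y₀) (fun x => Vp x - Vp y₀)
    (hE.a_le y₀ hy₀) (hE.b_le y₀ hy₀) ((le_abs_self _).trans (hE.d_le y₀ hy₀))
    (hE.le_d y₀ hy₀) (hE.le_det y₀ hy₀) hσ hρ (by positivity) hx₀'
    (hWc w _ _ (hcont w wq wp hE.w_partials hwN hpN))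
    (hWc V _ _ (hcont V Vq Vp hE.V_partials hVq hVp))
    (hWd w wq wp hE.w_partials hwN hpN) (hWd V Vq Vp hE.V_partials hVq hVp)
    (fun p hpb hps => ⟨hbdd wq hwN p hpb hps, hbdd wp hpN p hpb hps, hbdd Vq hVq p hpb hps,
      hbdd Vp hVp p hpb hps⟩)
    (fun p hpb hps => by
      have hpO := (hiff p hpb).1 hps.le
      constructor
      · have := herr a b f₁ hE.a_holder hE.b_holder hE.f₁_holder p hpb hps
        rw [hE.Vp_eq p hpO, hE.Vp_eq y₀ hy₀]
        convert this using 2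
        ring
      · have := herr b d f₂ hE.b_holder hE.d_holder hE.f₂_holder p hpb hps
        rw [hE.Vq_eq p hpO, hE.Vq_eq y₀ hy₀, ← abs_neg]
        convert this using 2
        ring)
    (fun p hpb hps => by
      have hpO := (hiff p hpb).1 hps
      exact ⟨(hE.w_partials.taylor hα.le hN'0 hwN hpN hpO hy₀).trans (hT p hpb),
        (hE.V_partials.taylor hα.le hN'0 hVq hVp hpO hy₀).trans (hT p hpb)⟩)
    (by
      rcases hcase with ⟨-, h⟩ | ⟨-, h⟩
      · right
        intro p hpb hpp
        have h1 := hy₀b p hpb hpp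
        have e1 : y₀ = (y₀.1, 0) := Prod.ext rfl (h1.trans h)
        have e2 : p = (p.1, 0) := Prod.ext rfl (hpp.trans h)
        have h2 : Vq y₀ = 0 := by
          rw [e1]; exact hE.V_partials.fst_eq_zero hE.top hp₀.le le_rfl y₀.1
        have h3 : V p = 0 := by rw [e2]; exact hE.top p.1
        have h4 : V y₀ = 0 := by rw [e1]; exact hE.top y₀.1
        simp [h2, h3, h4, h1, hpp]
      · left
        intro p hpb hpp
        have h1 := hy₀b p hpb hpp
        have h2 : wq y₀ = 0 := by
          have := hE.w_partials.fst_eq_zero hE.bottom le_rfl hp₀.le y₀.1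
          rwa [← h, ← h1] at this
        have h3 : w p = 0 := by
          have := hE.bottom p.1
          rwa [← h, ← hpp] at this
        have h4 : w y₀ = 0 := by
          have := hE.bottom y₀.1
          rwa [← h, ← h1] at this
        simp [h2, h3, h4, h1, hpp])
  refine ⟨m₀ + w y₀ + lin (wq y₀) (wp y₀) (x₀ - y₀), m₁ + wq y₀, m₂ + wp y₀, ?_⟩
  intro x hx hxc
  have hxb : x ∈ Metric.ball x₀ ρ := by
    rw [mem_ball_iff_norm]
    have : min c₀ (1 / 2) * ρ ≤ 1 / 2 * ρ := by gcongr; exact min_le_right _ _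
    linarith
  have h1 := hm x (hxc.trans (by gcongr; exact min_le_left _ _)) ((hiff x hxb).2 hx)
  have e : w x - (m₀ + w y₀ + lin (wq y₀) (wp y₀) (x₀ - y₀)) -
      lin (m₁ + wq y₀) (m₂ + wp y₀) (x - x₀) =
      w x - w y₀ - lin (wq y₀) (wp y₀) (x - y₀) - m₀ - lin m₁ m₂ (x - x₀) := by
    simp only [lin_apply, Prod.fst_sub, Prod.snd_sub]; ring
  rw [e]
  refine h1.trans ?_
  have hX : ‖x - x₀‖ / ρ ≤ 1 := by
    rw [div_le_one hρ]; rw [mem_ball_iff_norm] at hxb; exact hxb.le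
  have hX0 : 0 ≤ ‖x - x₀‖ / ρ := by positivity
  set X := ‖x - x₀‖ / ρ
  have hX2 : X ^ 2 ≤ 1 := pow_le_one₀ hX0 hX
  have hX20 : 0 ≤ X ^ 2 := by positivity
  have hr : 0 ≤ ρ * ρ ^ α := by positivity
  have hfin : 8 * N' * X ^ 2 + 2 * M ≤ 10 * (2 * Lam + 1) * (N * X ^ 2 + (G + F)) := by
    have hMle : M ≤ (2 * Lam + 1) * (G + F) := by
      rw [hM]; nlinarith [mul_nonneg hLam.le hF, hG]
    have hMX : M * X ^ 2 ≤ M := mul_le_of_le_one_right hM0 hX2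
    have : 0 ≤ (2 * Lam + 1) * (N * X ^ 2) := by positivity
    rw [hN']
    nlinarith
  calc C₀ * (8 * N' * (ρ * ρ ^ α) * X ^ 2 + 2 * M * ρ ^ α * ρ)
      = C₀ * ((8 * N' * X ^ 2 + 2 * M) * (ρ * ρ ^ α)) := by ring
    _ ≤ C₀ * ((10 * (2 * Lam + 1) * (N * X ^ 2 + (G + F))) * (ρ * ρ ^ α)) := by gcongr
    _ = _ := by ring

theorem exists_rpow_le {β K m η : ℝ} (hβ : 0 < β) (hK : 0 < K) (hm : 0 < m) (hη : 0 < η) :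
    ∃ t > 0, t ≤ m ∧ K * t ^ β ≤ η := by
  refine ⟨min m ((η / K) ^ β⁻¹), by positivity, min_le_left _ _, ?_⟩
  have h : (min m ((η / K) ^ β⁻¹)) ^ β ≤ η / K := by
    calc (min m ((η / K) ^ β⁻¹)) ^ β ≤ ((η / K) ^ β⁻¹) ^ β := by
          gcongr; exact min_le_right _ _
      _ = η / K := Real.rpow_inv_rpow (by positivity) hβ.ne'
  calc K * _ ≤ K * (η / K) := by gcongr
    _ = η := by field_simp

theorem HasPartials.interpolation {p₀ α N W s : ℝ} {w wq wp : ℝ × ℝ → ℝ} (hα : 0 ≤ α)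
    (hN : 0 ≤ N) (hw : HasPartials p₀ w wq wp) (hq : HolderC p₀ α wq N) (hp : HolderC p₀ α wp N)
    (hW : ∀ x ∈ Obar p₀, |w x| ≤ W) (hs : 0 < s) (hs' : s ≤ -p₀ / 2) {x : ℝ × ℝ}
    (hx : x ∈ Obar p₀) :
    |wq x| ≤ 2 / s * W + 4 * s ^ α * N ∧ |wp x| ≤ 2 / s * W + 4 * s ^ α * N := by
  have h := abs_slope_le (A := w x) (m₁ := wq x) (m₂ := wp x) (K := W + 2 * N * (s * s ^ α)) hx hs
    hs' fun y hy hys => by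
      have h1 := hw.taylor hα hN hq hp hy hx
      have h2 : 2 * N * (‖y - x‖ * ‖y - x‖ ^ α) ≤ 2 * N * (s * s ^ α) := by gcongr
      have e : w x + lin (wq x) (wp x) (y - x) =
        w y - (w y - w x - lin (wq x) (wp x) (y - x)) := by ring
      rw [e]
      exact (abs_sub _ _).trans (add_le_add (hW y hy) (h1.trans h2))
  have e : 2 * (W + 2 * N * (s * s ^ α)) / s = 2 / s * W + 4 * s ^ α * N := by
    field_simp; ring
  rwa [e] at h

set_option maxHeartbeats 1000000 in
/-- The global Schauder estimate for the elliptic system in the strip. -/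
theorem EllipticSystem.schauder {p₀ α lam Lam : ℝ} (hα : 0 < α) (hα1 : α < 1)
    (hlam : 0 < lam) (hLam : 0 < Lam) (hp₀ : p₀ < 0) :
    ∃ C > 0, ∀ (F W N₀ : ℝ) (a b d f₁ f₂ w wq wp V Vq Vp : ℝ × ℝ → ℝ),
      EllipticSystem p₀ α lam Lam F a b d f₁ f₂ w wq wp V Vq Vp → 0 ≤ F → 0 ≤ W → 0 ≤ N₀ →
      HolderC p₀ α wq N₀ → HolderC p₀ α wp N₀ → (∀ x ∈ Obar p₀, |w x| ≤ W) →
      (∀ x ∈ Obar p₀, |wq x| ≤ C * (W + F) ∧ |wp x| ≤ C * (W + F)) ∧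
      HolderC p₀ α wq (C * (W + F)) ∧ HolderC p₀ α wp (C * (W + F)) := by
  obtain ⟨C₁, hC₁, c, hc, H₁⟩ := EllipticSystem.exists_affine_approx hα hα1 hlam hLam
  obtain ⟨C₂, hC₂, H₂⟩ := holder_of_affine_approx hα
  obtain ⟨θ, hθ, hθm, hθs⟩ := exists_rpow_le (β := 1 - α) (K := C₂ * C₁) (m := min c 1)
    (η := 1 / 4) (by linarith) (by positivity) (by positivity) (by norm_num)
  have hθc : θ ≤ c := hθm.trans (min_le_left _ _)
  have hθ1 : θ ≤ 1 := hθm.trans (min_le_right _ _)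
  set R : ℝ := -p₀ / 2 with hR
  have hR0 : 0 < R := by rw [hR]; linarith
  set κ : ℝ := θ⁻¹ * (θ ^ α)⁻¹ with hκ
  have hκ0 : 0 < κ := by positivity
  have hθκ : θ ^ 2 * κ = θ ^ (1 - α) := by
    rw [hκ, Real.rpow_sub hθ, Real.rpow_one]
    field_simp
  set D : ℝ := C₂ * C₁ * κ + 2 * (2 / (θ * R)) ^ α with hD
  have hD0 : 0 < D := by positivity
  obtain ⟨s, hs, hsm, hss⟩ := exists_rpow_le (β := α) (K := D * 4) (m := R)
    (η := 1 / 4) hα (by positivity) hR0 (by norm_num)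
  set B : ℝ := D * (2 / s + 1) with hB
  have hB0 : 0 < B := by positivity
  refine ⟨2 / s + 4 * s ^ α * (2 * B) + 2 * B, by positivity, ?_⟩
  intro F W N₀ a b d f₁ f₂ w wq wp V Vq Vp hE hF hW hN₀ hq₀ hp₀' hw
  set X : {z : (ℝ × ℝ) × (ℝ × ℝ) // z.1 ∈ Obar p₀ ∧ z.2 ∈ Obar p₀} → ℝ :=
    fun z => max |wq z.1.1 - wq z.1.2| |wp z.1.1 - wp z.1.2| with hX
  have hXN : ∀ N, (HolderC p₀ α wq N ∧ HolderC p₀ α wp N) ↔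
      ∀ z, X z ≤ N * ‖z.1.1 - z.1.2‖ ^ α := by
    intro N
    constructor
    · rintro ⟨h1, h2⟩ ⟨⟨x, y⟩, hx, hy⟩
      exact max_le (h1 x hx y hy) (h2 x hx y hy)
    · intro h
      exact ⟨fun x hx y hy => (le_max_left _ _).trans (h ⟨(x, y), hx, hy⟩),
        fun x hx y hy => (le_max_right _ _).trans (h ⟨(x, y), hx, hy⟩)⟩
  have hfinal := le_of_contraction (N₀ := N₀) (θ := 1 / 2) (B := B * (W + F)) (X := X)
    (Y := fun z => ‖z.1.1 - z.1.2‖ ^ α) hN₀ (by norm_num) (by norm_num) (by positivity)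
    ((hXN N₀).1 ⟨hq₀, hp₀'⟩) (by
      intro N hN h
      obtain ⟨hq, hp⟩ := (hXN N).2 h
      have hint := fun x hx => hE.w_partials.interpolation hα.le hN hq hp hw hs hsm (x := x) hx
      set G : ℝ := 2 / s * W + 4 * s ^ α * N with hG
      have hG0 : 0 ≤ G := by positivity
      have hloc := H₂ p₀ w wq wp N (C₁ * (N * θ ^ 2 + (G + F)) * κ) (θ * R) hN (by positivity)
        (by positivity) (mul_le_of_le_one_left hR0.le hθ1) hE.w_partials hq hp (by
          intro x hx r hr hrr
          have hrθ : 0 < r / θ := by positivity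
          obtain ⟨m₀, m₁, m₂, hm⟩ := H₁ p₀ F N G a b d f₁ f₂ w wq wp V Vq Vp hE hN hG0 hF hp₀
            hq hp (fun x hx => (hint x hx).1) (fun x hx => (hint x hx).2) x hx (r / θ) hrθ
            (by rw [div_le_iff₀ hθ, mul_comm]; exact hrr)
          refine ⟨m₀, m₁, m₂, fun y hy hyr => ?_⟩
          refine (hm y hy (hyr.trans ?_)).trans ?_
          · calc r = θ * (r / θ) := by field_simp
              _ ≤ c * (r / θ) := by gcongr
          · have h1 : ‖y - x‖ / (r / θ) ≤ θ := by
              rw [div_le_iff₀ hrθ]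
              calc ‖y - x‖ ≤ r := hyr
                _ = θ * (r / θ) := by field_simp
            calc C₁ * (N * (‖y - x‖ / (r / θ)) ^ 2 + (G + F)) * (r / θ * (r / θ) ^ α)
                ≤ C₁ * (N * θ ^ 2 + (G + F)) * (r / θ * (r / θ) ^ α) := by gcongr
              _ = _ := by
                rw [Real.div_rpow hr.le hθ.le, hκ]; field_simp)
      have hnew : C₂ * (C₁ * (N * θ ^ 2 + (G + F)) * κ) + 2 * (2 / (θ * R)) ^ α * (G + F) ≤
          1 / 2 * N + B * (W + F) := by
        calc _ = C₂ * C₁ * (θ ^ 2 * κ) * N + D * (G + F) := by rw [hD]; ring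
          _ = C₂ * C₁ * θ ^ (1 - α) * N + D * 4 * s ^ α * N + D * (2 / s * W + F) := by
            rw [hθκ, hG]; ring
          _ ≤ 1 / 4 * N + 1 / 4 * N + D * ((2 / s + 1) * (W + F)) := by
            gcongr
            have : 0 ≤ 2 / s * F := by positivity
            linarith
          _ = _ := by rw [hB]; ring
      rw [← hXN]
      have hboth : ∀ u : ℝ × ℝ → ℝ, (∀ x ∈ Obar p₀, |u x| ≤ G) →
          (∀ x ∈ Obar p₀, ∀ y ∈ Obar p₀, ‖x - y‖ ≤ θ * R / 2 → |u x - u y| ≤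
            C₂ * (C₁ * (N * θ ^ 2 + (G + F)) * κ) * ‖x - y‖ ^ α) →
          HolderC p₀ α u (1 / 2 * N + B * (W + F)) := by
        intro u hu hu' x hx y hy
        refine le_trans ?_ (mul_le_mul_of_nonneg_right hnew (by positivity))
        rw [add_mul]
        by_cases hxy : ‖x - y‖ ≤ θ * R / 2
        · exact (hu' x hx y hy hxy).trans (le_add_of_nonneg_right (by positivity))
        · refine le_trans ?_ (le_add_of_nonneg_left (by positivity))
          have h1 : 1 ≤ (2 / (θ * R) * ‖x - y‖) ^ α := by
            refine Real.one_le_rpow ?_ hα.le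
            rw [div_mul_eq_mul_div, le_div_iff₀ (by positivity)]
            linarith
          rw [Real.mul_rpow (by positivity) (norm_nonneg _)] at h1
          calc |u x - u y| ≤ |u x| + |u y| := abs_sub _ _
            _ ≤ 2 * (G + F) * 1 := by linarith [hu x hx, hu y hy]
            _ ≤ 2 * (G + F) * ((2 / (θ * R)) ^ α * ‖x - y‖ ^ α) := by gcongr
            _ = _ := by ring
      exact ⟨hboth wq (fun x hx => (hint x hx).1) fun x hx y hy hxy => (hloc x hx y hy hxy).1,
        hboth wp (fun x hx => (hint x hx).2) fun x hx y hy hxy => (hloc x hx y hy hxy).2⟩)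
  rw [← hXN, show B * (W + F) / (1 - 1 / 2) = 2 * B * (W + F) by ring] at hfinal
  obtain ⟨hq, hp⟩ := hfinal
  have hsum : 2 / s * W + 4 * s ^ α * (2 * B * (W + F)) ≤
      (2 / s + 4 * s ^ α * (2 * B) + 2 * B) * (W + F) := by
    have h1 : 0 ≤ 2 / s * F := by positivity
    have h2 : 0 ≤ 2 * B * (W + F) := by positivity
    linarith
  have hmono : 2 * B * (W + F) ≤ (2 / s + 4 * s ^ α * (2 * B) + 2 * B) * (W + F) := by
    have : 0 ≤ (2 / s + 4 * s ^ α * (2 * B)) * (W + F) := by positivity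
    linarith
  refine ⟨fun x hx => ?_, hq.mono hmono, hp.mono hmono⟩
  have := hE.w_partials.interpolation hα.le (by positivity) hq hp hw hs hsm hx
  exact ⟨this.1.trans hsum, this.2.trans hsum⟩

theorem eq_of_integral_mul_deriv_eq_zero {l r : ℝ} {f : ℝ → ℝ} (hf : Continuous f)
    (h : ∀ χ : ℝ → ℝ, ContDiff ℝ 1 χ → HasCompactSupport χ → tsupport χ ⊆ Ioo l r →
      ∫ x, f x * deriv χ x = 0) (hlr : l < r) :
    ∃ c, ∀ x ∈ Icc l r, f x = c := by
  let β : ContDiffBump ((l + r) / 2) := ⟨(r - l) / 8, (r - l) / 4, by linarith, by linarith⟩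
  have hβc : Continuous (β.normed volume) := (β.contDiff_normed (n := 0)).continuous
  have hβs : tsupport (β.normed volume) ⊆ Ioo l r := by
    rw [β.tsupport_normed_eq, Real.closedBall_eq_Icc]
    exact Icc_subset_Ioo (by change l < (l + r) / 2 - (r - l) / 4; linarith)
      (by change (l + r) / 2 + (r - l) / 4 < r; linarith)
  have hβk : HasCompactSupport (β.normed volume) := β.hasCompactSupport_normed
  set c := ∫ x, f x * β.normed volume x with hc
  have hae : ∀ᵐ x ∂(volume : Measure ℝ), x ∈ Ioo l r → f x - c = 0 := by
    refine IsOpen.ae_eq_zero_of_integral_contDiff_smul_eq_zero isOpen_Ioo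
      ((hf.sub continuous_const).locallyIntegrable.locallyIntegrableOn _) fun k hk hkc hks => ?_
    have hkcont : Continuous k := hk.continuous
    have hki : Integrable k := hkcont.integrable_of_hasCompactSupport hkc
    have hfk : Integrable (fun x => f x * k x) :=
      (hf.mul hkcont).integrable_of_hasCompactSupport hkc.mul_left
    have hβi : Integrable (β.normed volume) := hβc.integrable_of_hasCompactSupport hβk
    have hfβ : Integrable (fun x => f x * β.normed volume x) :=
      (hf.mul hβc).integrable_of_hasCompactSupport hβk.mul_left
    set m := ∫ x, k x with hm
    set φ : ℝ → ℝ := fun x => k x - m * β.normed volume x with hφ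
    have hφc : Continuous φ := by fun_prop
    have hφi : Integrable φ := hki.sub (hβi.const_mul m)
    have hφ0 : ∫ x, φ x = 0 := by
      rw [hφ, integral_sub hki (hβi.const_mul m), integral_const_mul, β.integral_normed, ← hm]
      ring
    obtain ⟨l', hl', r', hr', hK⟩ : ∃ l' > l, ∃ r' < r, ∀ x, x ∉ Icc l' r' → φ x = 0 := by
      have hcpt : IsCompact (tsupport k ∪ tsupport (β.normed volume)) := hkc.isCompact.union hβk
      have hne : (tsupport k ∪ tsupport (β.normed volume)).Nonempty := by
        rw [β.tsupport_normed_eq]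
        exact ⟨(l + r) / 2, Or.inr (Metric.mem_closedBall_self β.rOut_pos.le)⟩
      have hsub := union_subset hks hβs
      have i1 := hcpt.sInf_mem hne
      have i2 := hcpt.sSup_mem hne
      refine ⟨_, (hsub i1).1, _, (hsub i2).2, fun x hx => ?_⟩
      have hx' : x ∉ tsupport k ∪ tsupport (β.normed volume) := fun h =>
        hx ⟨csInf_le hcpt.bddBelow h, le_csSup hcpt.bddAbove h⟩
      rw [mem_union, not_or] at hx'
      simp [hφ, image_eq_zero_of_notMem_tsupport hx'.1, image_eq_zero_of_notMem_tsupport hx'.2]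
    set χ : ℝ → ℝ := fun x => ∫ t in l..x, φ t with hχ
    have hχd : ∀ x, HasDerivAt χ (φ x) x := fun x =>
      intervalIntegral.integral_hasDerivAt_right (hφc.intervalIntegrable _ _)
        hφc.stronglyMeasurable.stronglyMeasurableAtFilter hφc.continuousAt
    have hχ' : deriv χ = φ := funext fun x => (hχd x).deriv
    have hχs : Function.support χ ⊆ Icc l' r' := by
      intro x hx
      by_contra hxn
      refine hx ?_
      rw [mem_Icc, not_and_or, not_le, not_le] at hxn
      rcases hxn with hxn | hxn
      · refine intervalIntegral.integral_zero_ae (Eventually.of_forall fun t ht => hK t fun h => ?_)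
        rw [mem_uIoc] at ht
        rcases ht with ht | ht <;> linarith [h.1, ht.1, ht.2]
      · rw [hχ, ← hφ0]
        by_cases hrl : l' ≤ r'
        · refine intervalIntegral.integral_eq_integral_of_support_subset fun t ht => ?_
          by_contra htn
          refine ht (hK t fun h => htn ⟨by linarith [h.1], by linarith [h.2]⟩)
        · have : φ = 0 := funext fun t => hK t fun h => hrl (h.1.trans h.2)
          simp [this]
    have hts : tsupport χ ⊆ Icc l' r' := closure_minimal hχs isClosed_Icc
    have key := h χ (contDiff_one_iff_deriv.2 ⟨fun x => (hχd x).differentiableAt, hχ' ▸ hφc⟩)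
      (HasCompactSupport.of_support_subset_isCompact isCompact_Icc hχs)
      (hts.trans (Icc_subset_Ioo hl' hr'))
    rw [hχ'] at key
    have e1 : ∫ x, f x * φ x = (∫ x, f x * k x) - m * c := by
      rw [hc, ← integral_const_mul, ← integral_sub hfk (hfβ.const_mul m)]
      refine integral_congr_ae (Eventually.of_forall fun x => ?_)
      simp only [hφ]; ring
    have e2 : ∫ x, k x • (f x - c) = (∫ x, f x * k x) - m * c := by
      rw [hm, ← integral_mul_const, ← integral_sub hfk (hki.mul_const c)]
      refine integral_congr_ae (Eventually.of_forall fun x => ?_)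
      simp only [smul_eq_mul]; ring
    rw [e2, ← e1, key]
  have hopen : EqOn f (fun _ => c) (Ioo l r) := by
    refine Measure.eqOn_open_of_ae_eq (μ := (volume : Measure ℝ)) ?_ isOpen_Ioo hf.continuousOn
      continuousOn_const
    rw [EventuallyEq, ae_restrict_iff' measurableSet_Ioo]
    filter_upwards [hae] with x hx hxI
    linarith [hx hxI]
  refine ⟨c, fun x hx => ?_⟩
  have := hopen.closure hf continuous_const
  rw [closure_Ioo hlr.ne] at this
  exact this hx

/-- The lemma of du Bois-Reymond. -/
theorem sub_eq_integral_of_integral_test_eq_zero {l r : ℝ} {f k : ℝ → ℝ} (hf : Continuous f)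
    (hk : Continuous k) (hlr : l < r)
    (h : ∀ χ : ℝ → ℝ, ContDiff ℝ 1 χ → HasCompactSupport χ → tsupport χ ⊆ Ioo l r →
      ∫ x, (f x * deriv χ x + k x * χ x) = 0) :
    ∀ x ∈ Icc l r, ∀ y ∈ Icc l r, f y - f x = ∫ t in x..y, k t := by
  set K : ℝ → ℝ := fun x => ∫ t in l..x, k t with hK
  have hKd : ∀ x, HasDerivAt K (k x) x := fun x =>
    intervalIntegral.integral_hasDerivAt_right (hk.intervalIntegrable _ _)
      hk.stronglyMeasurable.stronglyMeasurableAtFilter hk.continuousAt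
  have hKc : Continuous K := continuous_iff_continuousAt.2 fun x => (hKd x).continuousAt
  obtain ⟨c, hc⟩ := eq_of_integral_mul_deriv_eq_zero (l := l) (r := r) (hf.sub hKc) (by
    intro χ h1 h2 h3
    have hχ' : Continuous (deriv χ) := h1.continuous_deriv le_rfl
    have hχd : ∀ x, HasDerivAt χ (deriv χ x) x := fun x =>
      (h1.differentiable one_ne_zero x).hasDerivAt
    have i1 : Integrable (fun x => K x * deriv χ x) :=
      (hKc.mul hχ').integrable_of_hasCompactSupport h2.deriv.mul_left
    have i2 : Integrable (fun x => k x * χ x) :=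
      (hk.mul h1.continuous).integrable_of_hasCompactSupport h2.mul_left
    have i3 : Integrable (K * χ) :=
      (hKc.mul h1.continuous).integrable_of_hasCompactSupport h2.mul_left
    have i4 : Integrable (fun x => f x * deriv χ x) :=
      (hf.mul hχ').integrable_of_hasCompactSupport h2.deriv.mul_left
    have hparts := integral_mul_deriv_eq_deriv_mul_of_integrable (fun x _ => hKd x)
      (fun x _ => hχd x) i1 i2 i3
    have h4 := h χ h1 h2 h3
    rw [integral_add i4 i2] at h4
    have e : ∫ x, (f x - K x) * deriv χ x = (∫ x, f x * deriv χ x) - ∫ x, K x * deriv χ x := by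
      rw [← integral_sub i4 i1]
      refine integral_congr_ae (Eventually.of_forall fun x => ?_)
      ring
    rw [Pi.sub_def, e, hparts]
    linarith) hlr
  intro x hx y hy
  have h1 := hc x hx
  have h2 := hc y hy
  have h3 := intervalIntegral.integral_interval_sub_left (μ := volume) (hk.intervalIntegrable l y)
    (hk.intervalIntegrable l x)
  rw [← h3]
  have h4 : f x - K x = c := h1
  have h5 : f y - K y = c := h2
  change f y - f x = K y - K x
  linarith

theorem integral_tensor_test_eq_zero {p₀ : ℝ} {A B : ℝ × ℝ → ℝ} (hA : Continuous A)
    (hB : Continuous B)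
    (hw : ∀ ψ, IsTest p₀ ψ → ∫ x in Oset p₀, (B x * pd_q ψ x - A x * pd_p p₀ ψ x) = 0)
    {χ η : ℝ → ℝ} (hχ : ContDiff ℝ 1 χ) (hχs : HasCompactSupport χ) (hη : ContDiff ℝ 1 η)
    (hηs : HasCompactSupport η) (hηt : tsupport η ⊆ Ioo p₀ 0) :
    ∫ q, ((∫ p in p₀..0, B (q, p) * η p) * deriv χ q +
      (-∫ p in p₀..0, A (q, p) * deriv η p) * χ q) = 0 := by
  have hχ' : Continuous (deriv χ) := hχ.continuous_deriv le_rfl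
  have hη' : Continuous (deriv η) := hη.continuous_deriv le_rfl
  have hχc := hχ.continuous
  have hηc := hη.continuous
  have hη0 : ∀ p, p ∉ tsupport η → η p = 0 ∧ deriv η p = 0 := fun p hp =>
    ⟨image_eq_zero_of_notMem_tsupport hp,
      image_eq_zero_of_notMem_tsupport fun h => hp (tsupport_deriv_subset h)⟩
  have hχ0 : ∀ q, q ∉ tsupport χ → χ q = 0 ∧ deriv χ q = 0 := fun p hp =>
    ⟨image_eq_zero_of_notMem_tsupport hp,
      image_eq_zero_of_notMem_tsupport fun h => hp (tsupport_deriv_subset h)⟩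
  set F : ℝ × ℝ → ℝ := fun x => B x * (deriv χ x.1 * η x.2) - A x * (χ x.1 * deriv η x.2) with hF
  have hFc : Continuous F := by fun_prop
  have hFk : HasCompactSupport F := by
    refine HasCompactSupport.of_support_subset_isCompact
      (hχs.isCompact.prod hηs.isCompact) fun x hx => ?_
    by_contra hn
    rw [mem_prod, not_and_or] at hn
    refine hx ?_
    rcases hn with hn | hn
    · simp [hF, hχ0 _ hn]
    · simp [hF, hη0 _ hn]
  have htest : IsTest p₀ (fun x => χ x.1 * η x.2) := by
    refine ⟨(hχ.comp contDiff_fst).mul (hη.comp contDiff_snd), ?_, ?_⟩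
    · refine HasCompactSupport.of_support_subset_isCompact
        (hχs.isCompact.prod hηs.isCompact) fun x hx => ?_
      have := mul_ne_zero_iff.1 hx
      exact ⟨subset_tsupport _ this.1, subset_tsupport _ this.2⟩
    · refine (closure_minimal (t := univ ×ˢ tsupport η) (fun x hx => ?_)
        (isClosed_univ.prod (isClosed_tsupport η))).trans (prod_mono_right hηt)
      exact ⟨mem_univ _, subset_tsupport _ (mul_ne_zero_iff.1 hx).2⟩
  have hO : MeasurableSet (Oset p₀) := MeasurableSet.univ.prod measurableSet_Ioo
  have h1 := hw _ htest
  have e1 : ∫ x in Oset p₀, (B x * pd_q (fun x => χ x.1 * η x.2) x -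
      A x * pd_p p₀ (fun x => χ x.1 * η x.2) x) = ∫ x in Oset p₀, F x := by
    refine setIntegral_congr_fun hO fun x hx => ?_
    have hx2 : x.2 ∈ Ioo p₀ 0 := hx.2
    simp only [pd_q, pd_p, hF]
    rw [derivWithin_of_mem_nhds (Icc_mem_nhds hx2.1 hx2.2)]
    have d1 : deriv (fun q => χ q * η x.2) x.1 = deriv χ x.1 * η x.2 :=
      deriv_mul_const (hχ.differentiable one_ne_zero _) _
    have d2 : deriv (fun p => χ x.1 * η p) x.2 = χ x.1 * deriv η x.2 :=
      deriv_const_mul _ (hη.differentiable one_ne_zero _)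
    rw [d1, d2]
  have e2 : ∫ x in Oset p₀, F x = ∫ x, F x := by
    refine setIntegral_eq_integral_of_forall_compl_eq_zero fun x hx => ?_
    have : x.2 ∉ tsupport η := fun h => hx ⟨mem_univ _, hηt h⟩
    simp [hF, hη0 _ this]
  have hFi : Integrable F := hFc.integrable_of_hasCompactSupport hFk
  have e3 : ∫ x, F x = ∫ q, ∫ p, F (q, p) := by
    rw [Measure.volume_eq_prod] at hFi ⊢
    exact integral_prod F hFi
  rw [e1, e2, e3] at h1
  rw [← h1]
  refine integral_congr_ae (Eventually.of_forall fun q => ?_)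
  have e4 : ∫ p, F (q, p) = ∫ p in p₀..0, F (q, p) := by
    refine (intervalIntegral.integral_eq_integral_of_support_subset fun p hp => ?_).symm
    by_contra hn
    have : p ∉ tsupport η := fun h => hn (Ioo_subset_Ioc_self (hηt h))
    exact hp (by simp [hF, hη0 _ this])
  have c1 : Continuous fun p => B (q, p) * η p * deriv χ q := by fun_prop
  have c2 : Continuous fun p => A (q, p) * deriv η p * χ q := by fun_prop
  simp only
  rw [e4, ← intervalIntegral.integral_mul_const, neg_mul, ← intervalIntegral.integral_mul_const,
    ← sub_eq_add_neg, ← intervalIntegral.integral_sub (c1.intervalIntegrable _ _)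
    (c2.intervalIntegrable _ _)]
  congr 1
  ext p
  simp only [hF]; ring

theorem exists_potential {p₀ : ℝ} (hp₀ : p₀ < 0) {A B : ℝ × ℝ → ℝ} (hA : Continuous A)
    (hB : Continuous B)
    (hw : ∀ ψ, IsTest p₀ ψ → ∫ x in Oset p₀, (B x * pd_q ψ x - A x * pd_p p₀ ψ x) = 0) :
    ∃ V, HasPartials p₀ V A B := by
  have hcirc : ∀ q : ℝ, ∀ p ∈ Icc p₀ 0,
      (∫ t in (0:ℝ)..p, (B (q, t) - B (0, t))) = ∫ s in (0:ℝ)..q, (A (s, p) - A (s, 0)) := by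
    intro q p hp
    have hdual : ∀ η : ℝ → ℝ, ContDiff ℝ 1 η → HasCompactSupport η → tsupport η ⊆ Ioo p₀ 0 →
        ∫ t, ((∫ s in (0:ℝ)..q, A (s, t)) * deriv η t + (B (q, t) - B (0, t)) * η t) = 0 := by
      intro η h1 h2 h3
      have hη' : Continuous (deriv η) := h1.continuous_deriv le_rfl
      have hηc := h1.continuous
      have hη0 : ∀ p, p ∉ Ioc p₀ 0 → η p = 0 ∧ deriv η p = 0 := fun p hp => by
        have hp' : p ∉ tsupport η := fun h => hp (Ioo_subset_Ioc_self (h3 h))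
        exact ⟨image_eq_zero_of_notMem_tsupport hp',
          image_eq_zero_of_notMem_tsupport fun h => hp' (tsupport_deriv_subset h)⟩
      have hfc : Continuous fun q => ∫ p in p₀..0, B (q, p) * η p :=
        intervalIntegral.continuous_parametric_intervalIntegral_of_continuous'
          (f := fun q p => B (q, p) * η p) (by unfold Function.uncurry; fun_prop) _ _
      have hkc : Continuous fun q => -∫ p in p₀..0, A (q, p) * deriv η p :=
        (intervalIntegral.continuous_parametric_intervalIntegral_of_continuous'
          (f := fun q p => A (q, p) * deriv η p) (by unfold Function.uncurry; fun_prop) _ _).neg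
      have key := sub_eq_integral_of_integral_test_eq_zero (l := min 0 q - 1) (r := max 0 q + 1)
        hfc hkc (by linarith [min_le_left 0 q, le_max_left 0 q])
        (fun χ i1 i2 _ => integral_tensor_test_eq_zero hA hB hw i1 i2 h1 h2 h3)
        0 ⟨by linarith [min_le_left 0 q], by linarith [le_max_left 0 q]⟩
        q ⟨by linarith [min_le_right 0 q], by linarith [le_max_right 0 q]⟩
      have hcont : Continuous (Function.uncurry fun s t => A (s, t) * deriv η t) := by
        unfold Function.uncurry; fun_prop
      have hswap : ∫ s in (0:ℝ)..q, ∫ t in p₀..0, A (s, t) * deriv η t =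
          ∫ t in p₀..0, ∫ s in (0:ℝ)..q, A (s, t) * deriv η t := by
        refine intervalIntegral_intervalIntegral_swap ?_
        exact (hcont.continuousOn.integrableOn_compact
          (isCompact_uIcc.prod isCompact_uIcc)).mono_set
            (prod_mono uIoc_subset_uIcc uIoc_subset_uIcc)
      have hac : Continuous fun t => ∫ s in (0:ℝ)..q, A (s, t) :=
        intervalIntegral.continuous_parametric_intervalIntegral_of_continuous'
          (f := fun t s => A (s, t)) (by unfold Function.uncurry; fun_prop) _ _
      have c1 : Continuous fun t => (∫ s in (0:ℝ)..q, A (s, t)) * deriv η t := hac.mul hη'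
      have c2 : Continuous fun t => B (q, t) * η t := by fun_prop
      have c3 : Continuous fun t => B (0, t) * η t := by fun_prop
      rw [intervalIntegral.integral_neg, hswap] at key
      simp only [intervalIntegral.integral_mul_const] at key
      rw [← intervalIntegral.integral_eq_integral_of_support_subset (a := p₀) (b := 0)
        fun p hp => by
          by_contra hn
          exact hp (by simp [hη0 _ hn])]
      simp only [sub_mul]
      rw [intervalIntegral.integral_add (c1.intervalIntegrable _ _)
        ((by fun_prop : Continuous fun t => B (q, t) * η t - B (0, t) * η t).intervalIntegrable _ _),
        intervalIntegral.integral_sub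
        (c2.intervalIntegrable _ _) (c3.intervalIntegrable _ _)]
      linarith
    have hac : Continuous fun t => ∫ s in (0:ℝ)..q, A (s, t) :=
      intervalIntegral.continuous_parametric_intervalIntegral_of_continuous'
        (f := fun t s => A (s, t)) (by unfold Function.uncurry; fun_prop) _ _
    have key := sub_eq_integral_of_integral_test_eq_zero hac
      (k := fun t => B (q, t) - B (0, t)) (by fun_prop) hp₀ hdual 0 ⟨hp₀.le, le_rfl⟩ p hp
    have c1 : Continuous fun s => A (s, p) := by fun_prop
    have c2 : Continuous fun s => A (s, 0) := by fun_prop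
    rw [← key, intervalIntegral.integral_sub (c1.intervalIntegrable _ _)
      (c2.intervalIntegrable _ _)]
  have hBq : ∀ q, Continuous fun t => B (q, t) := fun q => by fun_prop
  have hAp : ∀ p, Continuous fun s => A (s, p) := fun p => by fun_prop
  have ftc : ∀ k : ℝ → ℝ, Continuous k → ∀ x, HasDerivAt (fun x => ∫ t in (0:ℝ)..x, k t) (k x) x :=
    fun k hk x => intervalIntegral.integral_hasDerivAt_right (hk.intervalIntegrable _ _)
      hk.stronglyMeasurable.stronglyMeasurableAtFilter hk.continuousAt
  refine ⟨fun x => (∫ t in (0:ℝ)..x.2, B (x.1, t)) + ∫ s in (0:ℝ)..x.1, A (s, 0), ?_, ?_⟩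
  · intro x hx
    have e : ∀ q, (∫ t in (0:ℝ)..x.2, B (q, t)) + ∫ s in (0:ℝ)..q, A (s, 0) =
        (∫ t in (0:ℝ)..x.2, B (0, t)) + ∫ s in (0:ℝ)..q, A (s, x.2) := by
      intro q
      have h := hcirc q x.2 (mem_Obar.1 hx)
      rw [intervalIntegral.integral_sub ((hBq q).intervalIntegrable _ _)
        ((hBq 0).intervalIntegrable _ _), intervalIntegral.integral_sub
        ((hAp x.2).intervalIntegrable _ _) ((hAp 0).intervalIntegrable _ _)] at h
      linarith
    simp only [e]
    exact (ftc _ (hAp x.2) x.1).const_add _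
  · intro x hx
    exact ((ftc _ (hBq x.1) x.2).add_const (∫ s in (0:ℝ)..x.1, A (s, 0))).hasDerivWithinAt

/-- `c` bounds the `C^α` norm of `f` on the closed strip. -/
def HB (p₀ α : ℝ) (f : ℝ × ℝ → ℝ) (c : ℝ) : Prop :=
  ∃ a b, 0 ≤ a ∧ 0 ≤ b ∧ a + b ≤ c ∧ (∀ x ∈ Obar p₀, |f x| ≤ a) ∧ HolderC p₀ α f b

section HB

variable {p₀ α c c' : ℝ} {f k : ℝ × ℝ → ℝ}

theorem HB.nonneg (hf : HB p₀ α f c) : 0 ≤ c := by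
  obtain ⟨a, b, ha, hb, hab, -, -⟩ := hf
  linarith

theorem HB.abs_le (hf : HB p₀ α f c) {x : ℝ × ℝ} (hx : x ∈ Obar p₀) : |f x| ≤ c := by
  obtain ⟨a, b, ha, hb, hab, h1, -⟩ := hf
  linarith [h1 x hx]

theorem HB.holderC (hf : HB p₀ α f c) : HolderC p₀ α f c := by
  obtain ⟨a, b, ha, hb, hab, -, h1⟩ := hf
  exact h1.mono (by linarith)

theorem HB.of_le (hc : 0 ≤ c) (hc' : 0 ≤ c') (h : ∀ x ∈ Obar p₀, |f x| ≤ c)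
    (h' : HolderC p₀ α f c') : HB p₀ α f (c + c') :=
  ⟨c, c', hc, hc', le_rfl, h, h'⟩

theorem HB.mono (hf : HB p₀ α f c) (h : c ≤ c') : HB p₀ α f c' := by
  obtain ⟨a, b, ha, hb, hab, h1, h2⟩ := hf
  exact ⟨a, b, ha, hb, hab.trans h, h1, h2⟩

theorem HB.congr (hf : HB p₀ α f c) (h : ∀ x ∈ Obar p₀, k x = f x) : HB p₀ α k c := by
  obtain ⟨a, b, ha, hb, hab, h1, h2⟩ := hf
  exact ⟨a, b, ha, hb, hab, fun x hx => h x hx ▸ h1 x hx, h2.congr h⟩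

theorem HB.add (hf : HB p₀ α f c) (hk : HB p₀ α k c') : HB p₀ α (f + k) (c + c') := by
  obtain ⟨a, b, ha, hb, hab, h1, h2⟩ := hf
  obtain ⟨a', b', ha', hb', hab', h1', h2'⟩ := hk
  exact ⟨a + a', b + b', by positivity, by positivity, by linarith,
    fun x hx => (abs_add_le _ _).trans (add_le_add (h1 x hx) (h1' x hx)), h2.add h2'⟩

theorem HB.mul (hf : HB p₀ α f c) (hk : HB p₀ α k c') : HB p₀ α (f * k) (c * c') := by
  obtain ⟨a, b, ha, hb, hab, h1, h2⟩ := hf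
  obtain ⟨a', b', ha', hb', hab', h1', h2'⟩ := hk
  refine ⟨a * a', a * b' + b * a', by positivity, by positivity, ?_, fun x hx => ?_,
    HolderC.mul ha hb h1 h2 h1' h2'⟩
  · calc a * a' + (a * b' + b * a') ≤ (a + b) * (a' + b') := by nlinarith [mul_nonneg hb hb']
      _ ≤ c * c' := by gcongr; linarith
  · rw [Pi.mul_apply, abs_mul]
    exact mul_le_mul (h1 x hx) (h1' x hx) (abs_nonneg _) ha

theorem HB.const (r : ℝ) : HB p₀ α (fun _ => r) |r| :=
  ⟨|r|, 0, abs_nonneg _, le_rfl, by simp, fun _ _ => le_rfl, fun x _ y _ => by simp⟩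

theorem HB.smul (hf : HB p₀ α f c) (r : ℝ) : HB p₀ α (r • f) (|r| * c) :=
  ((HB.const r).mul hf).congr fun _ _ => rfl

theorem HB.neg (hf : HB p₀ α f c) : HB p₀ α (-f) c := by
  have := hf.smul (-1)
  rw [abs_neg, abs_one, one_mul] at this
  exact this.congr fun _ _ => by simp

theorem HB.sum {ι : Type*} {s : Finset ι} {F : ι → ℝ × ℝ → ℝ} {C : ι → ℝ}
    (h : ∀ i ∈ s, HB p₀ α (F i) (C i)) : HB p₀ α (∑ i ∈ s, F i) (∑ i ∈ s, C i) := by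
  classical
  induction s using Finset.induction_on with
  | empty =>
    have := HB.const (p₀ := p₀) (α := α) 0
    rw [abs_zero] at this
    exact this
  | insert i s hi ih =>
    rw [Finset.sum_insert hi, Finset.sum_insert hi]
    exact (h i (Finset.mem_insert_self _ _)).add
      (ih fun j hj => h j (Finset.mem_insert_of_mem hj))

end HB

/-- Horizontal translation by `ε`. -/
def trL (ε : ℝ) : Module.End ℝ (ℝ × ℝ → ℝ) where
  toFun f := fun x => f (x.1 + ε, x.2)
  map_add' _ _ := rfl
  map_smul' _ _ := rfl

/-- Horizontal difference quotient with step `ε`. -/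
noncomputable def dqL (ε : ℝ) : Module.End ℝ (ℝ × ℝ → ℝ) := ε⁻¹ • (trL ε - 1)

theorem trL_apply (ε : ℝ) (f : ℝ × ℝ → ℝ) (x : ℝ × ℝ) : trL ε f x = f (x.1 + ε, x.2) := rfl

theorem dqL_apply (ε : ℝ) (f : ℝ × ℝ → ℝ) (x : ℝ × ℝ) :
    dqL ε f x = ε⁻¹ * (f (x.1 + ε, x.2) - f x) := rfl

theorem commute_trL_dqL (ε : ℝ) : Commute (trL ε) (dqL ε) :=
  ((Commute.refl _).sub_right (Commute.one_right _)).smul_right _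

theorem dqL_mul (ε : ℝ) (f k : ℝ × ℝ → ℝ) :
    dqL ε (f * k) = f * dqL ε k + dqL ε f * trL ε k := by
  ext x
  simp only [dqL_apply, trL_apply, Pi.mul_apply, Pi.add_apply]
  ring

/-- The discrete Leibniz rule. -/
theorem dqL_pow_mul (ε : ℝ) (n : ℕ) (f k : ℝ × ℝ → ℝ) :
    (dqL ε ^ n) (f * k) = ∑ ij ∈ Finset.HasAntidiagonal.antidiagonal n,
      (n.choose ij.1 : ℝ × ℝ → ℝ) * ((dqL ε ^ ij.1) f * (trL ε ^ ij.1) ((dqL ε ^ ij.2) k)) := by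
  induction n generalizing f k with
  | zero => simp
  | succ n ih =>
    rw [Finset.sum_antidiagonal_choose_succ_mul
      (fun i j => (dqL ε ^ i) f * (trL ε ^ i) ((dqL ε ^ j) k)), pow_succ, Module.End.mul_apply,
      dqL_mul, map_add, ih, ih]
    congr 1
    · refine Finset.sum_congr rfl fun ij hij => ?_
      rw [Finset.HasAntidiagonal.mem_antidiagonal] at hij
      congr 1
      · rw [← hij, Nat.choose_symm_add]
      · rw [pow_succ (dqL ε) ij.1, Module.End.mul_apply]
        congr 1
        rw [pow_succ (trL ε) ij.1, Module.End.mul_apply, ← Module.End.mul_apply,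
          ← Module.End.mul_apply (trL ε), ((commute_trL_dqL ε).pow_right ij.2).eq]
        rfl

theorem mem_Obar_add {p₀ ε : ℝ} {x : ℝ × ℝ} (hx : x ∈ Obar p₀) : (x.1 + ε, x.2) ∈ Obar p₀ :=
  mem_Obar.2 (mem_Obar.1 hx)

theorem dqL_pow_congr {p₀ ε : ℝ} {f k : ℝ × ℝ → ℝ} (h : ∀ x ∈ Obar p₀, f x = k x) (n : ℕ) :
    ∀ x ∈ Obar p₀, (dqL ε ^ n) f x = (dqL ε ^ n) k x := by
  induction n with
  | zero => simpa using h
  | succ n ih =>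
    intro x hx
    rw [pow_succ', Module.End.mul_apply, Module.End.mul_apply, dqL_apply, dqL_apply, ih x hx,
      ih _ (mem_Obar_add hx)]

theorem dqL_const (ε r : ℝ) : dqL ε (fun _ => r) = 0 := by
  ext x
  simp [dqL_apply]

section HB

variable {p₀ α c c' : ℝ} {f k : ℝ × ℝ → ℝ}

theorem HB.trL (hf : HB p₀ α f c) (ε : ℝ) : HB p₀ α (trL ε f) c := by
  obtain ⟨a, b, ha, hb, hab, h1, h2⟩ := hf
  refine ⟨a, b, ha, hb, hab, fun x hx => h1 _ (mem_Obar_add hx), fun x hx y hy => ?_⟩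
  have := h2 _ (mem_Obar_add (ε := ε) hx) _ (mem_Obar_add (ε := ε) hy)
  simpa [trL_apply, Prod.norm_def] using this

theorem HB.trL_pow (hf : HB p₀ α f c) (ε : ℝ) (n : ℕ) : HB p₀ α ((_root_.trL ε ^ n) f) c := by
  induction n with
  | zero => simpa using hf
  | succ n ih => rw [pow_succ', Module.End.mul_apply]; exact ih.trL ε

theorem HB.dqL (hf : HB p₀ α f c) (ε : ℝ) : HB p₀ α (dqL ε f) (|ε⁻¹| * (c + c)) :=
  ((hf.trL ε).add hf.neg).smul ε⁻¹ |>.congr fun x _ => by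
    simp [dqL_apply, trL_apply, sub_eq_add_neg]

theorem HB.exists_dqL_pow (hf : HB p₀ α f c) (ε : ℝ) (n : ℕ) :
    ∃ c', HB p₀ α ((_root_.dqL ε ^ n) f) c' := by
  induction n with
  | zero => exact ⟨c, by simpa using hf⟩
  | succ n ih =>
    obtain ⟨c', h⟩ := ih
    rw [pow_succ', Module.End.mul_apply]
    exact ⟨_, h.dqL ε⟩

theorem HasPartials.dqL {w wq wp : ℝ × ℝ → ℝ} (h : HasPartials p₀ w wq wp) (ε : ℝ) :
    HasPartials p₀ (dqL ε w) (dqL ε wq) (dqL ε wp) := by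
  constructor
  · intro x hx
    have h1 := h.fst (x.1 + ε, x.2) (mem_Obar_add hx)
    have h2 := HasDerivAt.comp_add_const x.1 ε h1
    exact (h2.sub (h.fst x hx)).const_mul ε⁻¹
  · intro x hx
    exact ((h.snd (x.1 + ε, x.2) (mem_Obar_add hx)).sub (h.snd x hx)).const_mul ε⁻¹

theorem HasPartials.dqL_pow {w wq wp : ℝ × ℝ → ℝ} (h : HasPartials p₀ w wq wp) (ε : ℝ) (n : ℕ) :
    HasPartials p₀ ((_root_.dqL ε ^ n) w) ((_root_.dqL ε ^ n) wq) ((_root_.dqL ε ^ n) wp) := by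
  induction n with
  | zero => simpa using h
  | succ n ih =>
    simp only [pow_succ', Module.End.mul_apply]
    exact ih.dqL ε

/-- Difference quotients are controlled by the derivative. -/
theorem HB.dqL_of_partials {w wq wp : ℝ × ℝ → ℝ} (h : HasPartials p₀ w wq wp)
    (hq : HB p₀ α wq c) (ε : ℝ) : HB p₀ α (_root_.dqL ε w) c := by
  obtain ⟨a, b, ha, hb, hab, h1, h2⟩ := hq
  have key : ∀ (φ φ' : ℝ → ℝ) (t M : ℝ), 0 ≤ M → (∀ t, HasDerivAt φ (φ' t) t) →
      (∀ t, |φ' t| ≤ M) → |ε⁻¹ * (φ (t + ε) - φ t)| ≤ M := by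
    intro φ φ' t M hM hφ hφ'
    have h := abs_sub_sub_mul_le_of_deriv (m := 0) (K := M) convex_univ (mem_univ t)
      (mem_univ (t + ε)) (fun t _ => (hφ t).hasDerivWithinAt) (fun t _ => by simpa using hφ' t)
    rw [zero_mul, sub_zero, add_sub_cancel_left] at h
    rw [abs_mul, abs_inv]
    rcases eq_or_ne ε 0 with rfl | hε
    · simpa using hM
    · rw [inv_mul_le_iff₀ (abs_pos.2 hε), mul_comm]; exact h
  refine ⟨a, b, ha, hb, hab, fun x hx => ?_, fun x hx y hy => ?_⟩
  · exact key (fun t => w (t, x.2)) (fun t => wq (t, x.2)) x.1 a ha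
      (fun t => h.fst (t, x.2) (mem_Obar.2 (mem_Obar.1 hx)))
      fun t => h1 (t, x.2) (mem_Obar.2 (mem_Obar.1 hx))
  · have hx' : ∀ t, (x.1 + t, x.2) ∈ Obar p₀ := fun t => mem_Obar_add hx
    have hy' : ∀ t, (y.1 + t, y.2) ∈ Obar p₀ := fun t => mem_Obar_add hy
    have := key (fun t => w (x.1 + t, x.2) - w (y.1 + t, y.2))
      (fun t => wq (x.1 + t, x.2) - wq (y.1 + t, y.2)) 0 (b * ‖x - y‖ ^ α) (by positivity)
      (fun t => (HasDerivAt.comp_const_add x.1 t (h.fst _ (hx' t))).sub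
        (HasDerivAt.comp_const_add y.1 t (h.fst _ (hy' t))))
      (fun t => by
        have := h2 _ (hx' t) _ (hy' t)
        simpa [Prod.norm_def] using this)
    convert this using 2
    simp only [dqL_apply, zero_add, add_zero]
    ring

end HB

/-- The majorant sequence `k! R ^ k / k ^ 2`. -/
noncomputable def maj (R : ℝ) (k : ℕ) : ℝ := k.factorial * R ^ k / (k : ℝ) ^ 2

theorem maj_nonneg {R : ℝ} (hR : 0 ≤ R) (k : ℕ) : 0 ≤ maj R k := by
  unfold maj; positivity

theorem sum_inv_sq_le (N : ℕ) : ∑ i ∈ Finset.range N, 1 / ((i : ℝ) + 1) ^ 2 ≤ 2 := by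
  have h : ∀ N : ℕ, ∑ i ∈ Finset.range (N + 1), 1 / ((i : ℝ) + 1) ^ 2 ≤ 2 - 1 / ((N : ℝ) + 1) := by
    intro N
    induction N with
    | zero => norm_num
    | succ N ih =>
      rw [Finset.sum_range_succ]
      have : 1 / (((N + 1 : ℕ) : ℝ) + 1) ^ 2 ≤ 1 / ((N : ℝ) + 1) - 1 / (((N + 1 : ℕ) : ℝ) + 1) := by
        push_cast
        rw [div_sub_div _ _ (by positivity) (by positivity), div_le_div_iff₀ (by positivity)
          (by positivity)]
        nlinarith [(Nat.cast_nonneg N : (0:ℝ) ≤ N)]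
      linarith
  rcases N with _ | N
  · norm_num
  · have : 0 ≤ 1 / ((N : ℝ) + 1) := by positivity
    linarith [h N]

theorem sum_inv_sq_reflect_le (N : ℕ) :
    ∑ i ∈ Finset.range N, 1 / (((N - i : ℕ) : ℝ)) ^ 2 ≤ 2 := by
  refine le_trans (le_of_eq ?_) (sum_inv_sq_le N)
  rw [← Finset.sum_range_reflect]
  refine Finset.sum_congr rfl fun i hi => ?_
  rw [Finset.mem_range] at hi
  rw [show N - (N - 1 - i) = i + 1 by omega]
  push_cast
  rfl

theorem sum_choose_mul_maj_mul_maj_le {R : ℝ} (hR : 0 ≤ R) (n : ℕ) :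
    ∑ i ∈ Finset.range n, ((n + 1).choose (i + 1) : ℝ) * (maj R (i + 1) * maj R (n - i)) ≤
      8 * maj R (n + 1) := by
  have h : ∀ i ∈ Finset.range n, ((n + 1).choose (i + 1) : ℝ) * (maj R (i + 1) * maj R (n - i)) ≤
      maj R (n + 1) * (2 * (1 / ((i : ℝ) + 1) ^ 2 + 1 / (((n - i : ℕ) : ℝ)) ^ 2)) := by
    intro i hi
    rw [Finset.mem_range] at hi
    obtain ⟨y, rfl⟩ : ∃ y, n = i + (y + 1) := ⟨n - i - 1, by omega⟩
    rw [show i + (y + 1) - i = y + 1 by omega]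
    have hc : ((i + (y + 1) + 1).choose (i + 1) : ℝ) * ((i + 1).factorial * (y + 1).factorial) =
        (i + (y + 1) + 1).factorial := by
      have := Nat.choose_mul_factorial_mul_factorial (n := i + (y + 1) + 1) (k := i + 1) (by omega)
      rw [show i + (y + 1) + 1 - (i + 1) = y + 1 by omega, mul_assoc] at this
      exact_mod_cast this
    have e : ((i + (y + 1) + 1).choose (i + 1) : ℝ) * (maj R (i + 1) * maj R (y + 1)) =
        (i + (y + 1) + 1).factorial * R ^ (i + (y + 1) + 1) *
          (1 / (((i : ℝ) + 1) ^ 2 * ((y : ℝ) + 1) ^ 2)) := by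
      rw [← hc]; unfold maj; push_cast
      field_simp
      ring
    have e' : maj R (i + (y + 1) + 1) = (i + (y + 1) + 1).factorial * R ^ (i + (y + 1) + 1) *
        (1 / ((i : ℝ) + (y + 1) + 1) ^ 2) := by
      unfold maj; push_cast
      field_simp
    rw [e, e', mul_assoc _ (1 / ((i : ℝ) + (y + 1) + 1) ^ 2)]
    push_cast
    refine mul_le_mul_of_nonneg_left ?_ (by positivity)
    rw [one_div_mul_eq_div, le_div_iff₀ (by positivity), div_add_div _ _ (by positivity)
      (by positivity), one_div_mul_eq_div, mul_div_assoc',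
      div_le_div_iff_of_pos_right (by positivity)]
    nlinarith [sq_nonneg ((i : ℝ) - y)]
  refine (Finset.sum_le_sum h).trans ?_
  rw [← Finset.mul_sum, ← Finset.mul_sum, Finset.sum_add_distrib, mul_comm (8:ℝ)]
  have := maj_nonneg hR (n + 1)
  gcongr
  linarith [sum_inv_sq_le n, sum_inv_sq_reflect_le n]

theorem sum_choose_mul_maj_mul_maj_le' {R : ℝ} (hR : 0 ≤ R) (n : ℕ) :
    ∑ i ∈ Finset.range n, (n.choose (i + 1) : ℝ) * (maj R (i + 1) * maj R (n - i)) ≤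
      4 * maj R (n + 1) := by
  have h : ∀ i ∈ Finset.range n, (n.choose (i + 1) : ℝ) * (maj R (i + 1) * maj R (n - i)) ≤
      maj R (n + 1) * (3 / 2 * (1 / ((i : ℝ) + 1) ^ 2) + 1 / 2 * (1 / (((n - i : ℕ) : ℝ)) ^ 2)) := by
    intro i hi
    rw [Finset.mem_range] at hi
    obtain ⟨y, rfl⟩ : ∃ y, n = i + (y + 1) := ⟨n - i - 1, by omega⟩
    rw [show i + (y + 1) - i = y + 1 by omega]
    have hc : ((i + (y + 1)).choose (i + 1) : ℝ) * ((i + 1).factorial * y.factorial) =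
        (i + (y + 1)).factorial := by
      have := Nat.choose_mul_factorial_mul_factorial (n := i + (y + 1)) (k := i + 1) (by omega)
      rw [show i + (y + 1) - (i + 1) = y by omega, mul_assoc] at this
      exact_mod_cast this
    have e : ((i + (y + 1)).choose (i + 1) : ℝ) * (maj R (i + 1) * maj R (y + 1)) =
        (i + (y + 1)).factorial * R ^ (i + (y + 1) + 1) *
          (1 / (((i : ℝ) + 1) ^ 2 * ((y : ℝ) + 1))) := by
      rw [← hc]; unfold maj; rw [Nat.factorial_succ y]; push_cast
      field_simp
      ring
    have e' : maj R (i + (y + 1) + 1) = (i + (y + 1)).factorial * R ^ (i + (y + 1) + 1) *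
        (1 / ((i : ℝ) + (y + 1) + 1)) := by
      unfold maj; rw [Nat.factorial_succ (i + (y + 1))]; push_cast
      field_simp
    rw [e, e', mul_assoc _ (1 / ((i : ℝ) + (y + 1) + 1))]
    push_cast
    gcongr
    rw [one_div_mul_eq_div, le_div_iff₀ (by positivity)]
    have e3 : 1 / (((i : ℝ) + 1) ^ 2 * ((y : ℝ) + 1)) * ((i : ℝ) + (y + 1) + 1) =
        (1 / ((i : ℝ) + 1)) * (1 / ((y : ℝ) + 1)) + (1 / ((i : ℝ) + 1)) ^ 2 := by
      field_simp
      ring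
    rw [e3, ← one_div_pow, ← one_div_pow]
    nlinarith [sq_nonneg (1 / ((i : ℝ) + 1) - 1 / ((y : ℝ) + 1))]
  refine (Finset.sum_le_sum h).trans ?_
  rw [← Finset.mul_sum, Finset.sum_add_distrib, ← Finset.mul_sum, ← Finset.mul_sum, mul_comm (4:ℝ)]
  have := maj_nonneg hR (n + 1)
  gcongr
  linarith [sum_inv_sq_le n, sum_inv_sq_reflect_le n]

/-- Bounds for the difference quotients of `f` up to order `n` by multiples of `maj R`. -/
structure Maj (p₀ α ε δ R : ℝ) (n : ℕ) (f : ℝ × ℝ → ℝ) (K A : ℝ) : Prop where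
  nonneg : 0 ≤ A
  zero : HB p₀ α f K
  pos : ∀ k, 1 ≤ k → k ≤ n → HB p₀ α ((dqL ε ^ k) f) (A * δ * maj R k)

namespace Maj

variable {p₀ α ε δ R : ℝ} {n : ℕ} {f k : ℝ × ℝ → ℝ} {K A L B : ℝ}

theorem mono_order {m : ℕ} (hf : Maj p₀ α ε δ R n f K A) (h : m ≤ n) : Maj p₀ α ε δ R m f K A :=
  ⟨hf.nonneg, hf.zero, fun k h1 h2 => hf.pos k h1 (h2.trans h)⟩

theorem add (hf : Maj p₀ α ε δ R n f K A) (hk : Maj p₀ α ε δ R n k L B) :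
    Maj p₀ α ε δ R n (f + k) (K + L) (A + B) :=
  ⟨add_nonneg hf.nonneg hk.nonneg, hf.zero.add hk.zero, fun j h1 h2 => by
    rw [map_add, add_mul, add_mul]
    exact (hf.pos j h1 h2).add (hk.pos j h1 h2)⟩

theorem smul (hf : Maj p₀ α ε δ R n f K A) (r : ℝ) :
    Maj p₀ α ε δ R n (r • f) (|r| * K) (|r| * A) :=
  ⟨mul_nonneg (abs_nonneg _) hf.nonneg, hf.zero.smul r, fun j h1 h2 => by
    rw [map_smul, mul_assoc, mul_assoc, ← mul_assoc A]
    exact (hf.pos j h1 h2).smul r⟩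

theorem trL (hf : Maj p₀ α ε δ R n f K A) : Maj p₀ α ε δ R n (trL ε f) K A :=
  ⟨hf.nonneg, hf.zero.trL ε, fun j h1 h2 => by
    rw [← Module.End.mul_apply, ← ((commute_trL_dqL ε).pow_right j).eq, Module.End.mul_apply]
    exact (hf.pos j h1 h2).trL ε⟩

theorem const (r : ℝ) : Maj p₀ α ε δ R n (fun _ => r) |r| 0 :=
  ⟨le_rfl, HB.const r, fun j h1 _ => by
    obtain ⟨j, rfl⟩ : ∃ i, j = i + 1 := ⟨j - 1, by omega⟩
    rw [pow_succ, Module.End.mul_apply, dqL_const, map_zero, zero_mul, zero_mul]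
    have := HB.const (p₀ := p₀) (α := α) 0
    rw [abs_zero] at this
    exact this⟩

end Maj

theorem HB.leibniz_term {p₀ α c c' : ℝ} {f k : ℝ × ℝ → ℝ} (hf : HB p₀ α f c) (hk : HB p₀ α k c')
    (ε : ℝ) (n i : ℕ) :
    HB p₀ α ((n : ℝ × ℝ → ℝ) * (f * (_root_.trL ε ^ i) k)) (n * (c * c')) := by
  have := ((hf.mul (hk.trL_pow ε i)).smul (n : ℝ))
  rw [abs_of_nonneg (Nat.cast_nonneg n)] at this
  exact this.congr fun x _ => by simp

theorem dqL_pow_succ_mul (ε : ℝ) (n : ℕ) (f k : ℝ × ℝ → ℝ) :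
    (dqL ε ^ (n + 1)) (f * k) = (∑ i ∈ Finset.range n, (((n + 1).choose (i + 1) : ℕ) : ℝ × ℝ → ℝ) *
      ((dqL ε ^ (i + 1)) f * (trL ε ^ (i + 1)) ((dqL ε ^ (n - i)) k))) +
      f * (dqL ε ^ (n + 1)) k + (dqL ε ^ (n + 1)) f * (trL ε ^ (n + 1)) k := by
  rw [dqL_pow_mul, Finset.Nat.sum_antidiagonal_eq_sum_range_succ_mk, Finset.sum_range_succ,
    Finset.sum_range_succ']
  simp

theorem Maj.sum_interior {p₀ α ε δ R : ℝ} {n m : ℕ} {f k : ℝ × ℝ → ℝ} {K A L B : ℝ}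
    (hf : Maj p₀ α ε δ R n f K A) (hk : Maj p₀ α ε δ R n k L B) (hR : 0 ≤ R) (hm : m ≤ n) :
    HB p₀ α (∑ i ∈ Finset.range m, (((m + 1).choose (i + 1) : ℕ) : ℝ × ℝ → ℝ) *
      ((dqL ε ^ (i + 1)) f * (_root_.trL ε ^ (i + 1)) ((dqL ε ^ (m - i)) k)))
      (8 * (A * δ) * (B * δ) * maj R (m + 1)) := by
  have hA := hf.nonneg
  have hB := hk.nonneg
  refine (HB.sum fun i hi => ?_).mono (c := ∑ i ∈ Finset.range m, ((m + 1).choose (i + 1) : ℝ) *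
    ((A * δ * maj R (i + 1)) * (B * δ * maj R (m - i)))) ?_
  · rw [Finset.mem_range] at hi
    exact (hf.pos (i + 1) (by omega) (by omega)).leibniz_term (hk.pos (m - i) (by omega) (by omega))
      _ _ _
  · have h := sum_choose_mul_maj_mul_maj_le hR m
    calc _ = (A * B * δ ^ 2) * ∑ i ∈ Finset.range m, ((m + 1).choose (i + 1) : ℝ) *
          (maj R (i + 1) * maj R (m - i)) := by
          rw [Finset.mul_sum]
          exact Finset.sum_congr rfl fun i _ => by ring
      _ ≤ (A * B * δ ^ 2) * (8 * maj R (m + 1)) := by gcongr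
      _ = _ := by ring

theorem Maj.mul {p₀ α ε δ R : ℝ} {n : ℕ} {f k : ℝ × ℝ → ℝ} {K A L B : ℝ}
    (hf : Maj p₀ α ε δ R n f K A) (hk : Maj p₀ α ε δ R n k L B) (hR : 0 ≤ R) (hδ : 0 ≤ δ)
    (hδ1 : δ ≤ 1) : Maj p₀ α ε δ R n (f * k) (K * L) (8 * A * B + K * B + A * L) := by
  have hA := hf.nonneg
  have hB := hk.nonneg
  have hK := hf.zero.nonneg
  have hL := hk.zero.nonneg
  refine ⟨by positivity, hf.zero.mul hk.zero, fun j h1 h2 => ?_⟩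
  obtain ⟨m, rfl⟩ : ∃ i, j = i + 1 := ⟨j - 1, by omega⟩
  rw [dqL_pow_succ_mul]
  refine (((hf.sum_interior hk hR (by omega)).add (hf.zero.mul (hk.pos _ h1 h2))).add
    ((hf.pos _ h1 h2).mul (hk.zero.trL_pow ε _))).mono ?_
  have hm := maj_nonneg hR (m + 1)
  have : A * B * δ * maj R (m + 1) * δ ≤ A * B * δ * maj R (m + 1) * 1 := by gcongr
  linarith

theorem Maj.inv {p₀ α ε δ R : ℝ} {n : ℕ} {f u : ℝ × ℝ → ℝ} {K A L : ℝ}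
    (hf : Maj p₀ α ε δ R n f K A) (hu : HB p₀ α u L) (huf : ∀ x ∈ Obar p₀, u x * f x = 1)
    (hR : 0 ≤ R) (hδ : 0 ≤ δ) (hsmall : 8 * L * A * δ ≤ 1 / 2) :
    Maj p₀ α ε δ R n u L (2 * L ^ 2 * A) := by
  have hA := hf.nonneg
  have hL := hu.nonneg
  refine ⟨by positivity, hu, fun j => ?_⟩
  induction j using Nat.strong_induction_on with
  | _ j ih =>
    intro h1 h2
    obtain ⟨m, rfl⟩ : ∃ i, j = i + 1 := ⟨j - 1, by omega⟩
    have hu' : Maj p₀ α ε δ R m u L (2 * L ^ 2 * A) :=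
      ⟨by positivity, hu, fun k i1 i2 => ih k (by omega) i1 (by omega)⟩
    have h3 := hu'.sum_interior (hf.mono_order (by omega : m ≤ n)) hR le_rfl
    have h4 := hu.mul (hf.pos _ h1 h2)
    refine (((h3.add h4).neg.mul (hu.trL_pow ε (m + 1))).congr fun x hx => ?_).mono ?_
      (c := (8 * (2 * L ^ 2 * A * δ) * (A * δ) * maj R (m + 1) + L * (A * δ * maj R (m + 1))) * L)
    · have e1 : (dqL ε ^ (m + 1)) (u * f) x = 0 := by
        rw [dqL_pow_congr (f := u * f) (k := fun _ => 1) huf (m + 1) x hx, pow_succ, Module.End.mul_apply,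
          dqL_const, map_zero]
        rfl
      rw [dqL_pow_succ_mul] at e1
      have e2 : (_root_.trL ε ^ (m + 1)) f x * (_root_.trL ε ^ (m + 1)) u x = 1 := by
        have : ∀ j : ℕ, ∀ x ∈ Obar p₀,
            (_root_.trL ε ^ j) f x * (_root_.trL ε ^ j) u x = 1 := by
          intro j
          induction j with
          | zero => intro x hx; simpa [mul_comm] using huf x hx
          | succ j ihj =>
            intro x hx
            simp only [pow_succ', Module.End.mul_apply, trL_apply]
            exact ihj _ (mem_Obar_add hx)
        exact this _ x hx
      simp only [Pi.add_apply, Pi.mul_apply, Pi.neg_apply] at e1 ⊢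
      linear_combination (_root_.trL ε ^ (m + 1)) u x * e1 - (dqL ε ^ (m + 1)) u x * e2
    · have hm := maj_nonneg hR (m + 1)
      have : 8 * L * A * δ * (2 * L ^ 2 * A * δ * maj R (m + 1)) ≤
        1 / 2 * (2 * L ^ 2 * A * δ * maj R (m + 1)) := by gcongr
      linarith

/-- Commutator estimate for `D ^ n` and multiplication by `f`. -/
theorem Maj.commutator {p₀ α ε δ R : ℝ} {n : ℕ} {f k : ℝ × ℝ → ℝ} {K A L B : ℝ}
    (hf : Maj p₀ α ε δ R n f K A) (hk : Maj p₀ α ε δ R n k L B) (hR : 0 ≤ R) :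
    HB p₀ α ((dqL ε ^ n) (f * dqL ε k) - f * (dqL ε ^ (n + 1)) k)
      (4 * (A * δ) * (B * δ) * maj R (n + 1)) := by
  have hA := hf.nonneg
  have hB := hk.nonneg
  have e : (dqL ε ^ n) (f * dqL ε k) - f * (dqL ε ^ (n + 1)) k =
      ∑ i ∈ Finset.range n, ((n.choose (i + 1) : ℕ) : ℝ × ℝ → ℝ) *
      ((dqL ε ^ (i + 1)) f * (_root_.trL ε ^ (i + 1)) ((dqL ε ^ (n - i)) k)) := by
    rw [dqL_pow_mul, Finset.Nat.sum_antidiagonal_eq_sum_range_succ_mk, Finset.sum_range_succ']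
    simp only [Nat.choose_zero_right, Nat.cast_one, one_mul, pow_zero, Module.End.one_apply,
      Nat.sub_zero, ← Module.End.mul_apply, ← pow_succ, add_sub_cancel_right]
    refine Finset.sum_congr rfl fun i hi => ?_
    rw [Finset.mem_range] at hi
    rw [show n - (i + 1) + 1 = n - i by omega]
  rw [e]
  refine (HB.sum fun i hi => ?_).mono (c := ∑ i ∈ Finset.range n, (n.choose (i + 1) : ℝ) *
    ((A * δ * maj R (i + 1)) * (B * δ * maj R (n - i)))) ?_
  · rw [Finset.mem_range] at hi
    exact (hf.pos (i + 1) (by omega) (by omega)).leibniz_term (hk.pos (n - i) (by omega) (by omega))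
      _ _ _
  · have h := sum_choose_mul_maj_mul_maj_le' hR n
    calc _ = (A * B * δ ^ 2) * ∑ i ∈ Finset.range n, (n.choose (i + 1) : ℝ) *
          (maj R (i + 1) * maj R (n - i)) := by
          rw [Finset.mul_sum]
          exact Finset.sum_congr rfl fun i _ => by ring
      _ ≤ (A * B * δ ^ 2) * (4 * maj R (n + 1)) := by gcongr
      _ = _ := by ring

theorem Maj.mono {p₀ α ε δ R : ℝ} {n : ℕ} {f : ℝ × ℝ → ℝ} {K A L B : ℝ}
    (hf : Maj p₀ α ε δ R n f K A) (hδ : 0 ≤ δ) (hR : 0 ≤ R) (hK : K ≤ L) (hA : A ≤ B) :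
    Maj p₀ α ε δ R n f L B :=
  ⟨hf.nonneg.trans hA, hf.zero.mono hK, fun k h1 h2 => (hf.pos k h1 h2).mono (by
    have := maj_nonneg hR k
    gcongr)⟩

/-- First coefficient of the linear system solved by difference quotients. -/
noncomputable def coefA (ε : ℝ) (u : ℝ × ℝ → ℝ) : ℝ × ℝ → ℝ := (1 / 2 : ℝ) • (u + trL ε u)

/-- Mixed coefficient of the linear system solved by difference quotients. -/
noncomputable def coefB (ε : ℝ) (ξ u : ℝ × ℝ → ℝ) : ℝ × ℝ → ℝ :=
  (-(1 / 2) : ℝ) • ((ξ + trL ε ξ) * (u * trL ε u))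

/-- Last coefficient of the linear system solved by difference quotients. -/
noncomputable def coefD (ε : ℝ) (ξ u : ℝ × ℝ → ℝ) : ℝ × ℝ → ℝ :=
  (1 / 2 : ℝ) • ((((fun _ => (1 : ℝ)) + ξ * ξ) * u + trL ε (((fun _ => (1 : ℝ)) + ξ * ξ) * u)) *
    (u * trL ε u))

theorem exists_maj_coef (K : ℝ) : ∃ L A, 0 < L ∧ 0 ≤ A ∧
    ∀ p₀ α ε δ R : ℝ, ∀ (n : ℕ) (ξ u : ℝ × ℝ → ℝ), 0 ≤ R → 0 ≤ δ → δ ≤ 1 →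
      Maj p₀ α ε δ R n ξ K 1 → Maj p₀ α ε δ R n u K (2 * K ^ 2) →
      Maj p₀ α ε δ R n (coefA ε u) L A ∧ Maj p₀ α ε δ R n (coefB ε ξ u) L A ∧
        Maj p₀ α ε δ R n (coefD ε ξ u) L A := by
  have h1 : ∃ L A, ∀ p₀ α ε δ R : ℝ, ∀ (n : ℕ) (ξ u : ℝ × ℝ → ℝ), 0 ≤ R → 0 ≤ δ → δ ≤ 1 →
      Maj p₀ α ε δ R n ξ K 1 → Maj p₀ α ε δ R n u K (2 * K ^ 2) →
      Maj p₀ α ε δ R n (coefA ε u) L A :=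
    ⟨_, _, fun p₀ α ε δ R n ξ u hR hδ hδ1 hξ hu => (hu.add hu.trL).smul _⟩
  have h2 : ∃ L A, ∀ p₀ α ε δ R : ℝ, ∀ (n : ℕ) (ξ u : ℝ × ℝ → ℝ), 0 ≤ R → 0 ≤ δ → δ ≤ 1 →
      Maj p₀ α ε δ R n ξ K 1 → Maj p₀ α ε δ R n u K (2 * K ^ 2) →
      Maj p₀ α ε δ R n (coefB ε ξ u) L A :=
    ⟨_, _, fun p₀ α ε δ R n ξ u hR hδ hδ1 hξ hu =>
      ((hξ.add hξ.trL).mul (hu.mul hu.trL hR hδ hδ1) hR hδ hδ1).smul _⟩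
  have h3 : ∃ L A, ∀ p₀ α ε δ R : ℝ, ∀ (n : ℕ) (ξ u : ℝ × ℝ → ℝ), 0 ≤ R → 0 ≤ δ → δ ≤ 1 →
      Maj p₀ α ε δ R n ξ K 1 → Maj p₀ α ε δ R n u K (2 * K ^ 2) →
      Maj p₀ α ε δ R n (coefD ε ξ u) L A :=
    ⟨_, _, fun p₀ α ε δ R n ξ u hR hδ hδ1 hξ hu =>
      have h := ((Maj.const 1).add (hξ.mul hξ hR hδ hδ1)).mul hu hR hδ hδ1
      ((h.add h.trL).mul (hu.mul hu.trL hR hδ hδ1) hR hδ hδ1).smul _⟩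
  obtain ⟨L₁, A₁, h1⟩ := h1
  obtain ⟨L₂, A₂, h2⟩ := h2
  obtain ⟨L₃, A₃, h3⟩ := h3
  have e1 := le_abs_self L₁
  have e2 := le_abs_self L₂
  have e3 := le_abs_self L₃
  have e4 := le_abs_self A₁
  have e5 := le_abs_self A₂
  have e6 := le_abs_self A₃
  have i1 := abs_nonneg L₁
  have i2 := abs_nonneg L₂
  have i3 := abs_nonneg L₃
  have i4 := abs_nonneg A₁
  have i5 := abs_nonneg A₂
  have i6 := abs_nonneg A₃
  refine ⟨|L₁| + |L₂| + |L₃| + 1, |A₁| + |A₂| + |A₃|, by linarith, by linarith,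
    fun p₀ α ε δ R n ξ u hR hδ hδ1 hξ hu => ⟨?_, ?_, ?_⟩⟩
  · exact (h1 p₀ α ε δ R n ξ u hR hδ hδ1 hξ hu).mono hδ hR (by linarith) (by linarith)
  · exact (h2 p₀ α ε δ R n ξ u hR hδ hδ1 hξ hu).mono hδ hR (by linarith) (by linarith)
  · exact (h3 p₀ α ε δ R n ξ u hR hδ hδ1 hξ hu).mono hδ hR (by linarith) (by linarith)

/-- The height function of a water wave, its gradient `(ξ, η)`, `u = 1 / η`, and the potential `V`
of the divergence-form equation. -/
structure WaveSystem (p₀ g κ α K : ℝ) (Γ : ℝ → ℝ) (h ξ η u V : ℝ × ℝ → ℝ) : Prop where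
  h_partials : HasPartials p₀ h ξ η
  V_partials : HasPartials p₀ V (fun x => Γ x.2 + (1 + ξ x ^ 2) * u x ^ 2 / 2) (fun x => ξ x * u x)
  u_mul : ∀ x ∈ Obar p₀, u x * η x = 1
  u_pos : ∀ x ∈ Obar p₀, 0 < u x
  ξ_bound : HB p₀ α ξ K
  η_bound : HB p₀ α η K
  u_bound : HB p₀ α u K
  top : ∀ q, Γ 0 + (1 + ξ (q, 0) ^ 2) * u (q, 0) ^ 2 / 2 + g * h (q, 0) = κ
  bottom : ∀ q, h (q, p₀) = 0

namespace WaveSystem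

variable {p₀ g κ α K : ℝ} {Γ : ℝ → ℝ} {h ξ η u V : ℝ × ℝ → ℝ}

theorem u_ge (hw : WaveSystem p₀ g κ α K Γ h ξ η u V) {x : ℝ × ℝ} (hx : x ∈ Obar p₀) :
    K⁻¹ ≤ u x := by
  have h1 := hw.u_mul x hx
  have h2 := hw.u_pos x hx
  have h3 := (le_abs_self _).trans (hw.η_bound.abs_le hx)
  have h4 : 1 ≤ u x * K := h1 ▸ mul_le_mul_of_nonneg_left h3 h2.le
  have h5 : 0 < K := by nlinarith
  rwa [inv_le_iff_one_le_mul₀ h5]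

theorem K_pos (hw : WaveSystem p₀ g κ α K Γ h ξ η u V) (hp₀ : p₀ ≤ 0) : 0 < K := by
  have hx : ((0, 0) : ℝ × ℝ) ∈ Obar p₀ := mem_Obar.2 ⟨hp₀, le_rfl⟩
  exact (hw.u_pos _ hx).trans_le ((le_abs_self _).trans (hw.u_bound.abs_le hx))

theorem dqL_flux (hw : WaveSystem p₀ g κ α K Γ h ξ η u V) (ε : ℝ) : ∀ x ∈ Obar p₀,
    dqL ε (fun x => ξ x * u x) x =
      (coefA ε u * dqL ε ξ + coefB ε ξ u * dqL ε η) x := by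
  intro x hx
  have h1 := hw.u_mul x hx
  have h2 := hw.u_mul _ (mem_Obar_add (ε := ε) hx)
  simp only [coefA, coefB, Pi.add_apply, Pi.mul_apply, Pi.smul_apply, smul_eq_mul, dqL_apply,
    trL_apply]
  linear_combination (1 / 2) * ε⁻¹ * (ξ x + ξ (x.1 + ε, x.2)) * (u x * h2 - u (x.1 + ε, x.2) * h1)

theorem dqL_flux' (hw : WaveSystem p₀ g κ α K Γ h ξ η u V) (ε : ℝ) : ∀ x ∈ Obar p₀,
    dqL ε (fun x => Γ x.2 + (1 + ξ x ^ 2) * u x ^ 2 / 2) x =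
      (-(coefB ε ξ u * dqL ε ξ + coefD ε ξ u * dqL ε η)) x := by
  intro x hx
  have h1 := hw.u_mul x hx
  have h2 := hw.u_mul _ (mem_Obar_add (ε := ε) hx)
  simp only [coefB, coefD, Pi.add_apply, Pi.mul_apply, Pi.smul_apply, Pi.neg_apply, smul_eq_mul,
    dqL_apply, trL_apply]
  linear_combination (1 / 2) * ε⁻¹ * ((1 + ξ x * ξ x) * u x +
    (1 + ξ (x.1 + ε, x.2) * ξ (x.1 + ε, x.2)) * u (x.1 + ε, x.2)) *
    (u x * h2 - u (x.1 + ε, x.2) * h1)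

theorem coef_elliptic (hw : WaveSystem p₀ g κ α K Γ h ξ η u V) (hp₀ : p₀ ≤ 0) (ε : ℝ)
    {x : ℝ × ℝ} (hx : x ∈ Obar p₀) : min (K⁻¹ ^ 3) (K⁻¹ ^ 4) ≤ coefD ε ξ u x ∧
      min (K⁻¹ ^ 3) (K⁻¹ ^ 4) ≤ coefA ε u x * coefD ε ξ u x - coefB ε ξ u x ^ 2 := by
  have hK := inv_pos.2 (hw.K_pos hp₀)
  have h1 := hw.u_ge hx
  have h2 := hw.u_ge (mem_Obar_add (ε := ε) hx)
  simp only [coefA, coefB, coefD, Pi.add_apply, Pi.mul_apply, Pi.smul_apply, smul_eq_mul,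
    trL_apply]
  generalize u x = v at *
  generalize u (x.1 + ε, x.2) = v' at *
  generalize ξ x = t at *
  generalize ξ (x.1 + ε, x.2) = t' at *
  have hv : 0 < v := hK.trans_le h1
  have hv' : 0 < v' := hK.trans_le h2
  have hvv : K⁻¹ * K⁻¹ ≤ v * v' := mul_le_mul h1 h2 hK.le hv.le
  constructor
  · refine (min_le_left _ _).trans ?_
    calc K⁻¹ ^ 3 = K⁻¹ * (K⁻¹ * K⁻¹) := by ring
      _ ≤ (1 / 2 * (v + v')) * (v * v') := by gcongr; linarith
      _ ≤ (1 / 2 * ((1 + t * t) * v + (1 + t' * t') * v')) * (v * v') := by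
        gcongr
        · nlinarith [mul_nonneg (mul_self_nonneg t) hv.le]
        · nlinarith [mul_nonneg (mul_self_nonneg t') hv'.le]
      _ = _ := by ring
  · refine (min_le_right _ _).trans ?_
    calc K⁻¹ ^ 4 = (K⁻¹ * K⁻¹) * K⁻¹ ^ 2 := by ring
      _ ≤ (v * v') * (1 / 2 * (v + v')) ^ 2 := by gcongr; linarith
      _ ≤ (v * v') * ((1 / 2 * (v + v')) ^ 2 + (1 / 2 * (t * v - t' * v')) ^ 2) := by
        gcongr
        exact le_add_of_nonneg_right (sq_nonneg _)
      _ = _ := by ring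

end WaveSystem

theorem HB.row {p₀ α c : ℝ} {f : ℝ × ℝ → ℝ} (hf : HB p₀ α f c) (hα : 0 ≤ α) (hp₀ : p₀ ≤ 0) :
    HB p₀ α (fun x => f (x.1, 0)) c := by
  obtain ⟨a, b, ha, hb, hab, h1, h2⟩ := hf
  have h0 : ∀ q : ℝ, (q, (0:ℝ)) ∈ Obar p₀ := fun q => mem_Obar.2 ⟨hp₀, le_rfl⟩
  refine ⟨a, b, ha, hb, hab, fun x _ => h1 _ (h0 _), fun x _ y _ => (h2 _ (h0 _) _ (h0 _)).trans ?_⟩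
  have : ‖((x.1, 0) - (y.1, 0) : ℝ × ℝ)‖ ≤ ‖x - y‖ := by
    simp [Prod.norm_def]
  gcongr

/-- The commutator of `D ^ n` with multiplication by `a`, applied to `D f`. -/
noncomputable def dqComm (ε : ℝ) (n : ℕ) (a f : ℝ × ℝ → ℝ) : ℝ × ℝ → ℝ :=
  (dqL ε ^ n) (a * dqL ε f) - a * (dqL ε ^ (n + 1)) f

namespace WaveSystem

variable {p₀ g κ α K : ℝ} {Γ : ℝ → ℝ} {h ξ η u V : ℝ × ℝ → ℝ}

theorem dqL_pow_top (hw : WaveSystem p₀ g κ α K Γ h ξ η u V) (ε : ℝ) (n : ℕ) (q : ℝ) :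
    (dqL ε ^ (n + 1)) (fun x => Γ x.2 + (1 + ξ x ^ 2) * u x ^ 2 / 2) (q, 0) +
      g * (dqL ε ^ (n + 1)) h (q, 0) = 0 := by
  have h1 := dqL_pow_congr (p₀ := 0) (ε := ε)
    (f := (fun x => Γ x.2 + (1 + ξ x ^ 2) * u x ^ 2 / 2) + g • h) (k := fun _ => κ)
    (fun x hx => by
      rw [mem_Obar] at hx
      have hx2 : x.2 = 0 := le_antisymm hx.2 hx.1
      obtain ⟨q, p⟩ := x
      simp only at hx2
      subst hx2
      simpa using hw.top q) (n + 1) (q, 0) (mem_Obar.2 ⟨le_rfl, le_rfl⟩)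
  rw [map_add, map_smul, pow_succ (dqL ε), Module.End.mul_apply _ _ (fun _ => κ), dqL_const,
    map_zero, ← pow_succ] at h1
  simpa using h1

theorem ellipticSystem (hw : WaveSystem p₀ g κ α K Γ h ξ η u V) (hα : 0 ≤ α) (hp₀ : p₀ ≤ 0)
    (hg : 0 ≤ g) {ε L c W : ℝ} {n : ℕ} (ha : HB p₀ α (coefA ε u) L) (hb : HB p₀ α (coefB ε ξ u) L)
    (hd : HB p₀ α (coefD ε ξ u) L)
    (h1 : HB p₀ α (dqComm ε n (coefA ε u) ξ + dqComm ε n (coefB ε ξ u) η) c)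
    (h2 : HB p₀ α (dqComm ε n (coefB ε ξ u) ξ + dqComm ε n (coefD ε ξ u) η) c)
    (hW : HB p₀ α ((dqL ε ^ (n + 1)) h) W) :
    ∃ f₁ f₂ v vq vp, EllipticSystem p₀ α (min (K⁻¹ ^ 3) (K⁻¹ ^ 4)) L (c + g * W) (coefA ε u)
      (coefB ε ξ u) (coefD ε ξ u) f₁ f₂ ((dqL ε ^ (n + 1)) h) ((dqL ε ^ (n + 1)) ξ)
      ((dqL ε ^ (n + 1)) η) v vq vp := by
  set G : ℝ × ℝ → ℝ := fun x => Γ x.2 + (1 + ξ x ^ 2) * u x ^ 2 / 2 with hG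
  set H := (dqL ε ^ (n + 1)) h with hH
  have hHp : HasPartials p₀ H ((dqL ε ^ (n + 1)) ξ) ((dqL ε ^ (n + 1)) η) :=
    hw.h_partials.dqL_pow ε (n + 1)
  have hVp := hw.V_partials.dqL_pow ε (n + 1)
  have hcont : Continuous fun s : ℝ => H (s, 0) := continuous_iff_continuousAt.2 fun s =>
    (hHp.fst (s, 0) (mem_Obar.2 ⟨hp₀, le_rfl⟩)).continuousAt
  have hrow : HB p₀ α (g • fun x => H (x.1, 0)) (g * W) := by
    have := (hW.row hα hp₀).smul g
    rwa [abs_of_nonneg hg] at this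
  have hv : HasPartials p₀ (fun x => (dqL ε ^ (n + 1)) V x - (dqL ε ^ (n + 1)) V (0, 0) +
      g * ∫ s in (0:ℝ)..x.1, H (s, 0)) (fun x => (dqL ε ^ (n + 1)) G x + g * H (x.1, 0))
      ((dqL ε ^ (n + 1)) fun x => ξ x * u x) := by
    constructor
    · intro x hx
      exact ((hVp.fst x hx).sub_const _).add ((hcont.integral_hasStrictDerivAt 0
        x.1).hasDerivAt.const_mul g)
    · intro x hx
      exact ((hVp.snd x hx).sub_const ((dqL ε ^ (n + 1)) V (0, 0))).add_const
        (g * ∫ s in (0:ℝ)..x.1, H (s, 0))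
  refine ⟨_, _, _, _, _, ⟨hHp, hv, fun x hx => ha.abs_le hx, fun x hx => hb.abs_le hx,
    fun x hx => hd.abs_le hx, ha.holderC, hb.holderC, hd.holderC,
    fun x hx => (hw.coef_elliptic hp₀ ε hx).1, fun x hx => (hw.coef_elliptic hp₀ ε hx).2,
    (h1.mono (le_add_of_nonneg_right hrow.nonneg)).holderC, (h2.add hrow.neg).holderC,
    ?_, ?_, ?_, ?_⟩⟩
  · intro x hx
    rw [pow_succ, Module.End.mul_apply, dqL_pow_congr (hw.dqL_flux ε) n x hx, map_add]
    simp only [dqComm, Pi.add_apply, Pi.mul_apply, Pi.sub_apply, ← pow_succ]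
    ring
  · intro x hx
    simp only [pow_succ (dqL ε), Module.End.mul_apply _ _ G]
    rw [dqL_pow_congr (hw.dqL_flux' ε) n x hx, map_neg, map_add]
    simp only [dqComm, Pi.add_apply, Pi.mul_apply, Pi.sub_apply, Pi.neg_apply, Pi.smul_apply,
      smul_eq_mul, ← pow_succ]
    ring
  · intro q
    have hz : ∀ q : ℝ, HasDerivAt (fun q : ℝ => (dqL ε ^ (n + 1)) V (q, 0) -
        (dqL ε ^ (n + 1)) V (0, 0) + g * ∫ s in (0:ℝ)..q, H (s, 0)) 0 q := fun q => by
      have := hv.fst (q, 0) (mem_Obar.2 ⟨hp₀, le_rfl⟩)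
      rwa [hw.dqL_pow_top ε n q] at this
    have := is_const_of_deriv_eq_zero (fun q => (hz q).differentiableAt) (fun q => (hz q).deriv)
      q 0
    simpa using this
  · intro q
    have := dqL_pow_congr (p₀ := 0) (ε := ε) (f := fun x => h (x.1, p₀)) (k := fun _ => 0)
      (fun x _ => hw.bottom x.1) (n + 1) (q, 0) (mem_Obar.2 ⟨le_rfl, le_rfl⟩)
    have e : ∀ m : ℕ, ∀ x : ℝ × ℝ, (dqL ε ^ m) (fun x => h (x.1, p₀)) x =
        (dqL ε ^ m) h (x.1, p₀) := by
      intro m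
      induction m with
      | zero => intro x; rfl
      | succ m ih =>
        intro x
        rw [pow_succ', Module.End.mul_apply, Module.End.mul_apply, dqL_apply, dqL_apply, ih, ih]
    rw [e] at this
    rw [hH, this, pow_succ, Module.End.mul_apply, dqL_const, map_zero]
    rfl

theorem maj_succ_ge {R : ℝ} (hR : 0 ≤ R) {n : ℕ} (hn : 1 ≤ n) : R / 2 * maj R n ≤ maj R (n + 1) := by
  have hn0 : (1:ℝ) ≤ n := by exact_mod_cast hn
  have e : maj R (n + 1) = maj R n * R * ((n : ℝ) ^ 2 / (n + 1)) := by
    unfold maj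
    rw [Nat.factorial_succ]
    push_cast
    field_simp
    ring
  rw [e]
  have := maj_nonneg hR n
  have h2 : (1:ℝ) / 2 ≤ (n : ℝ) ^ 2 / (n + 1) := by
    rw [div_le_div_iff₀ (by norm_num) (by positivity)]
    nlinarith
  calc R / 2 * maj R n = maj R n * R * (1 / 2) := by ring
    _ ≤ _ := by gcongr

/-- Factorial bounds, uniform in the step, for all difference quotients of the gradient. -/
theorem exists_dqL_bound (hw : WaveSystem p₀ g κ α K Γ h ξ η u V) (hα : 0 < α) (hα1 : α < 1)
    (hp₀ : p₀ < 0) (hg : 0 ≤ g) :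
    ∃ δ R, 0 < δ ∧ 0 < R ∧ ∀ (ε : ℝ) (k : ℕ), 1 ≤ k →
      HB p₀ α ((dqL ε ^ k) ξ) (δ * maj R k) ∧ HB p₀ α ((dqL ε ^ k) η) (δ * maj R k) := by
  have hK := hw.K_pos hp₀.le
  obtain ⟨L, A, hL, hA, hcoef⟩ := exists_maj_coef K
  have hlam : 0 < min (K⁻¹ ^ 3) (K⁻¹ ^ 4) := by positivity
  obtain ⟨C, hC, hS⟩ := EllipticSystem.schauder hα hα1 hlam hL hp₀
  set δ := min 1 (min (1 / (16 * K)) (1 / (32 * C * A + 1))) with hδ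
  have hδ0 : 0 < δ := by positivity
  have hδ1 : δ ≤ 1 := min_le_left _ _
  have hδK : 8 * K * 1 * δ ≤ 1 / 2 := by
    have : δ ≤ 1 / (16 * K) := (min_le_right _ _).trans (min_le_left _ _)
    rw [le_div_iff₀ (by positivity)] at this
    linarith
  have hδA : 16 * C * A * δ ≤ 1 / 2 := by
    have : δ ≤ 1 / (32 * C * A + 1) := (min_le_right _ _).trans (min_le_right _ _)
    rw [le_div_iff₀ (by positivity)] at this
    linarith
  set R := 4 * C * (1 + g) * K / δ + 8 * C * (1 + g) with hR
  have hR0 : 0 < R := by positivity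
  have hR1 : 2 * C * (1 + g) * K ≤ 1 / 2 * (δ * R) := by
    have : δ * R = 4 * C * (1 + g) * K + δ * (8 * C * (1 + g)) := by
      rw [hR]; field_simp
    have h2 : 0 ≤ δ * (8 * C * (1 + g)) := by positivity
    linarith
  have hR2 : 2 * C * (1 + g) ≤ 1 / 2 * (R / 2) := by
    have : 0 ≤ 4 * C * (1 + g) * K / δ := by positivity
    linarith
  refine ⟨δ, R, hδ0, hR0, fun ε k => ?_⟩
  induction k using Nat.strong_induction_on with
  | _ k ih =>
    intro hk
    obtain ⟨n, rfl⟩ : ∃ n, k = n + 1 := ⟨k - 1, by omega⟩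
    have hξ : Maj p₀ α ε δ R n ξ K 1 :=
      ⟨zero_le_one, hw.ξ_bound, fun j h1 h2 => by rw [one_mul]; exact (ih j (by omega) h1).1⟩
    have hη : Maj p₀ α ε δ R n η K 1 :=
      ⟨zero_le_one, hw.η_bound, fun j h1 h2 => by rw [one_mul]; exact (ih j (by omega) h1).2⟩
    have hu := hη.inv hw.u_bound hw.u_mul hR0.le hδ0.le hδK
    rw [mul_one] at hu
    obtain ⟨ha, hb, hd⟩ := hcoef p₀ α ε δ R n ξ u hR0.le hδ0.le hδ1 hξ hu
    have hm := maj_nonneg hR0.le (n + 1)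
    obtain ⟨W, hW0, hW⟩ : ∃ W, HB p₀ α ((dqL ε ^ (n + 1)) h) W ∧
        2 * C * (1 + g) * W ≤ 1 / 2 * (δ * maj R (n + 1)) := by
      rcases Nat.eq_zero_or_pos n with rfl | hn
      · refine ⟨K, ?_, hR1.trans (le_of_eq ?_)⟩
        · rw [zero_add, pow_one]
          exact HB.dqL_of_partials hw.h_partials hw.ξ_bound ε
        · simp [maj]
      · refine ⟨δ * maj R n, ?_, ?_⟩
        · rw [pow_succ', Module.End.mul_apply]
          exact HB.dqL_of_partials (hw.h_partials.dqL_pow ε n) (ih n (by omega) hn).1 ε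
        · calc 2 * C * (1 + g) * (δ * maj R n) ≤ 1 / 2 * (R / 2) * (δ * maj R n) := by
                have := maj_nonneg hR0.le n
                gcongr
            _ = 1 / 2 * (δ * (R / 2 * maj R n)) := by ring
            _ ≤ _ := by
                gcongr
                exact maj_succ_ge hR0.le hn
    obtain ⟨f₁, f₂, v, vq, vp, hE⟩ := hw.ellipticSystem hα.le hp₀.le hg ha.zero hb.zero hd.zero
      ((ha.commutator hξ hR0.le).add (hb.commutator hη hR0.le))
      ((hb.commutator hξ hR0.le).add (hd.commutator hη hR0.le)) hW0
    obtain ⟨N₁, hN₁⟩ := hw.ξ_bound.exists_dqL_pow ε (n + 1)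
    obtain ⟨N₂, hN₂⟩ := hw.η_bound.exists_dqL_pow ε (n + 1)
    have hW00 := hW0.nonneg
    obtain ⟨h1, h2, h3⟩ := hS _ W (max N₁ N₂) _ _ _ _ _ _ _ _ _ _ _ hE (by positivity) hW00
      (hN₁.nonneg.trans (le_max_left _ _)) (hN₁.holderC.mono (le_max_left _ _))
      (hN₂.holderC.mono (le_max_right _ _)) fun x hx => hW0.abs_le hx
    set B := C * (W + (4 * (A * δ) * (1 * δ) * maj R (n + 1) +
      4 * (A * δ) * (1 * δ) * maj R (n + 1) + g * W)) with hB
    have hB0 : 0 ≤ B := by positivity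
    have hBB : B + B ≤ δ * maj R (n + 1) := by
      have : 16 * C * A * δ * (δ * maj R (n + 1)) ≤ 1 / 2 * (δ * maj R (n + 1)) := by gcongr
      have e : B + B = 2 * C * (1 + g) * W + 16 * C * A * δ * (δ * maj R (n + 1)) := by
        rw [hB]; ring
      linarith
    exact ⟨(HB.of_le hB0 hB0 (fun x hx => (h1 x hx).1) h2).mono hBB,
      (HB.of_le hB0 hB0 (fun x hx => (h1 x hx).2) h3).mono hBB⟩

end WaveSystem

/-- A continuous function with bounded second difference quotients is differentiable. -/
theorem differentiable_of_second_difference {f : ℝ → ℝ} {c : ℝ} (hf : Continuous f)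
    (h : ∀ t x : ℝ, |t⁻¹ * (t⁻¹ * (f (x + t + t) - f (x + t)) - t⁻¹ * (f (x + t) - f x))| ≤ c) :
    Differentiable ℝ f := by
  set s : ℕ → ℝ := fun n => (1 / 2 : ℝ) ^ n with hs
  have hs0 : ∀ n, s n ≠ 0 := fun n => by positivity
  set D : ℕ → ℝ → ℝ := fun n x => (s n)⁻¹ * (f (x + s n) - f x) with hD
  have hstep : ∀ n x, dist (D n x) (D (n + 1) x) ≤ c / 2 / 2 / 2 ^ n * 1 := by
    intro n x
    have h1 := h (s (n + 1)) x
    have e1 : s n = s (n + 1) + s (n + 1) := by simp only [hs, pow_succ]; ring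
    have e2 : D n x - D (n + 1) x = s (n + 1) / 2 * ((s (n + 1))⁻¹ * ((s (n + 1))⁻¹ *
        (f (x + s (n + 1) + s (n + 1)) - f (x + s (n + 1))) -
        (s (n + 1))⁻¹ * (f (x + s (n + 1)) - f x))) := by
      simp only [hD]
      rw [e1, ← add_assoc]
      have := hs0 (n + 1)
      field_simp
      ring
    have e3 : s (n + 1) / 2 = 1 / 2 / 2 / 2 ^ n := by
      simp only [hs, pow_succ, one_div, inv_pow]
      field_simp
    rw [Real.dist_eq, e2, abs_mul, e3, abs_of_pos (by positivity)]
    calc (1:ℝ) / 2 / 2 / 2 ^ n * _ ≤ 1 / 2 / 2 / 2 ^ n * c := by gcongr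
      _ = _ := by ring
  simp only [mul_one] at hstep
  have hlim : ∀ x, ∃ l, Tendsto (fun n => D n x) atTop (nhds l) := fun x =>
    cauchySeq_tendsto_of_complete (cauchySeq_of_le_geometric_two fun n => hstep n x)
  choose g hg using hlim
  have hunif : TendstoUniformly D g atTop := by
    rw [Metric.tendstoUniformly_iff]
    intro r hr
    have h0 : Tendsto (fun n : ℕ => c / 2 / 2 ^ n) atTop (nhds 0) := by
      have := (tendsto_pow_atTop_nhds_zero_of_lt_one (r := (1 / 2 : ℝ)) (by norm_num)
        (by norm_num)).const_mul (c / 2)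
      rw [mul_zero] at this
      refine this.congr fun n => ?_
      rw [one_div, inv_pow, ← div_eq_mul_inv]
    filter_upwards [h0.eventually_lt_const hr] with n hn x
    rw [dist_comm]
    exact (dist_le_of_le_geometric_two_of_tendsto (fun n => hstep n x) (hg x) n).trans_lt hn
  have hF : ∀ x, HasDerivAt (fun y => ∫ z in (0:ℝ)..y, f z) (f x) x := fun x =>
    (hf.integral_hasStrictDerivAt 0 x).hasDerivAt
  have hd : ∀ n x, HasDerivAt (fun y => (s n)⁻¹ * ((∫ z in (0:ℝ)..(y + s n), f z) -
      ∫ z in (0:ℝ)..y, f z)) (D n x) x := fun n x =>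
    (((hF (x + s n)).comp_add_const x (s n)).sub (hF x)).const_mul _
  intro x
  refine (hasDerivAt_of_tendstoUniformly hunif (Eventually.of_forall hd) (fun x => ?_)
    x).differentiableAt (f := f)
  have h1 := (hasDerivAt_iff_tendsto_slope_zero.1 (hF x))
  have h2 : Tendsto s atTop (nhdsWithin 0 {0}ᶜ) :=
    tendsto_nhdsWithin_iff.2 ⟨tendsto_pow_atTop_nhds_zero_of_lt_one (by norm_num) (by norm_num),
      Eventually.of_forall fun n => hs0 n⟩
  exact h1.comp h2

theorem HB.of_tendsto {p₀ α c : ℝ} {f : ℝ × ℝ → ℝ} {F : ℕ → ℝ × ℝ → ℝ}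
    (hF : ∀ n, HB p₀ α (F n) c) (hlim : ∀ x ∈ Obar p₀, Tendsto (fun n => F n x) atTop (nhds (f x))) :
    HB p₀ α f c := by
  choose a b ha hb hab h1 h2 using hF
  obtain ⟨a₀, ha₀, φ, hφ, hφa⟩ := (isCompact_Icc (a := (0:ℝ)) (b := c)).tendsto_subseq
    (x := a) fun n => ⟨ha n, by linarith [hb n, hab n]⟩
  refine ⟨a₀, c - a₀, ha₀.1, by linarith [ha₀.2], by linarith, fun x hx => ?_, fun x hx y hy => ?_⟩
  · exact le_of_tendsto_of_tendsto' (((hlim x hx).comp hφ.tendsto_atTop).abs) hφa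
      fun n => h1 (φ n) x hx
  · refine le_of_tendsto_of_tendsto' ((((hlim x hx).sub (hlim y hy)).comp hφ.tendsto_atTop).abs)
      ((hφa.const_sub c).mul_const _) fun n => (h2 (φ n) x hx y hy).trans ?_
    have := hab (φ n)
    gcongr
    simp only [Function.comp_apply]
    linarith

/-- The mean of the translates by `0, ε, …, (N - 1) ε`. -/
noncomputable def meanL (N : ℕ) (ε : ℝ) : Module.End ℝ (ℝ × ℝ → ℝ) :=
  (N : ℝ)⁻¹ • ∑ i ∈ Finset.range N, trL ε ^ i

theorem trL_pow_eq (ε : ℝ) (N : ℕ) : trL ε ^ N = trL (N * ε) := by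
  induction N with
  | zero => ext f x; simp [trL_apply]
  | succ N ih =>
    ext f x
    rw [pow_succ', ih, Module.End.mul_apply, trL_apply, trL_apply, trL_apply]
    push_cast
    ring_nf

theorem dqL_nat_mul (N : ℕ) (ε : ℝ) : dqL (N * ε) = meanL N ε * dqL ε := by
  unfold dqL meanL
  rw [smul_mul_smul_comm, geom_sum_mul, trL_pow_eq, mul_inv]

theorem commute_meanL_dqL (N : ℕ) (ε : ℝ) : Commute (meanL N ε) (dqL ε) :=
  (Commute.sum_left _ _ _ fun _ _ => (commute_trL_dqL ε).pow_left _).smul_left _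

theorem HB.meanL {p₀ α c : ℝ} {f : ℝ × ℝ → ℝ} (hf : HB p₀ α f c) {N : ℕ} (hN : N ≠ 0) (ε : ℝ) :
    HB p₀ α (meanL N ε f) c := by
  have h := (HB.sum (s := Finset.range N) fun i _ => hf.trL_pow ε i).smul (N : ℝ)⁻¹
  rw [Finset.sum_const, Finset.card_range, nsmul_eq_mul, abs_of_nonneg (by positivity),
    inv_mul_cancel_left₀ (by exact_mod_cast hN)] at h
  simpa [_root_.meanL] using h

theorem HB.meanL_pow {p₀ α c : ℝ} {f : ℝ × ℝ → ℝ} (hf : HB p₀ α f c) {N : ℕ} (hN : N ≠ 0) (ε : ℝ)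
    (k : ℕ) : HB p₀ α ((_root_.meanL N ε ^ k) f) c := by
  induction k with
  | zero => simpa using hf
  | succ k ih => rw [pow_succ', Module.End.mul_apply]; exact ih.meanL hN ε

/-- Uniform bounds on all horizontal difference quotients. -/
def DQBound (p₀ α : ℝ) (c : ℕ → ℝ) (f : ℝ × ℝ → ℝ) : Prop :=
  ∀ (ε : ℝ) (k : ℕ), HB p₀ α ((dqL ε ^ k) f) (c k)

theorem tendsto_dqL {f : ℝ × ℝ → ℝ} {f' : ℝ} {x : ℝ × ℝ} (h : HasDerivAt (fun t => f (t, x.2)) f' x.1) :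
    Tendsto (fun ε => dqL ε f x) (nhdsWithin 0 {0}ᶜ) (nhds f') :=
  hasDerivAt_iff_tendsto_slope_zero.1 h

theorem hasDerivAt_dqL_pow {p₀ : ℝ} {f f' : ℝ × ℝ → ℝ}
    (h : ∀ x ∈ Obar p₀, HasDerivAt (fun t => f (t, x.2)) (f' x) x.1) (ε : ℝ) (k : ℕ) :
    ∀ x ∈ Obar p₀, HasDerivAt (fun t => (dqL ε ^ k) f (t, x.2)) ((dqL ε ^ k) f' x) x.1 := by
  induction k with
  | zero => simpa using h
  | succ k ih =>
    intro x hx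
    simp only [pow_succ', Module.End.mul_apply]
    exact ((HasDerivAt.comp_add_const x.1 ε (ih (x.1 + ε, x.2) (mem_Obar_add hx))).sub
      (ih x hx)).const_mul ε⁻¹

theorem DQBound.hasDerivAt {p₀ α : ℝ} {c : ℕ → ℝ} {f : ℝ × ℝ → ℝ} (hα : 0 < α)
    (hf : DQBound p₀ α c f) : ∀ x ∈ Obar p₀, HasDerivAt (fun t => f (t, x.2)) (pd_q f x) x.1 := by
  intro x hx
  have hc : Continuous fun t => f (t, x.2) := by
    refine (hf 0 0).holderC.continuousOn hα |>.comp_continuous (f := fun t : ℝ => (t, x.2))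
      (by fun_prop) fun t => ?_
    exact mem_Obar.2 (mem_Obar.1 hx)
  refine (differentiable_of_second_difference (c := c 2) hc (fun ε t => ?_) x.1).hasDerivAt
  have := (hf ε 2).abs_le (x := (t, x.2)) (mem_Obar.2 (mem_Obar.1 hx))
  rw [pow_two, Module.End.mul_apply, dqL_apply, dqL_apply, dqL_apply] at this
  exact this

theorem DQBound.pd_q {p₀ α : ℝ} {c : ℕ → ℝ} {f : ℝ × ℝ → ℝ} (hα : 0 < α)
    (hf : DQBound p₀ α c f) : DQBound p₀ α (fun k => c (k + 1)) (pd_q f) := by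
  have hf' := hf.hasDerivAt hα
  have key : ∀ ε : ℝ, ε ≠ 0 → ∀ k, HB p₀ α ((dqL ε ^ k) (_root_.pd_q f)) (c (k + 1)) := by
    intro ε hε k
    refine HB.of_tendsto (F := fun N => dqL (ε / (N + 1 : ℕ)) ((dqL ε ^ k) f)) (fun N => ?_)
      fun x hx => ?_
    · have e : ε = (N + 1 : ℕ) * (ε / (N + 1 : ℕ)) := by
        field_simp
      have h1 := (hf (ε / (N + 1 : ℕ)) (k + 1)).meanL_pow (Nat.succ_ne_zero N) (ε / (N + 1 : ℕ)) k
      have e2 : dqL (ε / (N + 1 : ℕ)) * dqL ε ^ k =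
          meanL (N + 1) (ε / (N + 1 : ℕ)) ^ k * dqL (ε / (N + 1 : ℕ)) ^ (k + 1) := by
        have e3 : dqL ε = meanL (N + 1) (ε / (N + 1 : ℕ)) * dqL (ε / (N + 1 : ℕ)) := by
          conv_lhs => rw [e]
          rw [dqL_nat_mul]
        rw [e3, (commute_meanL_dqL _ _).mul_pow, ← mul_assoc,
          ((commute_meanL_dqL _ _).symm.pow_right k).eq, mul_assoc, ← pow_succ']
      rwa [← Module.End.mul_apply, ← e2, Module.End.mul_apply] at h1
    · refine (tendsto_dqL (hasDerivAt_dqL_pow hf' ε k x hx)).comp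
        (tendsto_nhdsWithin_iff.2 ⟨?_, Eventually.of_forall fun N => ?_⟩)
      · exact (tendsto_const_div_atTop_nhds_zero_nat ε).comp (tendsto_add_atTop_nat 1)
      · simp only [mem_compl_iff, mem_singleton_iff]
        positivity
  intro ε k
  rcases eq_or_ne ε 0 with rfl | hε
  · rcases k with _ | k
    · exact key 1 one_ne_zero 0
    · have e : (dqL (0:ℝ)) = 0 := by
        ext f x
        simp [dqL_apply]
      have := hf 0 (k + 2)
      rw [e, zero_pow (by omega), LinearMap.zero_apply] at this ⊢
      exact this
  · exact key ε hε k

theorem uniqueDiffOn_Obar {p₀ : ℝ} (hp₀ : p₀ < 0) : UniqueDiffOn ℝ (Obar p₀) :=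
  uniqueDiffOn_univ.prod (uniqueDiffOn_Icc hp₀)

theorem hasPartials_of_hasFDerivWithinAt {p₀ : ℝ} {w : ℝ × ℝ → ℝ}
    {L : ℝ × ℝ → ℝ × ℝ →L[ℝ] ℝ} (h : ∀ x ∈ Obar p₀, HasFDerivWithinAt w (L x) (Obar p₀) x) :
    HasPartials p₀ w (fun x => L x (1, 0)) (fun x => L x (0, 1)) := by
  constructor
  · intro x hx
    have h1 : HasDerivWithinAt (fun t : ℝ => (t, x.2)) ((1, 0) : ℝ × ℝ) univ x.1 :=
      ((hasDerivAt_id x.1).prodMk (hasDerivAt_const x.1 x.2)).hasDerivWithinAt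
    rw [← hasDerivWithinAt_univ]
    exact (h x hx).comp_hasDerivWithinAt x.1 h1 fun t _ => mem_Obar.2 (mem_Obar.1 hx)
  · intro x hx
    have h1 : HasDerivWithinAt (fun t : ℝ => (x.1, t)) ((0, 1) : ℝ × ℝ) (Icc p₀ 0) x.2 :=
      ((hasDerivAt_const x.2 x.1).prodMk (hasDerivAt_id x.2)).hasDerivWithinAt
    exact (h x hx).comp_hasDerivWithinAt x.2 h1 fun t ht => mem_Obar.2 ht

section HasPartials

variable {p₀ α : ℝ} {w wq wp : ℝ × ℝ → ℝ}

theorem HasPartials.congr {wq' wp' : ℝ × ℝ → ℝ} (h : HasPartials p₀ w wq wp)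
    (hq : ∀ x ∈ Obar p₀, wq' x = wq x) (hp : ∀ x ∈ Obar p₀, wp' x = wp x) :
    HasPartials p₀ w wq' wp' :=
  ⟨fun x hx => hq x hx ▸ h.fst x hx, fun x hx => hp x hx ▸ h.snd x hx⟩

theorem HasPartials.pd_q_eq (h : HasPartials p₀ w wq wp) {x : ℝ × ℝ} (hx : x ∈ Obar p₀) :
    pd_q w x = wq x := (h.fst x hx).deriv

theorem HasPartials.pd_p_eq (h : HasPartials p₀ w wq wp) (hp₀ : p₀ < 0) {x : ℝ × ℝ}
    (hx : x ∈ Obar p₀) : pd_p p₀ w x = wp x :=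
  (h.snd x hx).derivWithin (uniqueDiffOn_Icc hp₀ _ (mem_Obar.1 hx))

/-- Horizontal derivatives may be taken of both partial derivatives. -/
theorem HasPartials.pd_q {c : ℕ → ℝ} (h : HasPartials p₀ w wq wp) (hα : 0 < α)
    (hq : DQBound p₀ α c wq) (hp : DQBound p₀ α c wp) :
    HasPartials p₀ (pd_q w) (pd_q wq) (pd_q wp) := by
  have hL : ∀ y ∈ Obar p₀, HasFDerivWithinAt (_root_.pd_q w)
      (lin (_root_.pd_q wq y) (_root_.pd_q wp y)) (Obar p₀) y := by
    intro y hy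
    refine hasFDerivWithinAt_of_taylor (N := 2 * c 1) hα fun x hx => ?_
    have lim : ∀ {f f' : ℝ × ℝ → ℝ} {z : ℝ × ℝ}, HasDerivAt (fun t => f (t, z.2)) (f' z) z.1 →
        Tendsto (fun ε => _root_.dqL ε f z) (nhdsWithin 0 {0}ᶜ) (nhds (f' z)) := fun h => tendsto_dqL h
    have l1 := lim (h.fst x hx)
    have l2 := lim (h.fst y hy)
    have l3 := lim (hq.hasDerivAt hα y hy)
    have l4 := lim (hp.hasDerivAt hα y hy)
    rw [← h.pd_q_eq hx] at l1
    rw [← h.pd_q_eq hy] at l2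
    simp only [lin_apply]
    refine le_of_tendsto (((l1.sub l2).sub ((l3.mul_const _).add (l4.mul_const _))).abs)
      (Eventually.of_forall fun ε => ?_)
    have h1 := hq ε 1
    have h2 := hp ε 1
    rw [pow_one] at h1 h2
    simpa using (h.dqL ε).taylor hα.le h1.nonneg h1.holderC h2.holderC hx hy
  exact (hasPartials_of_hasFDerivWithinAt hL).congr (fun x _ => by simp) fun x _ => by simp

theorem HasPartials.pd_q_iter {c : ℕ → ℝ} (h : HasPartials p₀ w wq wp) (hα : 0 < α)
    (hq : DQBound p₀ α c wq) (hp : DQBound p₀ α c wp) (m : ℕ) :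
    HasPartials p₀ (pd_q_iter m w) (pd_q_iter m wq) (pd_q_iter m wp) := by
  induction m generalizing c w wq wp with
  | zero => exact h
  | succ m ih => exact ih (h.pd_q hα hq hp) (hq.pd_q hα) (hp.pd_q hα)

theorem DQBound.pd_q_iter {c : ℕ → ℝ} (hα : 0 < α) (hq : DQBound p₀ α c w) (m : ℕ) :
    HB p₀ α (pd_q_iter m w) (c m) := by
  induction m generalizing c w with
  | zero => exact hq 0 0
  | succ m ih => exact ih (hq.pd_q hα)

theorem HB.memCα {c : ℝ} (h : HB p₀ α w c) : MemCα α (Obar p₀) w :=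
  ⟨⟨c, fun _ hx => h.abs_le hx⟩, ⟨c, fun x hx y hy => by
    rw [dist_eq_norm]; exact h.holderC x hx y hy⟩⟩

theorem HB.norm_le {c : ℝ} (h : HB p₀ α w c) :
    supNorm (Obar p₀) w + holderSemi α (Obar p₀) w ≤ c := by
  obtain ⟨a, b, ha, hb, hab, h1, h2⟩ := h
  refine le_trans (add_le_add (Real.sSup_le ?_ ha) (Real.sSup_le ?_ hb)) hab
  · rintro _ ⟨x, hx, rfl⟩
    exact h1 x hx
  · rintro _ ⟨x, hx, y, hy, hxy, rfl⟩
    have := Real.rpow_pos_of_pos (dist_pos.2 hxy) α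
    rw [div_le_iff₀ this, dist_eq_norm]
    exact h2 x hx y hy

theorem HasPartials.memC1α {c₀ c₁ c₂ : ℝ} (h : HasPartials p₀ w wq wp) (hp₀ : p₀ < 0) (hα : 0 < α)
    (h0 : HB p₀ α w c₀) (h1 : HB p₀ α wq c₁) (h2 : HB p₀ α wp c₂) :
    MemC1α p₀ α w ∧ norm1α p₀ α w ≤ c₀ + c₁ + c₂ := by
  have h1' : HB p₀ α (_root_.pd_q w) c₁ := h1.congr fun x hx => h.pd_q_eq hx
  have h2' : HB p₀ α (pd_p p₀ w) c₂ := h2.congr fun x hx => h.pd_p_eq hp₀ hx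
  have hd : ∀ x ∈ Obar p₀, HasFDerivWithinAt w (lin (wq x) (wp x)) (Obar p₀) x := fun x hx =>
    h.hasFDerivWithinAt hα (h1.nonneg.trans (le_max_left c₁ c₂))
      (h1.holderC.mono (le_max_left _ _)) (h2.holderC.mono (le_max_right _ _)) hx
  refine ⟨⟨?_, h0.memCα, h1'.memCα, h2'.memCα⟩, ?_⟩
  · have hu := uniqueDiffOn_Obar hp₀
    have := (contDiffOn_succ_iff_hasFDerivWithinAt_of_uniqueDiffOn (𝕜 := ℝ) (n := 0) (f := w)
      hu).2 ⟨by simp, fun x => lin (wq x) (wp x), ?_, hd⟩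
    · simpa using this
    · rw [contDiffOn_zero]
      unfold lin
      exact ((h1.holderC.continuousOn hα).smul continuousOn_const).add
        ((h2.holderC.continuousOn hα).smul continuousOn_const)
  · unfold norm1α
    linarith [h0.norm_le, h1'.norm_le, h2'.norm_le]

end HasPartials

theorem exists_factorial_bound {δ R : ℝ} (hδ : 0 ≤ δ) (hR : 0 < R) : ∃ L : ℝ, 1 < L ∧
    ∀ m : ℕ, 3 ≤ m → δ * maj R (m - 1) + δ * maj R m + δ * maj R m ≤
      L ^ (m - 2) * (m - 3).factorial := by
  set S := max R 1 with hS
  have hS1 : 1 ≤ S := le_max_right _ _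
  have hRS : R ≤ S := le_max_left _ _
  refine ⟨(9 * δ * S ^ 2 + 1) * (2 * S), ?_, fun m hm => ?_⟩
  · have : 0 ≤ 9 * δ * S ^ 2 := by positivity
    nlinarith
  · obtain ⟨n, rfl⟩ : ∃ n, m = n + 3 := ⟨m - 3, by omega⟩
    rw [show n + 3 - 1 = n + 2 by omega, show n + 3 - 2 = n + 1 by omega,
      show n + 3 - 3 = n by omega]
    have b1 : maj R (n + 2) ≤ n.factorial * S ^ (n + 3) := by
      have e : maj R (n + 2) = n.factorial * (R ^ (n + 2)) * (((n : ℝ) + 1) / (n + 2)) := by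
        unfold maj
        rw [Nat.factorial_succ, Nat.factorial_succ]
        push_cast
        field_simp
        ring
      have l1 : ((n : ℝ) + 1) / (n + 2) ≤ 1 := by
        rw [div_le_one (by positivity)]; linarith
      have l2 : R ^ (n + 2) ≤ S ^ (n + 3) :=
        (pow_le_pow_left₀ hR.le hRS _).trans (pow_le_pow_right₀ hS1 (by omega))
      rw [e]
      calc _ ≤ n.factorial * S ^ (n + 3) * 1 := by gcongr
        _ = _ := mul_one _
    have b2 : maj R (n + 3) ≤ n.factorial * S ^ (n + 3) * (n + 3) := by
      have e : maj R (n + 3) = n.factorial * (R ^ (n + 3)) *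
          (((n : ℝ) + 1) * (n + 2) / (n + 3)) := by
        unfold maj
        rw [Nat.factorial_succ, Nat.factorial_succ, Nat.factorial_succ]
        push_cast
        field_simp
        ring
      have l1 : ((n : ℝ) + 1) * (n + 2) / (n + 3) ≤ n + 3 := by
        rw [div_le_iff₀ (by positivity)]; nlinarith [(Nat.cast_nonneg n : (0:ℝ) ≤ n)]
      rw [e]
      gcongr
    have l3 : (2 * (n : ℝ) + 7) ≤ 9 * 2 ^ (n + 1) := by
      have : (n : ℝ) + 1 ≤ 2 ^ (n + 1) := by exact_mod_cast (Nat.lt_two_pow_self (n := n + 1)).le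
      have : (1:ℝ) ≤ 2 ^ (n + 1) := one_le_pow₀ (by norm_num)
      linarith
    have l4 : 9 * δ * S ^ 2 ≤ (9 * δ * S ^ 2 + 1) ^ (n + 1) := by
      have h0 : 0 ≤ 9 * δ * S ^ 2 := by positivity
      calc 9 * δ * S ^ 2 ≤ (9 * δ * S ^ 2 + 1) ^ 1 := by linarith
        _ ≤ _ := pow_le_pow_right₀ (by linarith) (by omega)
    calc δ * maj R (n + 2) + δ * maj R (n + 3) + δ * maj R (n + 3) ≤
        δ * (n.factorial * S ^ (n + 3)) + δ * (n.factorial * S ^ (n + 3) * (n + 3)) +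
          δ * (n.factorial * S ^ (n + 3) * (n + 3)) := by gcongr
      _ = δ * S ^ 2 * (2 * n + 7) * (S ^ (n + 1) * n.factorial) := by ring
      _ ≤ δ * S ^ 2 * (9 * 2 ^ (n + 1)) * (S ^ (n + 1) * n.factorial) := by gcongr
      _ = 9 * δ * S ^ 2 * ((2 * S) ^ (n + 1) * n.factorial) := by ring
      _ ≤ (9 * δ * S ^ 2 + 1) ^ (n + 1) * ((2 * S) ^ (n + 1) * n.factorial) := by gcongr
      _ = _ := by simp only [mul_pow, mul_assoc]

theorem MemCα.exists_HB {p₀ α : ℝ} {f : ℝ × ℝ → ℝ} (h : MemCα α (Obar p₀) f) :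
    ∃ c, HB p₀ α f c := by
  obtain ⟨⟨M, hM⟩, ⟨C, hC⟩⟩ := h
  refine ⟨|M| + |C|, HB.of_le (abs_nonneg _) (abs_nonneg _)
    (fun x hx => (hM x hx).trans (le_abs_self _)) fun x hx y hy => ?_⟩
  rw [← dist_eq_norm]
  refine (hC x hx y hy).trans ?_
  have := le_abs_self C
  gcongr

theorem MemC1α.hasPartials {p₀ α : ℝ} {h : ℝ × ℝ → ℝ} (hp₀ : p₀ < 0) (hh : MemC1α p₀ α h) :
    HasPartials p₀ h (pd_q h) (pd_p p₀ h) := by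
  have h1 := hasPartials_of_hasFDerivWithinAt (p₀ := p₀) (w := h) fun x hx =>
    ((hh.1.differentiableOn one_ne_zero) x hx).hasFDerivWithinAt
  exact h1.congr (fun x hx => h1.pd_q_eq hx) fun x hx => h1.pd_p_eq hp₀ hx

theorem closure_Oset {p₀ : ℝ} (hp₀ : p₀ < 0) : closure (Oset p₀) = Obar p₀ := by
  unfold Oset Obar
  rw [closure_prod_eq, closure_univ, closure_Ioo hp₀.ne]

theorem HB.inv {p₀ α c δ : ℝ} {f : ℝ × ℝ → ℝ} (hf : HB p₀ α f c) (hδ : 0 < δ)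
    (h : ∀ x ∈ Obar p₀, δ ≤ f x) : HB p₀ α (fun x => (f x)⁻¹) (δ⁻¹ + δ⁻¹ * δ⁻¹ * c) := by
  have hc := hf.nonneg
  refine HB.of_le (by positivity) (by positivity) (fun x hx => ?_) fun x hx y hy => ?_
  · have := hδ.trans_le (h x hx)
    rw [abs_of_pos (by positivity)]
    exact inv_anti₀ hδ (h x hx)
  · have h1 := hδ.trans_le (h x hx)
    have h2 := hδ.trans_le (h y hy)
    have e : (f x)⁻¹ - (f y)⁻¹ = -((f x)⁻¹ * (f y)⁻¹ * (f x - f y)) := by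
      field_simp
      ring
    rw [e, abs_neg, abs_mul, abs_of_pos (by positivity), mul_assoc (δ⁻¹ * δ⁻¹)]
    exact mul_le_mul (mul_le_mul (inv_anti₀ hδ (h x hx)) (inv_anti₀ hδ (h y hy)) (by positivity)
      (by positivity)) (hf.holderC x hx y hy) (abs_nonneg _) (by positivity)

/-- A weak solution gives rise to a `WaveSystem`. -/
theorem IsWeakSolution.exists_waveSystem {p₀ g Q α : ℝ} {γ : ℝ → ℝ} {h : ℝ × ℝ → ℝ}
    (hsol : IsWeakSolution p₀ g Q α γ h) (hp₀ : p₀ < 0) (hα : 0 < α)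
    (hγ : IntegrableOn γ (Set.Ioo p₀ 0)) :
    ∃ K Γ u V, WaveSystem p₀ g (Q / 2) α K Γ h (pd_q h) (pd_p p₀ h) u V := by
  obtain ⟨c₁, h1⟩ := hsol.reg.2.2.1.exists_HB
  obtain ⟨c₂, h2⟩ := hsol.reg.2.2.2.exists_HB
  obtain ⟨δ, hδ, hle⟩ := hsol.infpos
  have hle' : ∀ x ∈ Obar p₀, δ ≤ pd_p p₀ h x := fun x hx => by
    rw [← closure_Oset hp₀] at hx
    refine le_on_closure hle continuousOn_const ?_ hx
    rw [closure_Oset hp₀]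
    exact h2.holderC.continuousOn hα
  have hu := h2.inv hδ hle'
  set u : ℝ × ℝ → ℝ := fun x => (pd_p p₀ h x)⁻¹ with hu_def
  set Γ : ℝ → ℝ := fun p => ∫ s in (0:ℝ)..p, γ s with hΓ
  have hΓc : ContinuousOn Γ (Icc p₀ 0) := by
    have hi : IntegrableOn γ (uIcc p₀ 0) := by
      rw [uIcc_of_le hp₀.le]
      rwa [integrableOn_Icc_iff_integrableOn_Ioo]
    have := intervalIntegral.continuousOn_primitive_interval' (a := 0)
      (hi.intervalIntegrable) right_mem_uIcc
    rwa [uIcc_of_le hp₀.le] at this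
  set A₀ : ℝ × ℝ → ℝ := fun x => Γ x.2 + (1 + pd_q h x ^ 2) * u x ^ 2 / 2 with hA₀
  set B₀ : ℝ × ℝ → ℝ := fun x => pd_q h x * u x with hB₀
  have c1 := h1.holderC.continuousOn hα
  have c2 := hu.holderC.continuousOn hα
  have hAc : ContinuousOn A₀ (Obar p₀) :=
    (hΓc.comp continuousOn_snd fun x hx => mem_Obar.1 hx).add
      (((continuousOn_const.add (c1.pow 2)).mul (c2.pow 2)).div_const 2)
  have hBc : ContinuousOn B₀ (Obar p₀) := c1.mul c2
  set cl : ℝ × ℝ → ℝ × ℝ := fun x => (x.1, max p₀ (min x.2 0)) with hcl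
  have hclc : Continuous cl := by fun_prop
  have hclm : ∀ x, cl x ∈ Obar p₀ := fun x =>
    mem_Obar.2 ⟨le_max_left _ _, max_le hp₀.le (min_le_right _ _)⟩
  have hcle : ∀ x ∈ Obar p₀, cl x = x := fun x hx => by
    rw [mem_Obar] at hx
    simp only [hcl]
    rw [min_eq_left hx.2, max_eq_right hx.1]
  obtain ⟨V, hV⟩ := exists_potential hp₀ (hAc.comp_continuous hclc hclm)
    (hBc.comp_continuous hclc hclm) fun ψ hψ => by
      rw [← hsol.weak ψ hψ]
      refine setIntegral_congr_fun (MeasurableSet.univ.prod measurableSet_Ioo) fun x hx => ?_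
      have hx' : x ∈ Obar p₀ := mem_Obar.2 ⟨hx.2.1.le, hx.2.2.le⟩
      have hne : pd_p p₀ h x ≠ 0 := (hδ.trans_le (hle' x hx')).ne'
      simp only [Function.comp_apply, hcle x hx', hA₀, hB₀, hu_def, hΓ]
      field_simp
  have m1 : c₁ ≤ max c₁ (max c₂ (δ⁻¹ + δ⁻¹ * δ⁻¹ * c₂)) := le_max_left _ _
  have m2 : c₂ ≤ max c₁ (max c₂ (δ⁻¹ + δ⁻¹ * δ⁻¹ * c₂)) :=
    (le_max_left _ _).trans (le_max_right _ _)
  have m3 : δ⁻¹ + δ⁻¹ * δ⁻¹ * c₂ ≤ max c₁ (max c₂ (δ⁻¹ + δ⁻¹ * δ⁻¹ * c₂)) :=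
    (le_max_right _ _).trans (le_max_right _ _)
  refine ⟨_, Γ, u, V, ⟨hsol.reg.hasPartials hp₀, hV.congr (fun x hx => by rw [Function.comp_apply, hcle x hx])
    (fun x hx => by rw [Function.comp_apply, hcle x hx]), fun x hx => ?_, fun x hx => ?_, h1.mono m1, h2.mono m2,
    hu.mono m3, fun q => ?_, hsol.bottom⟩⟩
  · exact inv_mul_cancel₀ (hδ.trans_le (hle' x hx)).ne'
  · exact inv_pos.2 (hδ.trans_le (hle' x hx))
  · have h0 : ((q, 0) : ℝ × ℝ) ∈ Obar p₀ := mem_Obar.2 ⟨hp₀.le, le_rfl⟩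
    have hne : pd_p p₀ h (q, 0) ≠ 0 := (hδ.trans_le (hle' _ h0)).ne'
    have ht := hsol.top q
    simp only [hΓ, hu_def, intervalIntegral.integral_same]
    field_simp
    linarith

/-- If `h` is a `2π`-periodic (in `q`) weak solution of the gravity
water-wave problem, then `∂_q^m h ∈ C^{1+α}(Ω̄)` for all `m ∈ ℕ`, and there is a constant
`L > 1` with `‖∂_q^m h‖_{1+α} ≤ L^(m-2) * (m-3)!` for all integers `m ≥ 3`. -/
theorem regularity_of_periodic_weak_solutions
    (p₀ g Q α : ℝ) (hp₀ : p₀ < 0) (hg : 0 < g) (hα : α ∈ Set.Ioo (0 : ℝ) 1)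
    (γ : ℝ → ℝ) (hγ : MeasureTheory.IntegrableOn γ (Set.Ioo p₀ 0))
    (h : ℝ × ℝ → ℝ) (hsol : IsWeakSolution p₀ g Q α γ h)
    (hper : ∀ q p : ℝ, h (q + 2 * Real.pi, p) = h (q, p)) :
    (∀ m : ℕ, MemC1α p₀ α (pd_q_iter m h)) ∧
    ∃ L : ℝ, 1 < L ∧ ∀ m : ℕ, 3 ≤ m →
      norm1α p₀ α (pd_q_iter m h) ≤ L ^ (m - 2) * (m - 3).factorial := by
  obtain ⟨K, Γ, u, V, hw⟩ := hsol.exists_waveSystem hp₀ hα.1 hγ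
  obtain ⟨δ, R, hδ, hR, hbd⟩ := hw.exists_dqL_bound hα.1 hα.2 hp₀ hg.le
  obtain ⟨L, hL, hbound⟩ := exists_factorial_bound hδ.le hR
  set c : ℕ → ℝ := fun k => if k = 0 then K else δ * maj R k with hc
  have hξ : DQBound p₀ α c (pd_q h) := fun ε k => by
    rcases Nat.eq_zero_or_pos k with rfl | hk
    · simpa [hc] using hw.ξ_bound
    · simpa [hc, hk.ne'] using (hbd ε k hk).1
  have hη : DQBound p₀ α c (pd_p p₀ h) := fun ε k => by
    rcases Nat.eq_zero_or_pos k with rfl | hk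
    · simpa [hc] using hw.η_bound
    · simpa [hc, hk.ne'] using (hbd ε k hk).2
  have key : ∀ m, MemC1α p₀ α (pd_q_iter (m + 1) h) ∧
      norm1α p₀ α (pd_q_iter (m + 1) h) ≤ c m + c (m + 1) + c (m + 1) := fun m =>
    (hw.h_partials.pd_q_iter hα.1 hξ hη (m + 1)).memC1α hp₀ hα.1 (hξ.pd_q_iter hα.1 m)
      (hξ.pd_q_iter hα.1 (m + 1)) (hη.pd_q_iter hα.1 (m + 1))
  refine ⟨fun m => ?_, L, hL, fun m hm => ?_⟩
  · rcases m with _ | m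
    · exact hsol.reg
    · exact (key m).1
  · obtain ⟨n, rfl⟩ : ∃ n, m = n + 1 := ⟨m - 1, by omega⟩
    refine (key n).2.trans (le_trans (le_of_eq ?_) (hbound (n + 1) hm))
    simp only [hc, Nat.add_sub_cancel, if_neg (by omega : n ≠ 0), if_neg (Nat.succ_ne_zero n)]
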